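/- Let χ be a non-principal Dirichlet character and assume GRH for χ, χχ₋₄, χ² and χ²χ₋₄. Fix c ∈ (0,1/8) and ε > 0. Then there is a constant C = C(χ, c, ε) such that for every pair ρ₁ = 1/2 + iγ₁, ρ₂ = 1/2 + iγ₂ of non-trivial zeros of L(s,χ)L(s,χχ₋₄) different from 1/2, every X ≥ 2 and all sufficiently small radii r, |(1/X) ∫_X^{2X} (∫_{H_{ρ₁}} F(s₁,χ) x^{s₁}/s₁ ds₁) · conj(∫_{H_{ρ₂}} F(s₂,χ) x^{s₂}/s₂ ds₂) dx| ≤ C · X ((log X)^{−3/2} + r^{3/2} X^r)² / (((|γ₁|+1)(|γ₂|+1))^{1−c−ε} (1 + |γ₁ − γ₂|)). -/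

import Mathlib

open Complex Filter
open scoped Classical

noncomputable section

/-- `n` is a sum of two squares. -/
def IsSum2Sq (n : ℕ) : Prop := ∃ a b : ℕ, n = a ^ 2 + b ^ 2

/-- The Dirichlet L-function `L(s,χ)` (junk value `0` if the modulus is `0`). -/
noncomputable def LVal {N : ℕ} (χ : DirichletCharacter ℂ N) (s : ℂ) : ℂ :=
  if h : N = 0 then 0 else
    haveI : NeZero N := ⟨h⟩
    DirichletCharacter.LFunction χ s

/-- GRH for `L(s,χ)`: all zeros with `0 < Re s < 1` have real part `1/2`. -/
def GRH {N : ℕ} (χ : DirichletCharacter ℂ N) : Prop :=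
  ∀ s : ℂ, 0 < s.re → s.re < 1 → LVal χ s = 0 → s.re = 1 / 2

/-- The unique non-principal Dirichlet character modulo 4. -/
noncomputable def chiNeg4 : DirichletCharacter ℂ 4 := ZMod.χ₄.ringHomComp (Int.castRingHom ℂ)

/-- The product `χ ⋅ χ₋₄`, as a Dirichlet character modulo `4q`. -/
noncomputable def mulChiNeg4 {q : ℕ} (χ : DirichletCharacter ℂ q) : DirichletCharacter ℂ (4 * q) :=
  DirichletCharacter.changeLevel (dvd_mul_left q 4) χ *
    DirichletCharacter.changeLevel (dvd_mul_right 4 q) chiNeg4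

/-- `S(x;q,a)`, the number of sums of two squares `n ≤ x` with `n ≡ a (mod q)`. -/
noncomputable def Scount (q a : ℕ) (x : ℝ) : ℕ :=
  ((Finset.Icc 1 ⌊x⌋₊).filter (fun m => IsSum2Sq m ∧ (m : ZMod q) = (a : ZMod q))).card

/-- The sequence `n ↦ 1_S(n) χ(n)`. -/
noncomputable def STwist {q : ℕ} (χ : DirichletCharacter ℂ q) (n : ℕ) : ℂ :=
  if IsSum2Sq n then χ (n : ZMod q) else 0

/-- `∑_{n ≤ x, n ∈ S} χ(n)`. -/
noncomputable def SSum {q : ℕ} (χ : DirichletCharacter ℂ q) (x : ℝ) : ℂ :=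
  ∑ n ∈ Finset.Icc 1 ⌊x⌋₊, STwist χ n

/-- A set of positive integers has natural density one. -/
def HasDensityOne (P : ℕ → Prop) : Prop :=
  Tendsto (fun n : ℕ => (((Finset.Icc 1 n).filter P).card : ℝ) / n) atTop (nhds 1)

/-- The integral of `f` over the truncated Hankel contour around `ρ`, with horizontal extent
`c` and radius `r`; the two horizontal segments are taken as boundary values from below
(lower segment, traversed rightwards, `arg(s-ρ) = -π`) and from above (upper segment,
traversed leftwards, `arg(s-ρ) = π`), and the circle `|s-ρ| = r` is traversed
anticlockwise. -/
noncomputable def hankelIntegral (f : ℂ → ℂ) (ρ : ℂ) (c r : ℝ) : ℂ :=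
  limUnder (nhdsWithin (0 : ℝ) (Set.Ioi 0)) (fun ε =>
    ((∫ σ in (ρ.re - c)..(ρ.re - r), f (σ + (ρ.im - ε) * I))
      + ∫ θ in (-Real.pi)..Real.pi, f (ρ + r * Complex.exp (θ * I)) * (I * r * Complex.exp (θ * I)))
      - ∫ σ in (ρ.re - c)..(ρ.re - r), f (σ + (ρ.im + ε) * I))

/-- The integral `∫ g(s) |ds|` of a nonnegative density `g` over the truncated Hankel
contour around `ρ` (horizontal extent `c`, radius `r`), horizontal segments again taken
as boundary values from below resp. above. -/
noncomputable def hankelAbsIntegral (g : ℂ → ℝ) (ρ : ℂ) (c r : ℝ) : ℝ :=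
  limUnder (nhdsWithin (0 : ℝ) (Set.Ioi 0)) (fun ε =>
    (∫ σ in (ρ.re - c)..(ρ.re - r), g (σ + (ρ.im - ε) * I))
      + (∫ θ in (-Real.pi)..Real.pi, g (ρ + r * Complex.exp (θ * I)) * r)
      + ∫ σ in (ρ.re - c)..(ρ.re - r), g (σ + (ρ.im + ε) * I))

/-- The constant `C_q` of the paper. -/
noncomputable def Cconst (q : ℕ) : ℝ :=
  (2 * Real.pi ^ (-(1 / 4 : ℝ)) / Real.Gamma (1 / 4)) *
    (∏' p : Nat.Primes, if (p : ℕ) % 4 = 3 then (1 - (p : ℝ) ^ (-(2:ℝ))) ^ (-(1 / 4 : ℝ)) else 1) *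
    ∏ p ∈ q.primeFactors.filter (fun p => p % 4 = 3), (1 - 1 / (p : ℝ)) ^ ((1 : ℝ) / 2)

theorem sum_range_periodic_sub_bounded {N : ℕ} [NeZero N] (Φ : ZMod N → ℂ) :
    ∃ K : ℝ, ∀ n : ℕ, ‖∑ k ∈ Finset.range n, Φ k - (∑ j, Φ j) / N * n‖ ≤ K := by
  have hbase : ∑ k ∈ Finset.range N, Φ k = ∑ j, Φ j := by
    refine Finset.sum_nbij' (fun k => (k : ZMod N)) ZMod.val (by simp)
      (fun j _ => Finset.mem_range.2 (ZMod.val_lt j)) ?_ (by simp) (by simp)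
    intro k hk
    exact ZMod.val_cast_of_lt (Finset.mem_range.1 hk)
  have hper : Function.Periodic
      (fun n : ℕ => ∑ k ∈ Finset.range n, Φ k - (∑ j, Φ j) / N * n) N := by
    intro n
    have hN : (N : ℂ) ≠ 0 := Nat.cast_ne_zero.2 (NeZero.ne N)
    simp only
    rw [add_comm n N, Finset.sum_range_add, hbase]
    simp only [Nat.cast_add, ZMod.natCast_self, zero_add]
    field_simp
    ring
  refine ⟨∑ m ∈ Finset.range N, ‖∑ k ∈ Finset.range m, Φ k - (∑ j, Φ j) / N * m‖, fun n => ?_⟩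
  have h := hper.map_mod_nat n
  rw [← h]
  exact Finset.single_le_sum
    (f := fun m : ℕ => ‖∑ k ∈ Finset.range m, Φ k - (∑ j, Φ j) / N * m‖)
    (fun _ _ => norm_nonneg _) (Finset.mem_range.2 (Nat.mod_lt n (NeZero.pos N)))

/-- The deviation of the summatory function of a periodic function from its linear main term,
cut off below `1`. -/
def sumError {N : ℕ} (Φ : ZMod N → ℂ) [NeZero N] (t : ℝ) : ℂ :=
  if 1 < t then ∑ k ∈ Finset.Icc 1 ⌊t⌋₊, Φ k - (∑ j, Φ j) / N * t else 0

theorem sum_Icc_one_eq_sum_range_sub {E : Type*} [AddCommGroup E] (f : ℕ → E) (n : ℕ) :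
    ∑ k ∈ Finset.Icc 1 n, f k = ∑ k ∈ Finset.range (n + 1), f k - f 0 := by
  rw [Finset.sum_range_succ', add_sub_cancel_right, Finset.range_eq_Ico, Finset.sum_Ico_add']
  rfl

theorem sumError_bounded {N : ℕ} [NeZero N] (Φ : ZMod N → ℂ) :
    ∃ K : ℝ, 0 ≤ K ∧ ∀ t : ℝ, ‖sumError Φ t‖ ≤ K := by
  obtain ⟨K, hK⟩ := sum_range_periodic_sub_bounded Φ
  have hK0 : 0 ≤ K := (norm_nonneg _).trans (hK 0)
  set c : ℂ := (∑ j, Φ j) / N with hc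
  refine ⟨K + ‖Φ 0‖ + ‖c‖, by positivity, fun t => ?_⟩
  unfold sumError
  split_ifs with ht
  · rw [sum_Icc_one_eq_sum_range_sub (fun k : ℕ => Φ k)]
    have h1 := hK (⌊t⌋₊ + 1)
    have h2 : ‖c * ((⌊t⌋₊ + 1 : ℕ) - t : ℂ)‖ ≤ ‖c‖ := by
      rw [norm_mul]
      refine mul_le_of_le_one_right (norm_nonneg _) ?_
      have h3 := Nat.floor_le (zero_le_one.trans ht.le)
      have h4 := Nat.lt_floor_add_one t
      have : ((⌊t⌋₊ + 1 : ℕ) - t : ℂ) = ((⌊t⌋₊ + 1 - t : ℝ) : ℂ) := by push_cast; ring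
      rw [this, norm_real, Real.norm_eq_abs, abs_le]
      constructor <;> linarith
    calc _ = ‖(∑ k ∈ Finset.range (⌊t⌋₊ + 1), Φ k - c * (⌊t⌋₊ + 1 : ℕ)) - Φ 0
            + c * ((⌊t⌋₊ + 1 : ℕ) - t : ℂ)‖ := by congr 1; simp; ring
      _ ≤ _ := by
        refine (norm_add_le _ _).trans (add_le_add ((norm_sub_le _ _).trans ?_) h2)
        gcongr
  · simp; positivity

theorem measurable_sumError {N : ℕ} [NeZero N] (Φ : ZMod N → ℂ) : Measurable (sumError Φ) := by
  refine Measurable.ite measurableSet_Ioi ?_ measurable_const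
  refine Measurable.sub ?_ (by fun_prop)
  exact (measurable_from_nat (f := fun n : ℕ => ∑ k ∈ Finset.Icc 1 n, Φ (k : ZMod N))).comp
    Nat.measurable_floor

theorem differentiableAt_mellin_sumError {N : ℕ} [NeZero N] (Φ : ZMod N → ℂ) {s : ℂ}
    (hs : 0 < s.re) : DifferentiableAt ℂ (fun s => mellin (sumError Φ) (-s)) s := by
  obtain ⟨K, hK0, hK⟩ := sumError_bounded Φ
  have : DifferentiableAt ℂ (mellin (sumError Φ)) (-s) := by
    refine mellin_differentiableAt_of_isBigO_rpow (a := 0) (b := -s.re - 1) ?_ ?_ (by simpa) ?_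
      (by simp)
    · apply MeasureTheory.LocallyIntegrable.locallyIntegrableOn
      refine (MeasureTheory.locallyIntegrable_const (K : ℝ)).mono
        (measurable_sumError Φ).aestronglyMeasurable (Eventually.of_forall fun t => ?_)
      rw [Real.norm_of_nonneg hK0]
      exact hK t
    · refine Asymptotics.IsBigO.of_bound K (Eventually.of_forall fun t => ?_)
      simpa using hK t
    · refine Asymptotics.IsBigO.of_bound 0 ?_
      filter_upwards [Ioo_mem_nhdsGT (zero_lt_one (α := ℝ))] with t ht
      simp [sumError, not_lt.2 ht.2.le]
  exact this.comp s differentiableAt_id.neg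

theorem mellin_sumError_eq {N : ℕ} [NeZero N] (Φ : ZMod N → ℂ) (s : ℂ) :
    mellin (sumError Φ) (-s) = ∫ t in Set.Ioi (1 : ℝ), sumError Φ t * (t : ℂ) ^ (-(s + 1)) := by
  rw [mellin, ← MeasureTheory.setIntegral_eq_of_subset_of_forall_sdiff_eq_zero measurableSet_Ioi
    (Set.Ioi_subset_Ioi zero_le_one)]
  · refine MeasureTheory.setIntegral_congr_fun measurableSet_Ioi fun t _ => ?_
    simp only [smul_eq_mul]
    rw [mul_comm, neg_add']
  · intro t ht
    simp only [Set.mem_sdiff, Set.mem_Ioi, not_lt] at ht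
    simp [sumError, not_lt.2 ht.2]

theorem norm_mellin_sumError_le {N : ℕ} [NeZero N] (Φ : ZMod N → ℂ) :
    ∃ K : ℝ, 0 ≤ K ∧ ∀ s : ℂ, 1 / 4 ≤ s.re → ‖mellin (sumError Φ) (-s)‖ ≤ K := by
  obtain ⟨K, hK0, hK⟩ := sumError_bounded Φ
  have hInt : MeasureTheory.IntegrableOn (fun t : ℝ => K * t ^ (-(5 / 4) : ℝ)) (Set.Ioi 1) :=
    (integrableOn_Ioi_rpow_of_lt (by norm_num) one_pos).const_mul K
  refine ⟨∫ t in Set.Ioi (1 : ℝ), K * t ^ (-(5 / 4) : ℝ), ?_, fun s hs => ?_⟩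
  · refine MeasureTheory.setIntegral_nonneg measurableSet_Ioi fun t ht => ?_
    have : (0 : ℝ) < t := one_pos.trans ht
    positivity
  · rw [mellin_sumError_eq]
    refine MeasureTheory.norm_integral_le_of_norm_le hInt ?_
    refine (MeasureTheory.ae_restrict_iff' measurableSet_Ioi).2 (Eventually.of_forall fun t ht => ?_)
    have ht1 : (1 : ℝ) < t := ht
    rw [norm_mul, norm_cpow_eq_rpow_re_of_pos (one_pos.trans ht1)]
    refine mul_le_mul (hK t) ?_ (by positivity) hK0
    refine Real.rpow_le_rpow_of_exponent_le ht1.le ?_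
    simp
    linarith

theorem LFunction_eq_mellin_of_one_lt_re {N : ℕ} [NeZero N] (Φ : ZMod N → ℂ) {s : ℂ}
    (hs : 1 < s.re) : ZMod.LFunction Φ s =
      s * (mellin (sumError Φ) (-s) + (∑ j, Φ j) / N / (s - 1)) := by
  set c : ℂ := (∑ j, Φ j) / N with hc
  obtain ⟨K, hK0, hK⟩ := sumError_bounded Φ
  have hsum : ∀ t : ℝ, 1 < t →
      ∑ k ∈ Finset.Icc 1 ⌊t⌋₊, Φ k = sumError Φ t + c * t := by
    intro t ht
    simp [sumError, ht, hc]
  have hO : (fun n : ℕ => ∑ k ∈ Finset.Icc 1 n, Φ k) =O[atTop] fun n : ℕ => (n : ℝ) ^ (1 : ℝ) := by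
    refine Asymptotics.IsBigO.of_bound (K + ‖c‖) ?_
    filter_upwards [eventually_gt_atTop 1] with n hn
    have hn' : (1 : ℝ) < n := by exact_mod_cast hn
    have h := hsum n hn'
    rw [Nat.floor_natCast] at h
    rw [h, Real.rpow_one, Real.norm_natCast]
    refine (norm_add_le _ _).trans ?_
    rw [norm_mul, norm_real, Real.norm_natCast]
    have := hK n
    nlinarith
  rw [ZMod.LFunction_eq_LSeries Φ hs, LSeries_eq_mul_integral _ zero_le_one hs
    (ZMod.LSeriesSummable_of_one_lt_re Φ hs) hO, mellin_sumError_eq]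
  congr 1
  have hs1 : (-s).re < -1 := by simpa using hs
  have h1 : ∫ t in Set.Ioi (1 : ℝ), c * (t : ℂ) ^ (-s) = c / (s - 1) := by
    rw [MeasureTheory.integral_const_mul, integral_Ioi_cpow_of_lt hs1 one_pos]
    have : s - 1 ≠ 0 := fun h => by
      rw [sub_eq_zero.1 h] at hs; simp at hs
    have h' : -s + 1 ≠ 0 := fun h => this (by linear_combination -h)
    simp
    field_simp
    ring
  rw [← h1, ← MeasureTheory.integral_add]
  · refine MeasureTheory.setIntegral_congr_fun measurableSet_Ioi fun t ht => ?_
    have ht0 : (t : ℂ) ≠ 0 := ofReal_ne_zero.2 (one_pos.trans (Set.mem_Ioi.1 ht)).ne'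
    rw [hsum t ht, add_mul, neg_add, cpow_add _ _ ht0, cpow_neg_one]
    field_simp
  · refine MeasureTheory.Integrable.bdd_mul (c := K) ?_
      (measurable_sumError Φ).aestronglyMeasurable (Eventually.of_forall hK)
    exact integrableOn_Ioi_cpow_of_lt (by simp; linarith) one_pos
  · exact (integrableOn_Ioi_cpow_of_lt hs1 one_pos).const_mul c

theorem LFunction_eq_mellin {N : ℕ} [NeZero N] (Φ : ZMod N → ℂ) {s : ℂ}
    (hs : 0 < s.re) (him : s.im ≠ 0) : ZMod.LFunction Φ s =
      s * (mellin (sumError Φ) (-s) + (∑ j, Φ j) / N / (s - 1)) := by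
  have key : ∀ U : Set ℂ, IsOpen U → IsPreconnected U → (∀ z ∈ U, 0 < z.re ∧ z.im ≠ 0) →
      (∃ z ∈ U, 1 < z.re) → s ∈ U → ZMod.LFunction Φ s =
      s * (mellin (sumError Φ) (-s) + (∑ j, Φ j) / N / (s - 1)) := by
    rintro U hUo hUc hU ⟨z, hzU, hz⟩ hsU
    have hne : ∀ w ∈ U, w ≠ 1 := fun w hw h => (hU w hw).2 (by simp [h])
    have hf : AnalyticOnNhd ℂ (ZMod.LFunction Φ) U := DifferentiableOn.analyticOnNhd
      (fun w hw => (ZMod.differentiableAt_LFunction Φ w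
        (Or.inl (hne w hw))).differentiableWithinAt) hUo
    have hg : AnalyticOnNhd ℂ (fun s =>
        s * (mellin (sumError Φ) (-s) + (∑ j, Φ j) / N / (s - 1))) U := by
      refine DifferentiableOn.analyticOnNhd (fun w hw => ?_) hUo
      have h1 := differentiableAt_mellin_sumError Φ (hU w hw).1
      have h2 : w - 1 ≠ 0 := sub_ne_zero.2 (hne w hw)
      refine (differentiableAt_id.mul (h1.add ?_)).differentiableWithinAt
      exact (differentiableAt_const _).div (differentiableAt_id.sub_const 1) h2
    refine hf.eqOn_of_preconnected_of_eventuallyEq hg hUc hzU ?_ hsU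
    filter_upwards [(isOpen_lt continuous_const continuous_re).mem_nhds hz] with w hw
    exact LFunction_eq_mellin_of_one_lt_re Φ hw
  rcases lt_or_gt_of_ne him with h | h
  · refine key {z | 0 < z.re ∧ z.im < 0} ?_ ?_ (fun z hz => ⟨hz.1, hz.2.ne⟩)
      ⟨2 - I, by simp, by simp⟩ ⟨hs, h⟩
    · exact (isOpen_lt continuous_const continuous_re).inter
        (isOpen_lt continuous_im continuous_const)
    · exact ((convex_halfSpace_re_gt 0).inter (convex_halfSpace_im_lt 0)).isPreconnected
  · refine key {z | 0 < z.re ∧ 0 < z.im} ?_ ?_ (fun z hz => ⟨hz.1, hz.2.ne'⟩)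
      ⟨2 + I, by simp, by simp⟩ ⟨hs, h⟩
    · exact (isOpen_lt continuous_const continuous_re).inter
        (isOpen_lt continuous_const continuous_im)
    · exact ((convex_halfSpace_re_gt 0).inter (convex_halfSpace_im_gt 0)).isPreconnected

/-- Linear growth of periodic `L`-functions in `1/4 ≤ Re s ≤ 4`. -/
theorem norm_LFunction_le_mul_abs_im {N : ℕ} [NeZero N] (Φ : ZMod N → ℂ) :
    ∃ K : ℝ, 0 ≤ K ∧ ∀ s : ℂ, 1 / 4 ≤ s.re → s.re ≤ 4 → 1 ≤ |s.im| →
      ‖ZMod.LFunction Φ s‖ ≤ K * |s.im| := by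
  obtain ⟨K, hK0, hK⟩ := norm_mellin_sumError_le Φ
  refine ⟨5 * (K + ‖(∑ j, Φ j) / N‖), by positivity, fun s h1 h4 him => ?_⟩
  have h0 : s.im ≠ 0 := fun h => by simp [h] at him; linarith
  rw [LFunction_eq_mellin Φ (by linarith) h0, norm_mul]
  have hs : ‖s‖ ≤ 5 * |s.im| := by
    refine (norm_le_abs_re_add_abs_im s).trans ?_
    rw [abs_of_nonneg (by linarith : 0 ≤ s.re)]
    linarith
  have hd : 1 ≤ ‖s - 1‖ := him.trans (by simpa using abs_im_le_norm (s - 1))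
  have h2 : ‖mellin (sumError Φ) (-s) + (∑ j, Φ j) / N / (s - 1)‖ ≤ K + ‖(∑ j, Φ j) / N‖ := by
    refine (norm_add_le _ _).trans (add_le_add (hK s h1) ?_)
    rw [norm_div]
    exact div_le_self (norm_nonneg _) hd
  calc _ ≤ (5 * |s.im|) * (K + ‖(∑ j, Φ j) / N‖) := by gcongr
    _ = _ := by ring

/-- A sublinear form of Hadamard's three circles theorem combined with Borel–Carathéodory. -/
theorem norm_le_add_of_re_le {r ρ R b η : ℝ} (hr : 0 < r) (hrρ : r < ρ) (hρR : ρ < R)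
    (hb : 0 < b) (hη : 0 < η) :
    ∃ C : ℝ, ∀ Λ : ℝ, 0 < Λ → ∀ g : ℂ → ℂ, DifferentiableOn ℂ g (Metric.ball 0 R) → g 0 = 0 →
      (∀ z ∈ Metric.ball (0 : ℂ) R, (g z).re ≤ Λ) →
      (∀ z ∈ Metric.ball (0 : ℂ) (2 * r), (g z).re ≤ b) →
      ∀ z : ℂ, ‖z‖ ≤ ρ → ‖g z‖ ≤ η * Λ + C := by
  have hρ0 : 0 < ρ := hr.trans hrρ
  by_cases h2r : R < 2 * r
  · refine ⟨2 * b * ρ / (R - ρ), fun Λ hΛ g hg h0 h1 h2 z hz => ?_⟩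
    have hz' : z ∈ Metric.ball (0 : ℂ) R := by simpa using hz.trans_lt hρR
    have := borelCaratheodory_zero hb hg
      (fun w hw => h2 w (Metric.ball_subset_ball h2r.le hw)) (by linarith) hz' h0
    have h3 : 2 * b * ‖z‖ / (R - ‖z‖) ≤ 2 * b * ρ / (R - ρ) := by
      gcongr
    have := mul_pos hη hΛ
    linarith
  push Not at h2r
  set σ := (ρ + R) / 2 with hσ
  have hσ1 : ρ < σ := by rw [hσ]; linarith
  have hσ2 : σ < R := by rw [hσ]; linarith
  have hσ0 : 0 < σ := by linarith
  set l := Real.log r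
  set u := Real.log σ
  have hlu : l < u := Real.log_lt_log hr (by linarith)
  set τ := (Real.log ρ - l) / (u - l) with hτ
  have hτ0 : 0 < τ := div_pos (sub_pos.2 (Real.log_lt_log hr hrρ)) (sub_pos.2 hlu)
  have hτ1 : τ < 1 := by
    rw [hτ, div_lt_one (sub_pos.2 hlu)]
    linarith [Real.log_lt_log (by linarith) hσ1]
  set k := 2 * σ / (R - σ) with hk
  have hk0 : 0 < k := div_pos (by linarith) (by linarith)
  -- choose the AM-GM parameter
  set η' := η / (k * τ) with hη'
  have hη'0 : 0 < η' := by positivity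
  refine ⟨(1 - τ) * (2 * b * η' ^ (-(τ / (1 - τ)))), fun Λ hΛ g hg h0 h1 h2 z hz => ?_⟩
  have hbig : ∀ w : ℂ, ‖w‖ ≤ σ → ‖g w‖ ≤ k * Λ := by
    intro w hw
    have hw' : w ∈ Metric.ball (0 : ℂ) R := by simpa using hw.trans_lt hσ2
    refine (borelCaratheodory_zero hΛ hg (fun w hw => h1 w hw) (by linarith) hw' h0).trans ?_
    calc 2 * Λ * ‖w‖ / (R - ‖w‖) ≤ 2 * Λ * σ / (R - σ) := by
          gcongr
      _ = k * Λ := by rw [hk]; ring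
  have hsmall : ∀ w : ℂ, ‖w‖ ≤ r → ‖g w‖ ≤ 2 * b := by
    intro w hw
    have hw' : w ∈ Metric.ball (0 : ℂ) (2 * r) := by simpa using (by linarith : ‖w‖ < 2 * r)
    refine (borelCaratheodory_zero hb (hg.mono (Metric.ball_subset_ball h2r))
      (fun w hw => h2 w hw) (by linarith) hw' h0).trans ?_
    calc 2 * b * ‖w‖ / (2 * r - ‖w‖) ≤ 2 * b * r / (2 * r - r) := by
          gcongr
          linarith
      _ = 2 * b := by field_simp; ring
  have hsphere : ∀ w : ℂ, ‖w‖ = ρ → ‖g w‖ ≤ (2 * b) ^ (1 - τ) * (k * Λ) ^ τ := by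
    intro w hw
    have hw0 : w ≠ 0 := by
      rintro rfl
      simp at hw
      linarith
    have hre : (Complex.log w).re = Real.log ρ := by rw [Complex.log_re, hw]
    have hmem : Complex.log w ∈ HadamardThreeLines.verticalClosedStrip l u := by
      simp only [HadamardThreeLines.verticalClosedStrip, Set.mem_preimage, hre]
      exact ⟨(Real.log_lt_log hr hrρ).le, (Real.log_lt_log (by linarith) hσ1).le⟩
    have hnorm : ∀ z : ℂ, z.re ≤ u → ‖Complex.exp z‖ ≤ σ := by
      intro z hz
      rw [Complex.norm_exp, ← Real.exp_log hσ0]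
      exact Real.exp_le_exp.2 hz
    have hd : DifferentiableOn ℂ (fun z => g (Complex.exp z)) {z | z.re < Real.log R} := by
      refine hg.comp Complex.differentiable_exp.differentiableOn fun z hz => ?_
      simp only [Set.mem_ofPred_eq] at hz
      rw [mem_ball_zero_iff, Complex.norm_exp]
      calc Real.exp z.re < Real.exp (Real.log R) := Real.exp_lt_exp.2 hz
        _ = R := Real.exp_log (by linarith)
    have hcl : closure (HadamardThreeLines.verticalStrip l u) ⊆ {z | z.re < Real.log R} := by
      have : closure (HadamardThreeLines.verticalStrip l u) ⊆ {z | z.re ≤ u} := by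
        refine closure_minimal (fun z hz => ?_) (isClosed_le continuous_re continuous_const)
        exact le_of_lt hz.2
      exact fun z hz => (this hz).trans_lt (Real.log_lt_log hσ0 hσ2)
    have := HadamardThreeLines.norm_le_interp_of_mem_verticalClosedStrip' (f := fun z => g (exp z))
      (a := 2 * b) (b := k * Λ) hlu hmem
      (DifferentiableOn.diffContOnCl (hd.mono hcl))
      ⟨k * Λ, by
        rintro _ ⟨z, hz, rfl⟩
        exact hbig _ (hnorm z hz.2)⟩
      (fun z hz => hsmall _ (by
        rw [Complex.norm_exp, show z.re = l from hz, Real.exp_log hr]))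
      (fun z hz => hbig _ (hnorm z (le_of_eq hz)))
    rwa [Complex.exp_log hw0, hre, ← hτ] at this
  have hmax : ‖g z‖ ≤ (2 * b) ^ (1 - τ) * (k * Λ) ^ τ := by
    refine norm_le_of_forall_mem_frontier_norm_le (U := Metric.ball (0 : ℂ) ρ)
      Metric.isBounded_ball ?_ ?_ ?_
    · refine DifferentiableOn.diffContOnCl (hg.mono ?_)
      rw [closure_ball _ (by linarith)]
      exact Metric.closedBall_subset_ball hρR
    · intro w hw
      rw [frontier_ball _ (by linarith), mem_sphere_zero_iff_norm] at hw
      exact hsphere w hw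
    · rw [closure_ball _ (by linarith)]
      simpa using hz
  refine hmax.trans ?_
  have hx : (2 * b) ^ (1 - τ) * (k * Λ) ^ τ
      = (2 * b * η' ^ (-(τ / (1 - τ)))) ^ (1 - τ) * (η' * (k * Λ)) ^ τ := by
    rw [Real.mul_rpow (by positivity : 0 ≤ 2 * b) (by positivity : 0 ≤ η' ^ (-(τ / (1 - τ)))),
      Real.mul_rpow hη'0.le (by positivity),
      ← Real.rpow_mul hη'0.le]
    have : -(τ / (1 - τ)) * (1 - τ) = -τ := by
      have : (1 - τ) ≠ 0 := by linarith
      field_simp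
    rw [this, Real.rpow_neg hη'0.le]
    have : η' ^ τ ≠ 0 := by positivity
    field_simp
  rw [hx]
  refine (Real.geom_mean_le_arith_mean2_weighted (by linarith) hτ0.le (by positivity)
    (by positivity) (by ring)).trans (le_of_eq ?_)
  have : τ * (η' * (k * Λ)) = η * Λ := by
    rw [hη']; field_simp
  rw [this]; ring

theorem exists_log_ball {L : ℂ → ℂ} {c : ℂ} {R : ℝ}
    (hL : DifferentiableOn ℂ L (Metric.ball c R)) (h0 : ∀ z ∈ Metric.ball c R, L z ≠ 0) (hR : 0 < R) :
    ∃ g : ℂ → ℂ, DifferentiableOn ℂ g (Metric.ball c R) ∧ g c = 0 ∧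
      ∀ z ∈ Metric.ball c R, L z = L c * exp (g z) := by
  have hd : DifferentiableOn ℂ (fun z => deriv L z / L z) (Metric.ball c R) :=
    (hL.deriv Metric.isOpen_ball).div hL h0
  obtain ⟨g, hgc, hg⟩ := hd.isExactOn_ball.with_val_at c 0
  have hg' : DifferentiableOn ℂ g (Metric.ball c R) := fun z hz =>
    (hg z hz).differentiableAt.differentiableWithinAt
  refine ⟨g, hg', hgc, fun z hz => ?_⟩
  have hder : ∀ w ∈ Metric.ball c R, HasDerivAt (fun w => L w * exp (-g w)) 0 w := by
    intro w hw
    have h1 : HasDerivAt L (deriv L w) w :=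
      (hL.differentiableAt (Metric.isOpen_ball.mem_nhds hw)).hasDerivAt
    have := h1.mul (hg w hw).neg.cexp
    refine this.congr_deriv ?_
    have := h0 w hw
    rw [mul_neg, mul_neg, mul_comm (exp _), ← mul_assoc, mul_div_cancel₀ _ this]
    ring
  have hconst := Metric.isOpen_ball.is_const_of_deriv_eq_zero
    (convex_ball c R).isPreconnected
    (fun w hw => (hder w hw).differentiableAt.differentiableWithinAt)
    (fun w hw => (hder w hw).deriv) hz (Metric.mem_ball_self hR)
  simp only [hgc, neg_zero, exp_zero, mul_one] at hconst
  rw [← hconst, mul_assoc, ← exp_add]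
  simp

/-- Littlewood's bound for an abstract `L`-function without zeros right of `1/2`. -/
theorem littlewood_bound {L : ℂ → ℂ} {K B : ℝ}
    (hd : ∀ s : ℂ, 1 / 2 < s.re → 1 ≤ |s.im| → DifferentiableAt ℂ L s)
    (hne : ∀ s : ℂ, 1 / 2 < s.re → 1 ≤ |s.im| → L s ≠ 0)
    (hK : ∀ s : ℂ, 1 / 2 < s.re → s.re ≤ 4 → 1 ≤ |s.im| → ‖L s‖ ≤ K * |s.im|)
    (hB : ∀ s : ℂ, 5 / 4 ≤ s.re → ‖L s‖ ≤ B ∧ ‖(L s)⁻¹‖ ≤ B)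
    {δ η : ℝ} (hδ : 0 < δ) (hη : 0 < η) :
    ∃ C : ℝ, 0 ≤ C ∧ ∀ s : ℂ, 1 / 2 + δ ≤ s.re → 3 ≤ |s.im| →
      ‖L s‖ ≤ C * |s.im| ^ η ∧ ‖(L s)⁻¹‖ ≤ C * |s.im| ^ η := by
  have hB0 : 0 ≤ B := (norm_nonneg _).trans (hB 2 (by norm_num)).1
  set δ' := min δ 1 with hδ'
  have hδ'0 : 0 < δ' := by positivity
  have hδ'1 : δ' ≤ 1 := min_le_right _ _
  set b := max 1 (Real.log (B * B + 1)) with hb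
  have hb0 : 0 < b := by positivity
  obtain ⟨C, hC⟩ := norm_le_add_of_re_le (r := 3 / 8) (ρ := 3 / 2 - δ' / 2) (R := 3 / 2) (b := b)
    (η := η) (by norm_num) (by linarith) (by linarith) hb0 hη
  set C' := max C 0
  set K' := max 3 (3 * K * B) with hK'
  have hK'1 : 3 ≤ K' := le_max_left _ _
  refine ⟨(B + 1) * Real.exp C' * K' ^ η, by positivity, ?_⟩
  intro s hs him
  have hbase : ∀ x : ℝ, x ≤ B → x ≤ (B + 1) * Real.exp C' * K' ^ η * |s.im| ^ η := by
    intro x hx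
    have h1 : 1 ≤ Real.exp C' := Real.one_le_exp (le_max_right _ _)
    have h2 : 1 ≤ K' ^ η := Real.one_le_rpow (by linarith) hη.le
    have h3 : 1 ≤ |s.im| ^ η := Real.one_le_rpow (by linarith) hη.le
    have h4 : 1 ≤ Real.exp C' * K' ^ η * |s.im| ^ η :=
      one_le_mul_of_one_le_of_one_le (one_le_mul_of_one_le_of_one_le h1 h2) h3
    nlinarith
  by_cases hs2 : 5 / 4 ≤ s.re
  · exact ⟨hbase _ (hB s hs2).1, hbase _ (hB s hs2).2⟩
  push Not at hs2
  set s₀ : ℂ := ⟨2, s.im⟩ with hs₀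
  have hball : ∀ z ∈ Metric.ball s₀ (3 / 2), 1 / 2 < z.re ∧ z.re ≤ 4 ∧ 1 ≤ |z.im| ∧
      |z.im| ≤ 2 * |s.im| := by
    intro z hz
    rw [Metric.mem_ball, dist_eq_norm] at hz
    have h1 := (abs_re_le_norm (z - s₀)).trans_lt hz
    have h2 := (abs_im_le_norm (z - s₀)).trans_lt hz
    simp only [hs₀, sub_re, sub_im, abs_lt] at h1 h2
    have h3 : |s.im| - |z.im| ≤ |s.im - z.im| := abs_sub_abs_le_abs_sub _ _
    have h4 : |z.im| - |s.im| ≤ |z.im - s.im| := abs_sub_abs_le_abs_sub _ _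
    rw [abs_sub_comm] at h3
    have h5 : |z.im - s.im| < 3 / 2 := abs_lt.2 h2
    refine ⟨by linarith, by linarith, by linarith, by linarith⟩
  obtain ⟨g, hg, hg0, hgL⟩ := exists_log_ball (L := L) (c := s₀) (R := 3 / 2)
    (fun z hz => (hd z (hball z hz).1 (hball z hz).2.2.1).differentiableWithinAt)
    (fun z hz => hne z (hball z hz).1 (hball z hz).2.2.1) (by norm_num)
  have hs₀B := hB s₀ (by simp [hs₀]; norm_num)
  have hs₀0 : L s₀ ≠ 0 := hne s₀ (by simp [hs₀]; norm_num) (by simp [hs₀]; linarith)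
  have hreg : ∀ z ∈ Metric.ball s₀ (3 / 2), ∀ M, ‖L z‖ ≤ M → Real.exp (g z).re ≤ M * B := by
    intro z hz M hM
    have h1 := hgL z hz
    have h2 : exp (g z) = L z * (L s₀)⁻¹ := by rw [h1]; field_simp
    rw [← Complex.norm_exp, h2, norm_mul]
    gcongr
    · exact (norm_nonneg _).trans hM
    · exact hs₀B.2
  have hΛ : 0 < Real.log (K' * |s.im|) := Real.log_pos (by nlinarith)
  have hmap : ∀ z ∈ Metric.ball (0 : ℂ) (3 / 2), s₀ + z ∈ Metric.ball s₀ (3 / 2) := by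
    intro z hz
    simpa [Metric.mem_ball, dist_eq_norm] using hz
  have hgs := hC (Real.log (K' * |s.im|)) hΛ (fun z => g (s₀ + z))
    (hg.comp (by fun_prop) hmap) (by simpa using hg0) (by
      intro z hz
      obtain ⟨h1, h2, h3, h4⟩ := hball _ (hmap z hz)
      have hk := hK _ h1 h2 h3
      have hK0 : 0 ≤ K := by
        by_contra! h
        have := (norm_nonneg _).trans hk
        nlinarith
      rw [Real.le_log_iff_exp_le (by positivity)]
      refine (hreg _ (hmap z hz) _ hk).trans ?_
      calc K * |(s₀ + z).im| * B ≤ K * (2 * |s.im|) * B := by gcongr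
        _ ≤ 3 * K * B * |s.im| := by
          have : 0 ≤ K * B * |s.im| := by positivity
          nlinarith
        _ ≤ K' * |s.im| := by
          gcongr
          exact le_max_right _ _) (by
      intro z hz
      have hz1 : z ∈ Metric.ball (0 : ℂ) (3 / 2) :=
        Metric.ball_subset_ball (by norm_num) hz
      have hz2 : 5 / 4 ≤ (s₀ + z).re := by
        rw [mem_ball_zero_iff] at hz
        have := (abs_re_le_norm z).trans_lt hz
        rw [abs_lt] at this
        simp [hs₀]
        linarith
      have h1 := hreg _ (hmap z hz1) _ (hB _ hz2).1
      refine le_trans ?_ (le_max_right 1 _)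
      rw [Real.le_log_iff_exp_le (by positivity)]
      linarith) (s - s₀) (by
      have : s - s₀ = ((s.re - 2 : ℝ) : ℂ) := by
        apply Complex.ext <;> simp [hs₀]
      rw [this, norm_real, Real.norm_eq_abs, abs_of_neg (by linarith)]
      have : δ' ≤ δ := min_le_left _ _
      linarith)
  simp only [add_sub_cancel] at hgs
  have hsb : s ∈ Metric.ball s₀ (3 / 2) := by
    have : s - s₀ = ((s.re - 2 : ℝ) : ℂ) := by
      apply Complex.ext <;> simp [hs₀]
    rw [Metric.mem_ball, dist_eq_norm, this, norm_real, Real.norm_eq_abs,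
      abs_of_neg (by linarith)]
    linarith
  have hexp : Real.exp ‖g s‖ ≤ Real.exp C' * (K' * |s.im|) ^ η := by
    rw [Real.rpow_def_of_pos (by positivity), ← Real.exp_add]
    apply Real.exp_le_exp.2
    have : C ≤ C' := le_max_left _ _
    linarith
  have hfin : (B + 1) * Real.exp C' * K' ^ η * |s.im| ^ η
      = (B + 1) * (Real.exp C' * (K' * |s.im|) ^ η) := by
    rw [Real.mul_rpow (by positivity) (by positivity)]; ring
  rw [hfin, hgL s hsb, mul_inv, ← Complex.exp_neg, norm_mul, norm_mul]
  constructor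
  · refine mul_le_mul (hs₀B.1.trans (by linarith)) (le_trans ?_ hexp) (norm_nonneg _)
      (by positivity)
    exact norm_exp_le_exp_norm _
  · refine mul_le_mul (hs₀B.2.trans (by linarith)) (le_trans ?_ hexp) (norm_nonneg _)
      (by positivity)
    simpa using norm_exp_le_exp_norm (-g s)

theorem norm_LSeries_le {σ : ℝ} (hσ : 1 < σ) :
    ∃ B : ℝ, 0 ≤ B ∧ ∀ (f : ℕ → ℂ) (s : ℂ) (M : ℝ), (∀ n, n ≠ 0 → ‖f n‖ ≤ M) → σ ≤ s.re →
      ‖LSeries f s‖ ≤ M * B := by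
  have hs1 : LSeriesSummable 1 (σ : ℂ) := by
    rw [LSeriesSummable_one_iff]; simpa using hσ
  refine ⟨∑' n, ‖LSeries.term 1 (σ : ℂ) n‖, tsum_nonneg fun _ => norm_nonneg _,
    fun f s M hM hs => ?_⟩
  have hM0 : 0 ≤ M := (norm_nonneg _).trans (hM 1 one_ne_zero)
  have hb : ∀ n, ‖LSeries.term f s n‖ ≤ M * ‖LSeries.term 1 (σ : ℂ) n‖ := by
    intro n
    rcases eq_or_ne n 0 with rfl | hn
    · simp
    have h1 : ‖LSeries.term f s n‖ ≤ ‖LSeries.term (fun _ => (M : ℂ)) s n‖ :=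
      LSeries.norm_term_le s (by simpa [abs_of_nonneg hM0] using hM n hn)
    have h2 := LSeries.norm_term_le_of_re_le_re (fun _ => (M : ℂ)) (s := σ) (s' := s)
      (by simpa using hs) n
    refine (h1.trans h2).trans (le_of_eq ?_)
    rw [LSeries.norm_term_eq, LSeries.norm_term_eq]
    simp [hn, abs_of_nonneg hM0]
    ring
  rw [← tsum_mul_left]
  have hsum : Summable fun n => M * ‖LSeries.term 1 (σ : ℂ) n‖ :=
    (hs1.norm).mul_left M
  exact tsum_of_norm_bounded hsum.hasSum hb

theorem LVal_eq {N : ℕ} [NeZero N] (χ : DirichletCharacter ℂ N) :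
    LVal χ = DirichletCharacter.LFunction χ := by
  funext s
  rw [LVal, dif_neg (NeZero.ne N)]

theorem LFunction_ne_zero_of_GRH {N : ℕ} [NeZero N] {χ : DirichletCharacter ℂ N} (h : GRH χ)
    {s : ℂ} (hs : 1 / 2 < s.re) (hs1 : s.im ≠ 0) : DirichletCharacter.LFunction χ s ≠ 0 := by
  by_cases h1 : 1 ≤ s.re
  · exact DirichletCharacter.LFunction_ne_zero_of_one_le_re χ
      (Or.inr fun h => hs1 (by simp [h])) h1
  · intro h0
    have := h s (by linarith) (by linarith) (by rw [LVal_eq]; exact h0)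
    linarith

theorem LFunction_norm_le_of_five_fourths_le {N : ℕ} [NeZero N] (χ : DirichletCharacter ℂ N) :
    ∃ B : ℝ, 0 ≤ B ∧ ∀ s : ℂ, 5 / 4 ≤ s.re → ‖DirichletCharacter.LFunction χ s‖ ≤ B ∧
      ‖(DirichletCharacter.LFunction χ s)⁻¹‖ ≤ B := by
  obtain ⟨B, hB0, hB⟩ := norm_LSeries_le (σ := 5 / 4) (by norm_num)
  refine ⟨B, hB0, fun s hs => ?_⟩
  have hs' : 1 < s.re := by linarith
  rw [DirichletCharacter.LFunction_eq_LSeries χ hs']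
  have hmu := DirichletCharacter.LSeries.mul_mu_eq_one χ hs'
  rw [inv_eq_of_mul_eq_one_right hmu]
  constructor
  · simpa using hB _ s 1 (fun n _ => χ.norm_le_one _) hs
  · refine (hB _ s 1 (fun n _ => ?_) hs).trans (by simp)
    rw [Pi.mul_apply, norm_mul]
    refine mul_le_one₀ (χ.norm_le_one _) (norm_nonneg _) ?_
    have := ArithmeticFunction.abs_moebius_le_one (n := n)
    rw [Complex.norm_intCast]
    exact_mod_cast this

theorem LFunction_littlewood {N : ℕ} [NeZero N] {χ : DirichletCharacter ℂ N} (h : GRH χ)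
    {δ η : ℝ} (hδ : 0 < δ) (hη : 0 < η) :
    ∃ C : ℝ, 0 ≤ C ∧ ∀ s : ℂ, 1 / 2 + δ ≤ s.re → 3 ≤ |s.im| →
      ‖DirichletCharacter.LFunction χ s‖ ≤ C * |s.im| ^ η ∧
        ‖(DirichletCharacter.LFunction χ s)⁻¹‖ ≤ C * |s.im| ^ η := by
  obtain ⟨K, hK0, hK⟩ := norm_LFunction_le_mul_abs_im (fun j => χ j)
  obtain ⟨B, hB0, hB⟩ := LFunction_norm_le_of_five_fourths_le χ
  have h0 : ∀ s : ℂ, 1 ≤ |s.im| → s.im ≠ 0 := fun s hs h0 => by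
    rw [h0] at hs; simp at hs; linarith
  refine littlewood_bound (K := K) (B := B) (fun s _ h1 => ?_) (fun s h1 h2 => ?_)
    (fun s h1 h2 h3 => ?_) hB hδ hη
  · exact DirichletCharacter.differentiableAt_LFunction χ s (Or.inl fun h => h0 s h1 (by simp [h]))
  · exact LFunction_ne_zero_of_GRH h h1 (h0 s h2)
  · exact hK s (by linarith) h2 h3

theorem norm_Gamma_three_halves_le (t : ℝ) :
    ‖Gamma (3 / 2 + t * I)‖ ≤ (1 + |t|) * (3 * Real.exp (-(Real.pi * |t|) / 2)) := by
  have h1 : Gamma (3 / 2 + t * I) = (1 / 2 + t * I) * Gamma (1 / 2 + t * I) := by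
    rw [← Complex.Gamma_add_one]
    · congr 1; ring
    · intro h
      have := congrArg Complex.re h
      simp at this
  have h2 : ‖Gamma (1 / 2 + t * I)‖ ^ 2 = Real.pi / Real.cosh (Real.pi * t) := by
    have h3 := Complex.Gamma_mul_Gamma_one_sub (1 / 2 + t * I)
    have h4 : Gamma (1 - (1 / 2 + t * I)) = (starRingEnd ℂ) (Gamma (1 / 2 + t * I)) := by
      rw [← Complex.Gamma_conj]
      congr 1
      apply Complex.ext <;> simp
      norm_num
    rw [h4, Complex.mul_conj] at h3
    have h5 : Complex.sin (Real.pi * (1 / 2 + t * I)) = (Real.cosh (Real.pi * t) : ℂ) := by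
      rw [show (Real.pi : ℂ) * (1 / 2 + t * I) = ((Real.pi * t : ℝ) : ℂ) * I + Real.pi / 2 by
        push_cast; ring, Complex.sin_add_pi_div_two, Complex.cos_mul_I]
      push_cast; rfl
    rw [h5] at h3
    rw [← Complex.normSq_eq_norm_sq]
    exact_mod_cast h3
  have h6 : ‖Gamma (1 / 2 + t * I)‖ ≤ 3 * Real.exp (-(Real.pi * |t|) / 2) := by
    refine abs_le_of_sq_le_sq' ?_ (by positivity) |>.2
    rw [h2, mul_pow, ← Real.exp_nat_mul]
    have h7 : Real.exp (Real.pi * |t|) / 2 ≤ Real.cosh (Real.pi * t) := by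
      rw [← Real.cosh_abs, abs_mul, abs_of_pos Real.pi_pos, Real.cosh_eq]
      have := Real.exp_pos (-(Real.pi * |t|))
      linarith
    calc Real.pi / Real.cosh (Real.pi * t) ≤ Real.pi / (Real.exp (Real.pi * |t|) / 2) := by
          gcongr
      _ = 2 * Real.pi * Real.exp (-(Real.pi * |t|)) := by
          rw [Real.exp_neg]; field_simp
      _ ≤ 3 ^ 2 * Real.exp (-(Real.pi * |t|)) := by
          gcongr
          linarith [Real.pi_lt_d2]
      _ = 3 ^ 2 * Real.exp ((2 : ℕ) * (-(Real.pi * |t|) / 2)) := by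
          congr 2; push_cast; ring
  rw [h1, norm_mul]
  gcongr
  refine (norm_add_le _ _).trans ?_
  simp
  norm_num

theorem norm_LFunction_one_sub_le {N : ℕ} [NeZero N] (Φ : ZMod N → ℂ) {s : ℂ} (hs : 0 < s.re)
    (hs' : s ≠ 1) {M : ℝ} (h1 : ‖ZMod.LFunction (ZMod.dft Φ) s‖ ≤ M)
    (h2 : ‖ZMod.LFunction (ZMod.dft fun x => Φ (-x)) s‖ ≤ M) :
    ‖ZMod.LFunction Φ (1 - s)‖ ≤ (N : ℝ) ^ (s.re - 1) * (2 * Real.pi) ^ (-s.re) * ‖Gamma s‖ *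
      (2 * Real.exp (Real.pi * |s.im| / 2) * M) := by
  rw [ZMod.LFunction_one_sub Φ (fun n h => by rw [h] at hs; simp at hs; linarith [Nat.cast_nonneg (α := ℝ) n])
    (Or.inr hs')]
  have hN : (0 : ℝ) < N := Nat.cast_pos.2 (NeZero.pos N)
  have e1 : ‖(N : ℂ) ^ (s - 1)‖ = (N : ℝ) ^ (s.re - 1) := by
    rw [show (N : ℂ) = ((N : ℝ) : ℂ) by simp, Complex.norm_cpow_eq_rpow_re_of_pos hN]
    simp
  have e2 : ‖(2 * Real.pi : ℂ) ^ (-s)‖ = (2 * Real.pi) ^ (-s.re) := by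
    rw [show (2 * Real.pi : ℂ) = ((2 * Real.pi : ℝ) : ℂ) by push_cast; ring,
      Complex.norm_cpow_eq_rpow_re_of_pos (by positivity)]
    simp
  rw [norm_mul, norm_mul, norm_mul, e1, e2]
  gcongr
  refine (norm_add_le _ _).trans ?_
  rw [norm_mul, norm_mul, Complex.norm_exp, Complex.norm_exp]
  have e3 : (Real.pi * I * s / 2).re ≤ Real.pi * |s.im| / 2 := by
    have : (Real.pi * I * s / 2).re = -(Real.pi * s.im / 2) := by
      simp; ring
    rw [this]
    have := neg_abs_le s.im
    have := Real.pi_pos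
    nlinarith
  have e4 : (-Real.pi * I * s / 2).re ≤ Real.pi * |s.im| / 2 := by
    have : (-Real.pi * I * s / 2).re = (Real.pi * s.im / 2) := by
      simp
    rw [this]
    have := le_abs_self s.im
    have := Real.pi_pos
    nlinarith
  have := Real.exp_le_exp.2 e3
  have := Real.exp_le_exp.2 e4
  calc _ ≤ Real.exp (Real.pi * |s.im| / 2) * M + Real.exp (Real.pi * |s.im| / 2) * M := by
        gcongr
    _ = _ := by ring

theorem norm_Gamma_le_Gamma_re {s : ℂ} (hs : 0 < s.re) : ‖Gamma s‖ ≤ Real.Gamma s.re := by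
  rw [Complex.Gamma_eq_integral hs, Real.Gamma_eq_integral hs, Complex.GammaIntegral]
  refine (MeasureTheory.norm_integral_le_integral_norm _).trans (le_of_eq ?_)
  refine MeasureTheory.setIntegral_congr_fun measurableSet_Ioi fun x hx => ?_
  simp only [norm_mul]
  rw [Complex.norm_cpow_eq_rpow_re_of_pos hx, norm_real, Real.norm_eq_abs,
    abs_of_pos (Real.exp_pos _)]
  simp

theorem exists_norm_LFunction_le_line {N : ℕ} [NeZero N] (Φ : ZMod N → ℂ) :
    ∃ A : ℝ, 0 ≤ A ∧ ∀ s : ℂ, s.re = -(1 / 2) → ‖ZMod.LFunction Φ s‖ ≤ A * (1 + |s.im|) := by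
  obtain ⟨B, hB0, hB⟩ := norm_LSeries_le (σ := 3 / 2) (by norm_num)
  set M := ∑ j, ‖ZMod.dft Φ j‖ + ∑ j, ‖ZMod.dft (fun x => Φ (-x)) j‖ with hM
  have hM0 : 0 ≤ M := by positivity
  refine ⟨(N : ℝ) ^ ((3 : ℝ) / 2 - 1) * (2 * Real.pi) ^ (-((3 : ℝ) / 2)) * (3 * 2 * (M * B)),
    by positivity, fun s hs => ?_⟩
  have hre : (1 - s).re = 3 / 2 := by simp [hs]; norm_num
  have hser : ∀ Ψ : ZMod N → ℂ, (∀ j, ‖Ψ j‖ ≤ M) → ‖ZMod.LFunction Ψ (1 - s)‖ ≤ M * B := by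
    intro Ψ hΨ
    rw [ZMod.LFunction_eq_LSeries _ (by rw [hre]; norm_num)]
    exact hB _ _ _ (fun n _ => hΨ _) hre.ge
  have h1 := norm_LFunction_one_sub_le Φ (s := 1 - s) (by rw [hre]; norm_num)
    (fun h => by rw [h] at hre; norm_num at hre)
    (hser _ fun j => by
      have := Finset.single_le_sum (fun i _ => norm_nonneg (ZMod.dft Φ i)) (Finset.mem_univ j)
      have h0 : 0 ≤ ∑ j, ‖ZMod.dft (fun x => Φ (-x)) j‖ := by positivity
      linarith)
    (hser _ fun j => by
      have := Finset.single_le_sum (fun i _ => norm_nonneg (ZMod.dft (fun x => Φ (-x)) i))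
        (Finset.mem_univ j)
      have h0 : 0 ≤ ∑ j, ‖ZMod.dft Φ j‖ := by positivity
      linarith)
  have hG := norm_Gamma_three_halves_le (-s.im)
  have hs' : (1 - s) = 3 / 2 + ((-s.im : ℝ) : ℂ) * I := by
    apply Complex.ext <;> simp [hs]
    norm_num
  rw [← hs', abs_neg] at hG
  rw [sub_sub_cancel, hre] at h1
  have him : |(1 - s).im| = |s.im| := by simp
  rw [him] at h1
  refine h1.trans ?_
  have hee : Real.exp (-(Real.pi * |s.im|) / 2) * Real.exp (Real.pi * |s.im| / 2) = 1 := by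
    rw [← Real.exp_add]; simp; ring
  calc _ ≤ (N : ℝ) ^ ((3 : ℝ) / 2 - 1) * (2 * Real.pi) ^ (-((3 : ℝ) / 2)) *
        ((1 + |s.im|) * (3 * Real.exp (-(Real.pi * |s.im|) / 2))) *
        (2 * Real.exp (Real.pi * |s.im| / 2) * (M * B)) := by gcongr
    _ = (N : ℝ) ^ ((3 : ℝ) / 2 - 1) * (2 * Real.pi) ^ (-((3 : ℝ) / 2)) * (3 * 2 * (M * B)) *
        (1 + |s.im|) * (Real.exp (-(Real.pi * |s.im|) / 2) * Real.exp (Real.pi * |s.im| / 2)) := by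
        ring
    _ = _ := by rw [hee, mul_one]

theorem exists_norm_LFunction_le_exp {N : ℕ} [NeZero N] (Φ : ZMod N → ℂ) :
    ∃ A : ℝ, 0 ≤ A ∧ ∀ s : ℂ, -(1 / 2) ≤ s.re → s.re ≤ 3 / 4 →
      ‖ZMod.LFunction Φ s‖ ≤ A * Real.exp (5 * |s.im|) := by
  obtain ⟨K₁, hK₁0, hK₁⟩ := norm_LFunction_le_mul_abs_im (ZMod.dft Φ)
  obtain ⟨K₂, hK₂0, hK₂⟩ := norm_LFunction_le_mul_abs_im (ZMod.dft fun x => Φ (-x))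
  obtain ⟨G, hG⟩ : ∃ G, ∀ σ ∈ Set.Icc (1 / 4 : ℝ) (3 / 2), ‖Real.Gamma σ‖ ≤ G := by
    refine isCompact_Icc.exists_bound_of_continuousOn fun σ hσ => ?_
    exact (Real.differentiableAt_Gamma fun m h => by
      have := hσ.1
      rw [h] at this
      linarith [Nat.cast_nonneg (α := ℝ) m]).continuousAt.continuousWithinAt
  obtain ⟨D, hD⟩ : ∃ D, ∀ s ∈ Set.Icc (-(1 / 2) : ℝ) (3 / 4) ×ℂ Set.Icc (-1 : ℝ) 1,
      ‖ZMod.LFunction Φ s‖ ≤ D := by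
    refine (isCompact_Icc.reProdIm isCompact_Icc).exists_bound_of_continuousOn fun s hs => ?_
    exact (ZMod.differentiableAt_LFunction Φ s (Or.inl fun h => by
      have := hs.1.2
      rw [h] at this
      norm_num at this)).continuousAt.continuousWithinAt
  set K := K₁ + K₂ with hK
  have hG0 : 0 ≤ G := (norm_nonneg _).trans (hG 1 (by norm_num))
  have hN : (1 : ℝ) ≤ N := Nat.one_le_cast.2 (NeZero.one_le)
  refine ⟨max D 0 + N * G * (2 * K), by positivity, fun s h1 h2 => ?_⟩
  rcases le_total |s.im| 1 with him | him
  · have h3 := hD s ⟨⟨h1, h2⟩, abs_le.1 him⟩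
    have h4 : 1 ≤ Real.exp (5 * |s.im|) := Real.one_le_exp (by positivity)
    have h5 : 0 ≤ N * G * (2 * K) := by positivity
    have h6 : D ≤ max D 0 := le_max_left _ _
    have h7 : 0 ≤ max D 0 := le_max_right _ _
    nlinarith
  · have hre : (1 - s).re = 1 - s.re := by simp
    have him' : |(1 - s).im| = |s.im| := by simp
    have hne : (1 - s) ≠ 1 := fun h => by
      have : (1 - s).im = 0 := by rw [h]; simp
      rw [← him', this] at him
      simp at him
      linarith
    have h3 := norm_LFunction_one_sub_le Φ (s := 1 - s) (M := K * |s.im|)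
      (by rw [hre]; linarith) hne
      ((hK₁ _ (by rw [hre]; linarith) (by rw [hre]; linarith) (by rwa [him'])).trans
        (by rw [him']; gcongr; linarith))
      ((hK₂ _ (by rw [hre]; linarith) (by rw [hre]; linarith) (by rwa [him'])).trans
        (by rw [him']; gcongr; linarith))
    rw [sub_sub_cancel, hre, him'] at h3
    have hΓ : ‖Gamma (1 - s)‖ ≤ G := by
      refine (norm_Gamma_le_Gamma_re (by rw [hre]; linarith)).trans ?_
      rw [hre]
      exact (le_abs_self _).trans (hG _ ⟨by linarith, by linarith⟩)
    have hN1 : (N : ℝ) ^ (1 - s.re - 1) ≤ N := by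
      calc (N : ℝ) ^ (1 - s.re - 1) ≤ (N : ℝ) ^ (1 : ℝ) :=
            Real.rpow_le_rpow_of_exponent_le hN (by linarith)
        _ = N := Real.rpow_one _
    have hπ : (2 * Real.pi) ^ (-(1 - s.re)) ≤ 1 :=
      Real.rpow_le_one_of_one_le_of_nonpos (by linarith [Real.pi_gt_three]) (by linarith)
    have he : Real.exp (Real.pi * |s.im| / 2) * |s.im| ≤ Real.exp (5 * |s.im|) := by
      have : |s.im| ≤ Real.exp |s.im| := by linarith [Real.add_one_le_exp |s.im|]
      calc _ ≤ Real.exp (Real.pi * |s.im| / 2) * Real.exp |s.im| := by gcongr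
        _ = Real.exp (Real.pi * |s.im| / 2 + |s.im|) := (Real.exp_add _ _).symm
        _ ≤ _ := by
          apply Real.exp_le_exp.2
          nlinarith [Real.pi_lt_four]
    calc _ ≤ _ := h3
      _ ≤ (N : ℝ) * 1 * G * (2 * Real.exp (Real.pi * |s.im| / 2) * (K * |s.im|)) := by gcongr
      _ = N * G * (2 * K) * (Real.exp (Real.pi * |s.im| / 2) * |s.im|) := by ring
      _ ≤ N * G * (2 * K) * Real.exp (5 * |s.im|) := by gcongr
      _ ≤ _ := by
        gcongr
        have : 0 ≤ max D 0 := le_max_right _ _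
        linarith

theorem one_add_abs_mul_exp_neg_sq_le (y : ℝ) : (1 + |y|) * Real.exp (-y ^ 2) ≤ 2 := by
  have h1 := Real.add_one_le_exp (y ^ 2)
  rw [Real.exp_neg, ← div_eq_mul_inv, div_le_iff₀ (Real.exp_pos _)]
  nlinarith [sq_nonneg (|y| - 1), sq_abs y, abs_nonneg y]

theorem exists_norm_LFunction_le_rpow {N : ℕ} [NeZero N] {χ : DirichletCharacter ℂ N} (h : GRH χ)
    {δ : ℝ} (hδ : 0 < δ) (hδ1 : δ ≤ 1 / 4) :
    ∃ C : ℝ, 0 ≤ C ∧ ∀ s : ℂ, s.re = 1 / 2 + δ →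
      ‖DirichletCharacter.LFunction χ s‖ ≤ C * (1 + |s.im|) ^ δ := by
  obtain ⟨C, hC0, hC⟩ := LFunction_littlewood h hδ hδ
  obtain ⟨D, hD⟩ : ∃ D, ∀ s ∈ Set.Icc (1 / 2 : ℝ) (3 / 4) ×ℂ Set.Icc (-3 : ℝ) 3,
      ‖DirichletCharacter.LFunction χ s‖ ≤ D := by
    refine (isCompact_Icc.reProdIm isCompact_Icc).exists_bound_of_continuousOn fun s hs => ?_
    exact (DirichletCharacter.differentiableAt_LFunction χ s (Or.inl fun h => by
      have := hs.1.2
      rw [h] at this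
      norm_num at this)).continuousAt.continuousWithinAt
  refine ⟨max C D, le_trans hC0 (le_max_left _ _), fun s hs => ?_⟩
  rcases le_total |s.im| 3 with him | him
  · have h3 := hD s ⟨⟨by linarith, by linarith⟩, abs_le.1 him⟩
    have h4 : 1 ≤ (1 + |s.im|) ^ δ := Real.one_le_rpow (by linarith [abs_nonneg s.im]) hδ.le
    have h5 : D ≤ max C D := le_max_right _ _
    have h6 : 0 ≤ max C D := le_trans hC0 (le_max_left _ _)
    nlinarith
  · refine (hC s hs.ge him).1.trans ?_
    gcongr
    · exact le_max_left _ _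
    · linarith

/-- Convexity bound for Dirichlet `L`-functions, with the Lindelöf-type bound from GRH as input on
the right edge. -/
theorem LFunction_convexity {N : ℕ} [NeZero N] {χ : DirichletCharacter ℂ N} (h : GRH χ)
    {δ : ℝ} (hδ : 0 < δ) (hδ1 : δ ≤ 1 / 4) :
    ∃ C : ℝ, 0 ≤ C ∧ ∀ s : ℂ, -(1 / 2) ≤ s.re → s.re ≤ 1 / 2 + δ → 1 ≤ |s.im| →
      ‖DirichletCharacter.LFunction χ s‖ ≤ C * |s.im| ^ (1 / 2 - s.re + 2 * δ) := by
  obtain ⟨A, hA0, hA⟩ := exists_norm_LFunction_le_line (fun j => χ j)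
  obtain ⟨W, hW0, hW⟩ := exists_norm_LFunction_le_exp (fun j => χ j)
  obtain ⟨B, hB0, hB⟩ := exists_norm_LFunction_le_rpow h hδ hδ1
  set D := 12 * (A + B) with hD
  refine ⟨D, by positivity, fun s h1 h2 him => ?_⟩
  set t₀ := s.im with ht₀
  set T := |t₀| with hT
  have hT0 : 0 < T := by linarith
  set f : ℂ → ℂ := fun z => DirichletCharacter.LFunction χ (z + t₀ * I) * exp (z ^ 2) with hf
  set l : ℝ := -(1 / 2) with hl
  set u : ℝ := 1 / 2 + δ with hu
  have hlu : l < u := by rw [hl, hu]; linarith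
  have hre : ∀ z : ℂ, (z + t₀ * I).re = z.re := fun z => by simp
  have him' : ∀ z : ℂ, (z + t₀ * I).im = z.im + t₀ := fun z => by simp
  have hexp : ∀ z : ℂ, l ≤ z.re → z.re ≤ u → ‖exp (z ^ 2)‖ ≤ 3 * Real.exp (-z.im ^ 2) := by
    intro z hz1 hz2
    rw [Complex.norm_exp]
    have h3 : (z ^ 2).re = z.re ^ 2 + -z.im ^ 2 := by
      rw [pow_two]; simp; ring
    rw [h3, Real.exp_add]
    gcongr
    calc Real.exp (z.re ^ 2) ≤ Real.exp 1 := by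
          apply Real.exp_le_exp.2
          nlinarith
      _ ≤ 3 := by linarith [Real.exp_one_lt_d9]
  have htri : ∀ z : ℂ, 1 + |z.im + t₀| ≤ 2 * T * (1 + |z.im|) := by
    intro z
    have := abs_add_le z.im t₀
    have := abs_nonneg z.im
    nlinarith
  have hdiff : DifferentiableOn ℂ f {z | z.re < 1} := by
    intro z hz
    refine DifferentiableAt.differentiableWithinAt ?_
    refine DifferentiableAt.mul ?_ (by fun_prop)
    refine DifferentiableAt.comp z (DirichletCharacter.differentiableAt_LFunction χ _
      (Or.inl fun h => ?_)) (by fun_prop)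
    have h3 := hre z
    rw [h] at h3
    simp only [Set.mem_ofPred_eq] at hz
    rw [← h3] at hz
    simp at hz
  have hcl : closure (HadamardThreeLines.verticalStrip l u) ⊆ {z | z.re < 1} := by
    have : closure (HadamardThreeLines.verticalStrip l u) ⊆ {z | z.re ≤ u} := by
      refine closure_minimal (fun z hz => ?_) (isClosed_le continuous_re continuous_const)
      exact le_of_lt hz.2
    intro z hz
    have h3 : z.re ≤ u := this hz
    have h4 : u < 1 := by rw [hu]; linarith
    exact h3.trans_lt h4
  have key := HadamardThreeLines.norm_le_interp_of_mem_verticalClosedStrip' (f := f)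
    (z := (s.re : ℂ)) (a := D * T) (b := D * T ^ δ) hlu
    (by simp only [HadamardThreeLines.verticalClosedStrip, Set.mem_preimage, ofReal_re]
        exact ⟨h1, h2⟩)
    (DifferentiableOn.diffContOnCl (hdiff.mono hcl))
    ⟨W * (3 * Real.exp (5 * T + 7)), by
      rintro _ ⟨z, ⟨hz1, hz2⟩, rfl⟩
      simp only [Function.comp, hf, norm_mul]
      have h3 := hW (z + t₀ * I) (by rw [hre]; exact hz1) (by rw [hre]; linarith)
      rw [him'] at h3
      refine (mul_le_mul h3 (hexp z hz1 hz2) (norm_nonneg _) (by positivity)).trans ?_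
      rw [mul_assoc, mul_left_comm (Real.exp _), ← Real.exp_add]
      have h4 : 5 * |z.im + t₀| + -z.im ^ 2 ≤ 5 * T + 7 := by
        have := abs_add_le z.im t₀
        nlinarith [sq_nonneg (|z.im| - 5 / 2), sq_abs z.im]
      have h5 := Real.exp_le_exp.2 h4
      gcongr⟩
    (by
      intro z hz
      have hz : z.re = l := hz
      simp only [hf, norm_mul]
      have h3 := hA (z + t₀ * I) (by rw [hre]; exact hz)
      rw [him'] at h3
      have h4 := one_add_abs_mul_exp_neg_sq_le z.im
      calc _ ≤ (A * (2 * T * (1 + |z.im|))) * (3 * Real.exp (-z.im ^ 2)) :=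
            mul_le_mul (h3.trans (by gcongr; exact htri z)) (hexp z hz.ge (hz.le.trans hlu.le))
              (norm_nonneg _) (by positivity)
        _ = 6 * A * T * ((1 + |z.im|) * Real.exp (-z.im ^ 2)) := by ring
        _ ≤ 6 * A * T * 2 := by gcongr
        _ ≤ D * T := by
          rw [hD]
          nlinarith [mul_nonneg hB0 hT0.le])
    (by
      intro z hz
      have hz : z.re = u := hz
      simp only [hf, norm_mul]
      have h3 := hB (z + t₀ * I) (by rw [hre]; exact hz)
      rw [him'] at h3
      have h4 := one_add_abs_mul_exp_neg_sq_le z.im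
      have h5 : (1 + |z.im + t₀|) ^ δ ≤ 2 * (1 + |z.im|) * T ^ δ := by
        calc (1 + |z.im + t₀|) ^ δ ≤ (2 * (1 + |z.im|) * T) ^ δ := by
              gcongr
              linarith [htri z]
          _ = (2 * (1 + |z.im|)) ^ δ * T ^ δ := Real.mul_rpow (by positivity) hT0.le
          _ ≤ _ := by
            gcongr
            calc (2 * (1 + |z.im|)) ^ δ ≤ (2 * (1 + |z.im|)) ^ (1 : ℝ) :=
                  Real.rpow_le_rpow_of_exponent_le (by linarith [abs_nonneg z.im]) (by linarith)
              _ = _ := Real.rpow_one _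
      calc _ ≤ (B * (2 * (1 + |z.im|) * T ^ δ)) * (3 * Real.exp (-z.im ^ 2)) :=
            mul_le_mul (h3.trans (by gcongr)) (hexp z (hlu.le.trans hz.ge) hz.le)
              (norm_nonneg _) (by positivity)
        _ = 6 * B * T ^ δ * ((1 + |z.im|) * Real.exp (-z.im ^ 2)) := by ring
        _ ≤ 6 * B * T ^ δ * 2 := by gcongr
        _ ≤ D * T ^ δ := by
          rw [hD]
          have : 0 ≤ T ^ δ := by positivity
          nlinarith [mul_nonneg hA0 this])
  have hval : ‖DirichletCharacter.LFunction χ s‖ ≤ ‖f s.re‖ := by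
    simp only [hf, norm_mul]
    rw [ht₀, Complex.re_add_im, Complex.norm_exp]
    have h3 : 1 ≤ Real.exp (((s.re : ℂ) ^ 2).re) := by
      apply Real.one_le_exp
      rw [← ofReal_pow, ofReal_re]
      positivity
    nlinarith [norm_nonneg (DirichletCharacter.LFunction χ s)]
  refine (hval.trans key).trans ?_
  rw [ofReal_re]
  set τ := (s.re - l) / (u - l) with hτ
  have hul : u - l = 1 + δ := by rw [hu, hl]; ring
  have hτ1 : τ ≤ 1 := by
    rw [hτ, div_le_one (by linarith)]; linarith
  have hτ0 : 0 ≤ τ := div_nonneg (by linarith) (by linarith)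
  have h1τ : 1 - τ ≤ 1 / 2 + δ - s.re := by
    have : 1 - τ = (1 / 2 + δ - s.re) / (1 + δ) := by
      rw [hτ, hul, hl]; field_simp; ring
    rw [this]
    exact div_le_self (by linarith) (by linarith)
  rcases eq_or_lt_of_le (show 0 ≤ D by positivity) with hD0 | hD0
  · rw [← hD0]
    rcases eq_or_ne τ 0 with h0 | h0
    · simp [h0]
    · simp [Real.zero_rpow h0]
  rw [Real.mul_rpow hD0.le hT0.le, Real.mul_rpow hD0.le (by positivity), ← Real.rpow_mul hT0.le]
  calc D ^ (1 - τ) * T ^ (1 - τ) * (D ^ τ * T ^ (δ * τ))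
      = D ^ ((1 - τ) + τ) * T ^ ((1 - τ) + δ * τ) := by
        rw [Real.rpow_add hD0, Real.rpow_add hT0]; ring
    _ = D * T ^ ((1 - τ) + δ * τ) := by rw [sub_add_cancel, Real.rpow_one]
    _ ≤ _ := by
      refine mul_le_mul_of_nonneg_left (Real.rpow_le_rpow_of_exponent_le him ?_) hD0.le
      nlinarith

theorem mulChiNeg4_apply_nat {q : ℕ} (χ : DirichletCharacter ℂ q) (n : ℕ) :
    mulChiNeg4 χ n = χ n * chiNeg4 n := by
  by_cases h : IsUnit ((n : ℕ) : ZMod (4 * q))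
  · have hc : IsCoprime (n : ℤ) ((4 * q : ℕ) : ℤ) :=
      Nat.isCoprime_iff_coprime.2 ((ZMod.isUnit_iff_coprime _ _).1 h)
    have h1 := DirichletCharacter.changeLevel_eq_cast_of_dvd' χ (dvd_mul_left q 4) hc
    have h2 := DirichletCharacter.changeLevel_eq_cast_of_dvd' chiNeg4 (dvd_mul_right 4 q) hc
    rw [mulChiNeg4, MulChar.mul_apply]
    simp only [Int.cast_natCast] at h1 h2
    rw [h1, h2]
  · rw [MulChar.map_nonunit _ h]
    rw [ZMod.isUnit_iff_coprime, Nat.coprime_mul_iff_right, not_and_or] at h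
    rcases h with h | h
    · have : ¬ IsUnit ((n : ℕ) : ZMod 4) := by rwa [ZMod.isUnit_iff_coprime]
      rw [MulChar.map_nonunit chiNeg4 this, mul_zero]
    · have : ¬ IsUnit ((n : ℕ) : ZMod q) := by rwa [ZMod.isUnit_iff_coprime]
      rw [MulChar.map_nonunit χ this, zero_mul]

theorem chiNeg4_one_mod {n : ℕ} (h : n % 4 = 1) : chiNeg4 n = 1 := by
  have := ZMod.χ₄_nat_one_mod_four h
  simp [chiNeg4, this]

theorem chiNeg4_three_mod {n : ℕ} (h : n % 4 = 3) : chiNeg4 n = -1 := by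
  have := ZMod.χ₄_nat_three_mod_four h
  simp [chiNeg4, this]

theorem chiNeg4_two : chiNeg4 (2 : ℕ) = 0 := by
  apply MulChar.map_nonunit
  decide

theorem isSum2Sq_iff {n : ℕ} :
    IsSum2Sq n ↔ ∀ p ∈ n.primeFactors, p % 4 = 3 → Even (n.factorization p) := by
  rw [IsSum2Sq, Nat.eq_sq_add_sq_iff]
  refine forall₂_congr fun p hp => ?_
  rw [Nat.factorization_def n (Nat.prime_of_mem_primeFactors hp)]

theorem isSum2Sq_mul_of_coprime {m n : ℕ} (h : m.Coprime n) :
    IsSum2Sq (m * n) ↔ IsSum2Sq m ∧ IsSum2Sq n := by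
  simp only [isSum2Sq_iff, h.primeFactors_mul, Finset.mem_union]
  have hm : ∀ p ∈ m.primeFactors, (m * n).factorization p = m.factorization p := fun p hp =>
    Nat.factorization_eq_of_coprime_left h ((Nat.mem_primeFactors_iff_mem_primeFactorsList).1 hp)
  have hn : ∀ p ∈ n.primeFactors, (m * n).factorization p = n.factorization p := fun p hp =>
    Nat.factorization_eq_of_coprime_right h ((Nat.mem_primeFactors_iff_mem_primeFactorsList).1 hp)
  constructor
  · exact fun H => ⟨fun p hp h3 => hm p hp ▸ H p (Or.inl hp) h3,
      fun p hp h3 => hn p hp ▸ H p (Or.inr hp) h3⟩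
  · rintro ⟨H1, H2⟩ p (hp | hp) h3
    · exact hm p hp ▸ H1 p hp h3
    · exact hn p hp ▸ H2 p hp h3

theorem isSum2Sq_prime_pow {p : ℕ} (hp : p.Prime) (e : ℕ) :
    IsSum2Sq (p ^ e) ↔ (p % 4 = 3 → Even e) := by
  rw [isSum2Sq_iff]
  rcases eq_or_ne e 0 with rfl | he
  · simp
  · rw [Nat.primeFactors_prime_pow he hp]
    simp [hp.factorization]

theorem hasProd_STwist {q : ℕ} (χ : DirichletCharacter ℂ q) {s : ℂ} (hs : 1 < s.re) :
    HasProd (fun p : Nat.Primes => if (p : ℕ) % 4 = 3 then (1 - (χ p * (p : ℂ) ^ (-s)) ^ 2)⁻¹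
      else (1 - χ p * (p : ℂ) ^ (-s))⁻¹) (LSeries (STwist χ) s) := by
  have hs0 : s ≠ 0 := by rintro rfl; simp at hs; linarith
  set D := DirichletCharacter.LSeries_eulerProduct_hasProd χ hs
  let d := dirichletSummandHom χ hs0
  let f : ℕ → ℂ := fun n => if IsSum2Sq n then d n else 0
  have hd : ∀ n, d n = χ n * (n : ℂ) ^ (-s) := fun n => rfl
  have hsumd : Summable (fun n => ‖d n‖) := summable_dirichletSummand χ hs
  have hf1 : f 1 = 1 := by
    simp only [f, map_one, ite_eq_left_iff]
    exact fun h => absurd (show IsSum2Sq 1 from ⟨1, 0, by norm_num⟩) h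
  have hmul : ∀ {m n : ℕ}, m.Coprime n → f (m * n) = f m * f n := by
    intro m n h
    simp only [f, isSum2Sq_mul_of_coprime h, map_mul]
    by_cases h1 : IsSum2Sq m <;> by_cases h2 : IsSum2Sq n <;> simp [h1, h2]
  have hsum : Summable (fun n => ‖f n‖) := by
    refine hsumd.of_nonneg_of_le (fun _ => norm_nonneg _) fun n => ?_
    simp only [f]
    split_ifs <;> simp
  have h := EulerProduct.eulerProduct_hasProd hf1 hmul hsum (by simp [f])
  have htot : ∑' n, f n = LSeries (STwist χ) s := by
    rw [LSeries]
    refine tsum_congr fun n => ?_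
    simp only [f, LSeries.term, STwist, hd]
    rcases eq_or_ne n 0 with rfl | hn
    · simp [hs0]
    · simp only [hn, if_false]
      split_ifs
      · rw [cpow_neg, div_eq_mul_inv]
      · simp
  rw [htot] at h
  convert h using 2 with p
  have hx : ‖d p‖ < 1 := by
    have := Summable.norm_lt_one (f := (d : ℕ →* ℂ)) hsumd.of_norm p.2.one_lt
    exact this
  have hpow : ∀ e, f ((p : ℕ) ^ e) = if ((p : ℕ) % 4 = 3 → Even e) then d p ^ e else 0 := by
    intro e
    simp only [f, isSum2Sq_prime_pow p.2, map_pow]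
  simp only [hpow, ← hd]
  split_ifs with h3
  · simp only [h3, forall_true_left]
    have hsq : HasSum (fun k : ℕ => d p ^ (2 * k)) (1 - d p ^ 2)⁻¹ := by
      simp only [pow_mul]
      apply hasSum_geometric_of_norm_lt_one
      rw [norm_pow]
      exact pow_lt_one₀ (norm_nonneg _) hx two_ne_zero
    have he : HasSum (fun e : ℕ => if Even e then d p ^ e else 0) ((1 - d p ^ 2)⁻¹ + 0) := by
      refine HasSum.even_add_odd ?_ ?_
      · simpa using hsq
      · have : (fun k : ℕ => if Even (2 * k + 1) then d p ^ (2 * k + 1) else 0) = fun _ => 0 := by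
          funext k
          simp
        rw [this]
        exact hasSum_zero
    rw [add_zero] at he
    exact he.tsum_eq.symm
  · simp only [h3, false_imp_iff, if_true]
    exact (tsum_geometric_of_norm_lt_one hx).symm

/-- `χ⁴` restricted to integers all of whose prime factors are `3` modulo `4`. -/
def quarticTwist {q : ℕ} (χ : DirichletCharacter ℂ q) (n : ℕ) : ℂ :=
  if ∀ p : ℕ, p.Prime → p ∣ n → p % 4 = 3 then χ n ^ 4 else 0

theorem norm_quarticTwist_le {q : ℕ} (χ : DirichletCharacter ℂ q) (n : ℕ) :
    ‖quarticTwist χ n‖ ≤ 1 := by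
  rw [quarticTwist]
  split_ifs
  · rw [norm_pow]
    exact pow_le_one₀ (norm_nonneg _) (χ.norm_le_one _)
  · simp

theorem hasProd_quarticTwist {q : ℕ} (χ : DirichletCharacter ℂ q) {w : ℂ} (hw : 1 < w.re) :
    HasProd (fun p : Nat.Primes => if (p : ℕ) % 4 = 3 then (1 - χ p ^ 4 * (p : ℂ) ^ (-w))⁻¹ else 1)
      (LSeries (quarticTwist χ) w) := by
  have hw0 : w ≠ 0 := by rintro rfl; simp at hw; linarith
  have hz : quarticTwist χ 0 = 0 := by
    rw [quarticTwist, if_neg]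
    intro h
    have := h 2 Nat.prime_two (dvd_zero 2)
    norm_num at this
  have hsumz := summable_riemannZetaSummand hw
  let d : ℕ →*₀ ℂ :=
    { toFun := fun n => quarticTwist χ n * riemannZetaSummandHom hw0 n
      map_zero' := by simp
      map_one' := by
        have : quarticTwist χ 1 = 1 := by
          rw [quarticTwist, if_pos]
          · simp
          · exact fun p hp h1 => absurd (Nat.dvd_one.1 h1) hp.one_lt.ne'
        simp [this]
      map_mul' := fun m n => by
        have : quarticTwist χ (m * n) = quarticTwist χ m * quarticTwist χ n := by
          have hiff : (∀ p : ℕ, p.Prime → p ∣ m * n → p % 4 = 3) ↔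
              (∀ p : ℕ, p.Prime → p ∣ m → p % 4 = 3) ∧ ∀ p : ℕ, p.Prime → p ∣ n → p % 4 = 3 := by
            constructor
            · exact fun h => ⟨fun p hp hd => h p hp (hd.mul_right n),
                fun p hp hd => h p hp (hd.mul_left m)⟩
            · rintro ⟨h1, h2⟩ p hp hd
              exact ((Nat.Prime.dvd_mul hp).1 hd).elim (h1 p hp) (h2 p hp)
          simp only [quarticTwist, hiff]
          generalize (∀ p : ℕ, p.Prime → p ∣ m → p % 4 = 3) = P
          generalize (∀ p : ℕ, p.Prime → p ∣ n → p % 4 = 3) = Q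
          by_cases h1 : P <;> by_cases h2 : Q <;> simp [h1, h2, mul_pow]
        rw [this, map_mul]; ring }
  have hd : ∀ n, d n = quarticTwist χ n * (n : ℂ) ^ (-w) := fun n => rfl
  have hsum : Summable (fun n => ‖d n‖) := by
    refine hsumz.of_nonneg_of_le (fun _ => norm_nonneg _) fun n => ?_
    change ‖quarticTwist χ n * riemannZetaSummandHom hw0 n‖ ≤ _
    rw [norm_mul]
    exact mul_le_of_le_one_left (norm_nonneg _) (norm_quarticTwist_le χ n)
  have h := EulerProduct.eulerProduct_completely_multiplicative_hasProd hsum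
  have htot : ∑' n, d n = LSeries (quarticTwist χ) w := by
    rw [LSeries]
    refine tsum_congr fun n => ?_
    rw [hd, LSeries.term]
    rcases eq_or_ne n 0 with rfl | hn
    · simp [hz]
    · rw [if_neg hn, cpow_neg, div_eq_mul_inv]
  rw [htot] at h
  convert h using 2 with p
  rw [hd, quarticTwist]
  have hiff : (∀ r : ℕ, r.Prime → r ∣ (p : ℕ) → r % 4 = 3) ↔ (p : ℕ) % 4 = 3 := by
    constructor
    · exact fun h => h p p.2 dvd_rfl
    · intro h r hr hd
      rwa [(Nat.prime_dvd_prime_iff_eq hr p.2).1 hd]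
  simp only [hiff]
  split_ifs <;> simp

theorem HasProd.congr_fun' {ι : Type*} {f g : ι → ℂ} {a : ℂ} (hf : HasProd f a)
    (h : ∀ i, f i = g i) : HasProd g a := funext h ▸ hf

/-- The correction factor in the factorization of the fourth power of `∑ 1_S(n) χ(n) n^{-s}`
into Dirichlet `L`-functions. -/
def quarticFactor {q : ℕ} (χ : DirichletCharacter ℂ q) (s : ℂ) : ℂ :=
  (1 - (χ (2 : ℕ) * ((2 : ℕ) : ℂ) ^ (-s)) ^ 2) * (1 - χ (2 : ℕ) * ((2 : ℕ) : ℂ) ^ (-s))⁻¹ ^ 2 *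
    LSeries (quarticTwist χ) (4 * s)

theorem LSeries_STwist_pow_four {q : ℕ} [NeZero q] (χ : DirichletCharacter ℂ q) {s : ℂ}
    (hs : 1 < s.re) :
    LSeries (STwist χ) s ^ 4 * LSeries (fun n => mulChiNeg4 (χ ^ 2) n) (2 * s) =
      (LSeries (fun n => χ n) s * LSeries (fun n => mulChiNeg4 χ n) s) ^ 2 *
        LSeries (fun n => (χ ^ 2) n) (2 * s) * quarticFactor χ s := by
  have h2s : 1 < (2 * s).re := by simp; linarith
  have h4s : 1 < (4 * s).re := by simp; linarith
  have hF := hasProd_STwist χ hs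
  have hL := DirichletCharacter.LSeries_eulerProduct_hasProd χ hs
  have hL' := DirichletCharacter.LSeries_eulerProduct_hasProd (mulChiNeg4 χ) hs
  have hLsq := DirichletCharacter.LSeries_eulerProduct_hasProd (χ ^ 2) h2s
  have hLsq' := DirichletCharacter.LSeries_eulerProduct_hasProd (mulChiNeg4 (χ ^ 2)) h2s
  have hQ := hasProd_quarticTwist χ h4s
  have hT : HasProd (fun p : Nat.Primes => if (p : ℕ) = 2 then
      (1 - (χ (2 : ℕ) * ((2 : ℕ) : ℂ) ^ (-s)) ^ 2) * (1 - χ (2 : ℕ) * ((2 : ℕ) : ℂ) ^ (-s))⁻¹ ^ 2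
      else 1)
      ((1 - (χ (2 : ℕ) * ((2 : ℕ) : ℂ) ^ (-s)) ^ 2) *
        (1 - χ (2 : ℕ) * ((2 : ℕ) : ℂ) ^ (-s))⁻¹ ^ 2) := by
    have := hasProd_single (⟨2, Nat.prime_two⟩ : Nat.Primes) (f := fun p : Nat.Primes =>
      if (p : ℕ) = 2 then (1 - (χ (2 : ℕ) * ((2 : ℕ) : ℂ) ^ (-s)) ^ 2) *
        (1 - χ (2 : ℕ) * ((2 : ℕ) : ℂ) ^ (-s))⁻¹ ^ 2 else 1)
      (fun p hp => if_neg fun h => hp (Subtype.ext h))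
    simpa using this
  have hl := ((hF.mul hF).mul (hF.mul hF)).mul hLsq'
  have hr := (((hL.mul hL').mul (hL.mul hL')).mul hLsq).mul (hT.mul hQ)
  rw [quarticFactor]
  refine Eq.trans (by ring) ((hr.unique (HasProd.congr_fun' hl ?_)).symm.trans (by ring))
  · intro p
    have hp := p.2
    have hx : ‖χ p * (p : ℂ) ^ (-s)‖ < 1 := by
      rw [norm_mul, norm_natCast_cpow_of_pos hp.pos]
      refine (mul_le_of_le_one_left (by positivity) (χ.norm_le_one _)).trans_lt ?_
      exact Real.rpow_lt_one_of_one_lt_of_neg (by exact_mod_cast hp.one_lt) (by simp; linarith)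
    have e2 : (p : ℂ) ^ (-(2 * s)) = ((p : ℂ) ^ (-s)) ^ 2 := by
      rw [← cpow_nat_mul]; congr 1; push_cast; ring
    have e4 : (p : ℂ) ^ (-(4 * s)) = ((p : ℂ) ^ (-s)) ^ 4 := by
      rw [← cpow_nat_mul]; congr 1; push_cast; ring
    rw [mulChiNeg4_apply_nat, mulChiNeg4_apply_nat, MulChar.pow_apply' _ two_ne_zero, e2, e4]
    have d2 : χ p ^ 2 * ((p : ℂ) ^ (-s)) ^ 2 = (χ p * (p : ℂ) ^ (-s)) ^ 2 := by ring
    have d4 : χ p ^ 4 * ((p : ℂ) ^ (-s)) ^ 4 = (χ p * (p : ℂ) ^ (-s)) ^ 4 := by ring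
    rw [d2, d4, mul_right_comm _ (chiNeg4 _), mul_right_comm _ (chiNeg4 _), d2]
    have hx2 : ‖(χ p * (p : ℂ) ^ (-s)) ^ 2‖ < 1 := by
      rw [norm_pow]; exact pow_lt_one₀ (norm_nonneg _) hx two_ne_zero
    by_cases h2 : (p : ℕ) = 2
    · simp only [h2] at hx hx2 ⊢
      simp only [if_true, chiNeg4_two, mul_zero, sub_zero]
      generalize χ ((2 : ℕ) : ZMod q) * ((2 : ℕ) : ℂ) ^ (-s) = x at hx hx2
      have n1 : 1 - x ≠ 0 := fun h => by rw [← sub_eq_zero.1 h] at hx; simp at hx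
      have n2 : 1 - x ^ 2 ≠ 0 := fun h => by rw [← sub_eq_zero.1 h] at hx2; simp at hx2
      norm_num
      field_simp
    · have hodd : (p : ℕ) % 2 = 1 := by
        rcases hp.eq_two_or_odd with h | h
        · exact absurd h h2
        · exact h
      have h13 : (p : ℕ) % 4 = 1 ∨ (p : ℕ) % 4 = 3 := by omega
      generalize hxe : χ p * (p : ℂ) ^ (-s) = x at hx hx2
      rcases h13 with h1 | h3
      · have h3 : ¬ (p : ℕ) % 4 = 3 := by omega
        simp only [chiNeg4_one_mod h1, h2, h3, if_false]
        ring
      · simp only [chiNeg4_three_mod h3, h2, h3, if_true, if_false]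
        have n1 : 1 - x ≠ 0 := fun h => by rw [← sub_eq_zero.1 h] at hx; simp at hx
        have n2 : 1 - x ^ 2 ≠ 0 := fun h => by rw [← sub_eq_zero.1 h] at hx2; simp at hx2
        have n3 : 1 + x ≠ 0 := fun h => n2 (by linear_combination (1 - x) * h)
        have n4 : 1 + x ^ 2 ≠ 0 := fun h => by
          rw [show x ^ 2 = -1 by linear_combination h] at hx2; simp at hx2
        have q1 : 1 - x * -1 = 1 + x := by ring
        have q2 : 1 - x ^ 2 * -1 = 1 + x ^ 2 := by ring
        have q3 : 1 - x ^ 4 = (1 - x) * (1 + x) * (1 + x ^ 2) := by ring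
        have q4 : 1 - x ^ 2 = (1 - x) * (1 + x) := by ring
        rw [q1, q2, q3, q4]
        field_simp

theorem differentiableAt_quarticFactor {q : ℕ} (χ : DirichletCharacter ℂ q) {s : ℂ}
    (hs : 1 / 4 < s.re) : DifferentiableAt ℂ (quarticFactor χ) s := by
  have hx : ‖χ (2 : ℕ) * ((2 : ℕ) : ℂ) ^ (-s)‖ < 1 := by
    rw [norm_mul, norm_natCast_cpow_of_pos two_pos]
    refine (mul_le_of_le_one_left (by positivity) (χ.norm_le_one _)).trans_lt ?_
    exact Real.rpow_lt_one_of_one_lt_of_neg (by norm_num) (by simp; linarith)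
  have n1 : 1 - χ (2 : ℕ) * ((2 : ℕ) : ℂ) ^ (-s) ≠ 0 := fun h => by
    rw [← sub_eq_zero.1 h] at hx; simp at hx
  have hy : DifferentiableAt ℂ (fun s : ℂ => χ (2 : ℕ) * ((2 : ℕ) : ℂ) ^ (-s)) s :=
    (differentiableAt_id.neg.const_cpow (Or.inl (by norm_num))).const_mul _
  have habs : LSeries.abscissaOfAbsConv (quarticTwist χ) ≤ 1 :=
    LSeries.abscissaOfAbsConv_le_of_le_const ⟨1, fun n _ => norm_quarticTwist_le χ n⟩
  have hL : DifferentiableAt ℂ (LSeries (quarticTwist χ)) (4 * s) := by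
    refine (LSeries_analyticOnNhd (quarticTwist χ) (4 * s) ?_).differentiableAt
    refine habs.trans_lt ?_
    have : (1 : ℝ) < (4 * s).re := by simp; linarith
    exact_mod_cast this
  unfold quarticFactor
  refine DifferentiableAt.mul (DifferentiableAt.mul ((differentiableAt_const 1).sub (hy.pow 2)) ?_)
    (DifferentiableAt.comp (g := LSeries (quarticTwist χ)) s hL (differentiableAt_id.const_mul 4))
  exact (DifferentiableAt.inv ((differentiableAt_const 1).sub hy) n1).pow 2

theorem F_pow_four_eq_aux {q : ℕ} [NeZero q] (χ : DirichletCharacter ℂ q) {F : ℂ → ℂ} {e : ℝ}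
    (he : e ≠ 0)
    (hFser : ∀ s : ℂ, 1 < s.re → F s = LSeries (STwist χ) s)
    (hFan : DifferentiableOn ℂ F {s : ℂ | 1 / 4 < s.re ∧ (s.re ≤ 1 / 2 →
      LVal χ (1 / 2 + s.im * I) * LVal (mulChiNeg4 χ) (1 / 2 + s.im * I) ≠ 0 ∧
      ¬(s.im = 0 ∧ (χ ^ 2 = 1 ∨ mulChiNeg4 (χ ^ 2) = 1)))}) {s : ℂ}
    (hs : 1 / 4 < s.re) (hs0 : 0 < e * s.im)
    (hs1 : s.re ≤ 1 / 2 →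
      LVal χ (1 / 2 + s.im * I) * LVal (mulChiNeg4 χ) (1 / 2 + s.im * I) ≠ 0) :
    F s ^ 4 * LVal (mulChiNeg4 (χ ^ 2)) (2 * s) =
      (LVal χ s * LVal (mulChiNeg4 χ) s) ^ 2 * LVal (χ ^ 2) (2 * s) * quarticFactor χ s := by
  have : NeZero (4 * q) := ⟨mul_ne_zero (by norm_num) (NeZero.ne q)⟩
  have hdL : ∀ {N : ℕ} [NeZero N] (ψ : DirichletCharacter ℂ N) (z : ℂ), z ≠ 1 →
      DifferentiableAt ℂ (LVal ψ) z := fun ψ z hz => by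
    rw [LVal_eq]; exact DirichletCharacter.differentiableAt_LFunction ψ z (Or.inl hz)
  let M : ℂ → ℂ := fun z => LVal χ z * LVal (mulChiNeg4 χ) z
  let U : Set ℂ := {s | 1 / 4 < s.re ∧ 0 < e * s.im ∧ (s.re ≤ 1 / 2 → M (1 / 2 + s.im * I) ≠ 0)}
  have hUim : ∀ z ∈ U, z.im ≠ 0 := fun z hz h => by
    have := hz.2.1
    rw [h, mul_zero] at this
    exact this.false
  have hne1 : ∀ z : ℂ, z.im ≠ 0 → z ≠ 1 := fun z hz h => hz (by rw [h]; simp)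
  have hMc : Continuous fun s : ℂ => M (1 / 2 + s.im * I) := by
    rw [continuous_iff_continuousAt]
    intro z
    have h1 : (1 / 2 + (z.im : ℂ) * I) ≠ 1 := fun h => by
      have := congrArg re h
      norm_num at this
    have h2 : ContinuousAt M (1 / 2 + (z.im : ℂ) * I) :=
      ((hdL χ _ h1).mul (hdL (mulChiNeg4 χ) _ h1)).continuousAt
    exact ContinuousAt.comp (f := fun s : ℂ => 1 / 2 + (s.im : ℂ) * I) h2 (by fun_prop)
  have hUeq : U = {s | 1 / 4 < s.re} ∩ ({s | 0 < e * s.im} ∩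
      ({s | 1 / 2 < s.re} ∪ {s | M (1 / 2 + s.im * I) ≠ 0})) := by
    ext z
    simp only [U, Set.mem_ofPred_eq, Set.mem_inter_iff, Set.mem_union, ← not_le, imp_iff_not_or]
  have hUo : IsOpen U := by
    rw [hUeq]
    refine (isOpen_lt continuous_const continuous_re).inter
      ((isOpen_lt continuous_const (continuous_const.mul continuous_im)).inter
      ((isOpen_lt continuous_const continuous_re).union (isOpen_ne_fun hMc continuous_const)))
  have hei : e * e⁻¹ = 1 := mul_inv_cancel₀ he
  have hz0 : (⟨2, e⁻¹⟩ : ℂ) ∈ U := ⟨by norm_num, by simp [hei], by norm_num⟩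
  have hconv : Convex ℝ {s : ℂ | 1 / 2 < s.re ∧ 0 < e * s.im} :=
    (convex_halfSpace_re_gt (1 / 2)).inter ((convex_Ioi (0 : ℝ)).linear_preimage (e • imLm))
  have hUp : IsPreconnected U := by
    refine isPreconnected_of_forall (⟨2, e⁻¹⟩ : ℂ) fun y hy => ?_
    have hc2 : Convex ℝ {z : ℂ | y.re ≤ z.re ∧ z.im = y.im} :=
      (convex_halfSpace_re_ge y.re).inter ((convex_singleton y.im).linear_preimage imLm)
    refine ⟨{s : ℂ | 1 / 2 < s.re ∧ 0 < e * s.im} ∪ {z | y.re ≤ z.re ∧ z.im = y.im}, ?_,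
      Or.inl ⟨by norm_num, by simp [hei]⟩, Or.inr ⟨le_rfl, rfl⟩,
      IsPreconnected.union (⟨max y.re 1, y.im⟩ : ℂ) ⟨?_, hy.2.1⟩ ⟨le_max_left _ _, rfl⟩
        hconv.isPreconnected hc2.isPreconnected⟩
    · rintro z (⟨h1, h2⟩ | ⟨h1, h2⟩)
      · exact ⟨by linarith, h2, fun h => absurd h (not_le.2 h1)⟩
      · exact ⟨hy.1.trans_le h1, by rw [h2]; exact hy.2.1,
          fun h => by rw [h2]; exact hy.2.2 (h1.trans h)⟩
    · exact lt_of_lt_of_le (by norm_num) (le_max_right y.re 1)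
  have hUne : ∀ z ∈ U, 2 * z ≠ 1 := fun z hz => hne1 _ (by simp [hUim z hz])
  have h2d : ∀ {N : ℕ} [NeZero N] (ψ : DirichletCharacter ℂ N), ∀ z ∈ U,
      DifferentiableAt ℂ (fun z => LVal ψ (2 * z)) z := fun ψ z hz =>
    DifferentiableAt.comp (g := LVal ψ) z (hdL ψ _ (hUne z hz)) (differentiableAt_id.const_mul 2)
  have hf : DifferentiableOn ℂ (fun s => F s ^ 4 * LVal (mulChiNeg4 (χ ^ 2)) (2 * s)) U := by
    refine DifferentiableOn.mul ((hFan.mono fun z hz => ⟨hz.1, fun h => ⟨hz.2.2 h,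
      fun h0 => hUim z hz h0.1⟩⟩).pow 4) fun z hz => (h2d _ z hz).differentiableWithinAt
  have hg : DifferentiableOn ℂ (fun s => (LVal χ s * LVal (mulChiNeg4 χ) s) ^ 2 *
      LVal (χ ^ 2) (2 * s) * quarticFactor χ s) U := fun z hz =>
    DifferentiableAt.differentiableWithinAt <| DifferentiableAt.mul (DifferentiableAt.mul
      (DifferentiableAt.pow (DifferentiableAt.mul (hdL χ z (hne1 z (hUim z hz)))
      (hdL (mulChiNeg4 χ) z (hne1 z (hUim z hz)))) 2) (h2d _ z hz))
      (differentiableAt_quarticFactor χ hz.1)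
  refine (hf.analyticOnNhd hUo).eqOn_of_preconnected_of_eventuallyEq (hg.analyticOnNhd hUo) hUp hz0
    ?_ ⟨hs, hs0, hs1⟩
  have hop : {z : ℂ | 1 < z.re} ∈ nhds (⟨2, e⁻¹⟩ : ℂ) :=
    (isOpen_lt continuous_const continuous_re).mem_nhds (by simp)
  filter_upwards [hop] with z hz
  have hz' : 1 < z.re := hz
  have h2z : 1 < (2 * z).re := by simp; linarith
  have key := LSeries_STwist_pow_four χ hz'
  simp only [LVal_eq, hFser z hz', DirichletCharacter.LFunction_eq_LSeries _ hz',
    DirichletCharacter.LFunction_eq_LSeries _ h2z]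
  exact key

theorem F_pow_four_eq {q : ℕ} [NeZero q] (χ : DirichletCharacter ℂ q) {F : ℂ → ℂ}
    (hFser : ∀ s : ℂ, 1 < s.re → F s = LSeries (STwist χ) s)
    (hFan : DifferentiableOn ℂ F {s : ℂ | 1 / 4 < s.re ∧ (s.re ≤ 1 / 2 →
      LVal χ (1 / 2 + s.im * I) * LVal (mulChiNeg4 χ) (1 / 2 + s.im * I) ≠ 0 ∧
      ¬(s.im = 0 ∧ (χ ^ 2 = 1 ∨ mulChiNeg4 (χ ^ 2) = 1)))}) {s : ℂ}
    (hs : 1 / 4 < s.re) (hs0 : s.im ≠ 0)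
    (hs1 : s.re ≤ 1 / 2 →
      LVal χ (1 / 2 + s.im * I) * LVal (mulChiNeg4 χ) (1 / 2 + s.im * I) ≠ 0) :
    F s ^ 4 * LVal (mulChiNeg4 (χ ^ 2)) (2 * s) =
      (LVal χ s * LVal (mulChiNeg4 χ) s) ^ 2 * LVal (χ ^ 2) (2 * s) * quarticFactor χ s :=
  F_pow_four_eq_aux χ hs0 hFser hFan hs (mul_self_pos.2 hs0) hs1

theorem norm_quarticFactor_le {q : ℕ} (χ : DirichletCharacter ℂ q) :
    ∃ B, 0 ≤ B ∧ ∀ s : ℂ, 5 / 16 ≤ s.re → ‖quarticFactor χ s‖ ≤ B := by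
  obtain ⟨B, hB, h⟩ := norm_LSeries_le (σ := 5 / 4) (by norm_num)
  have hlt : (2 : ℝ) ^ (-(5 / 16) : ℝ) < 1 :=
    Real.rpow_lt_one_of_one_lt_of_neg (by norm_num) (by norm_num)
  refine ⟨2 * (1 - (2 : ℝ) ^ (-(5 / 16) : ℝ))⁻¹ ^ 2 * (1 * B), by
    have : 0 < 1 - (2 : ℝ) ^ (-(5 / 16) : ℝ) := by linarith
    positivity, fun s hs => ?_⟩
  have hx : ‖χ (2 : ℕ) * ((2 : ℕ) : ℂ) ^ (-s)‖ ≤ (2 : ℝ) ^ (-(5 / 16) : ℝ) := by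
    rw [norm_mul, norm_natCast_cpow_of_pos two_pos]
    refine (mul_le_of_le_one_left (by positivity) (χ.norm_le_one _)).trans ?_
    exact Real.rpow_le_rpow_of_exponent_le (by norm_num) (by simp; linarith)
  rw [quarticFactor, norm_mul, norm_mul, norm_pow, norm_inv]
  have hL : ‖LSeries (quarticTwist χ) (4 * s)‖ ≤ 1 * B :=
    h _ _ 1 (fun n _ => norm_quarticTwist_le χ n) (by simp; linarith)
  generalize χ (2 : ℕ) * ((2 : ℕ) : ℂ) ^ (-s) = y at hx
  have h1 : ‖1 - y ^ 2‖ ≤ 2 := by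
    refine (norm_sub_le _ _).trans ?_
    rw [norm_one, norm_pow]
    have : ‖y‖ ^ 2 ≤ 1 := pow_le_one₀ (norm_nonneg _) (hx.trans hlt.le)
    linarith
  have h2 : 1 - (2 : ℝ) ^ (-(5 / 16) : ℝ) ≤ ‖1 - y‖ := by
    have := norm_sub_norm_le 1 y
    rw [norm_one] at this
    linarith
  have h3 : 0 < 1 - (2 : ℝ) ^ (-(5 / 16) : ℝ) := by linarith
  gcongr

theorem norm_LVal_le_rpow {N : ℕ} [NeZero N] {χ : DirichletCharacter ℂ N} (h : GRH χ) {R δ : ℝ}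
    (hR : 0 ≤ R) (hR1 : R ≤ 1 / 2) (hδ : 0 < δ) (hδ1 : δ ≤ 1 / 4) :
    ∃ C, 0 ≤ C ∧ ∀ s : ℂ, 1 / 2 - R ≤ s.re → 3 ≤ |s.im| →
      ‖LVal χ s‖ ≤ C * |s.im| ^ (R + 2 * δ) := by
  obtain ⟨C₁, hC₁, h1⟩ := LFunction_convexity h hδ hδ1
  obtain ⟨C₂, hC₂, h2⟩ := LFunction_littlewood h hδ (show 0 < R + 2 * δ by linarith)
  refine ⟨C₁ + C₂, by positivity, fun s hs him => ?_⟩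
  rw [LVal_eq]
  rcases le_total s.re (1 / 2 + δ) with hr | hr
  · refine (h1 s (by linarith) hr (by linarith)).trans ?_
    have : |s.im| ^ (1 / 2 - s.re + 2 * δ) ≤ |s.im| ^ (R + 2 * δ) :=
      Real.rpow_le_rpow_of_exponent_le (by linarith) (by linarith)
    gcongr
    linarith
  · refine (h2 s hr him).1.trans ?_
    gcongr
    linarith

theorem differentiableAt_LVal {N : ℕ} [NeZero N] (ψ : DirichletCharacter ℂ N) {z : ℂ}
    (hz : z ≠ 1) : DifferentiableAt ℂ (LVal ψ) z := by
  rw [LVal_eq]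
  exact DirichletCharacter.differentiableAt_LFunction ψ z (Or.inl hz)

theorem finite_zeros {N₁ N₂ : ℕ} [NeZero N₁] [NeZero N₂] (χ : DirichletCharacter ℂ N₁)
    (ψ : DirichletCharacter ℂ N₂) (T : ℝ) :
    {γ : ℝ | |γ| ≤ T ∧ LVal χ (1 / 2 + γ * I) * LVal ψ (1 / 2 + γ * I) = 0}.Finite := by
  by_contra hinf
  let M : ℂ → ℂ := fun z => LVal χ z * LVal ψ z
  have hM : AnalyticOnNhd ℂ M {1}ᶜ := DifferentiableOn.analyticOnNhd (fun z hz =>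
    ((differentiableAt_LVal χ hz).mul (differentiableAt_LVal ψ hz)).differentiableWithinAt)
    isOpen_compl_singleton
  have hpre : IsPreconnected ({1}ᶜ : Set ℂ) :=
    (isConnected_compl_singleton_of_one_lt_rank (by simp) 1).isPreconnected
  obtain ⟨γ, -, hγ⟩ := Set.Infinite.exists_accPt_of_subset_isCompact hinf
    (isCompact_Icc (a := -T) (b := T)) fun x hx => abs_le.1 hx.1
  rw [accPt_iff_frequently_nhdsNE] at hγ
  have hmap : Tendsto (fun γ : ℝ => (1 / 2 + γ * I : ℂ)) (nhdsWithin γ {γ}ᶜ)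
      (nhdsWithin (1 / 2 + γ * I : ℂ) {(1 / 2 + γ * I : ℂ)}ᶜ) := by
    refine tendsto_nhdsWithin_iff.2 ⟨?_, ?_⟩
    · exact (Continuous.tendsto (by fun_prop) γ).mono_left nhdsWithin_le_nhds
    · filter_upwards [self_mem_nhdsWithin] with x hx h
      exact hx (by simpa using h)
  have hfreq : ∃ᶠ z in nhdsWithin (1 / 2 + γ * I : ℂ) {(1 / 2 + γ * I : ℂ)}ᶜ, M z = 0 :=
    hmap.frequently (hγ.mono fun x hx => hx.2)
  have hmem : (1 / 2 + γ * I : ℂ) ∈ ({1}ᶜ : Set ℂ) := fun h => by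
    have := congrArg re h
    norm_num at this
  have := hM.eqOn_zero_of_preconnected_of_frequently_eq_zero hpre hmem hfreq
    (show (2 : ℂ) ∈ ({1}ᶜ : Set ℂ) by simp)
  have h2 : (1 : ℝ) ≤ (2 : ℂ).re := by norm_num
  simp only [M, LVal_eq, Pi.zero_apply] at this
  exact mul_ne_zero (χ.LFunction_ne_zero_of_one_le_re (Or.inr (by norm_num)) h2)
    (ψ.LFunction_ne_zero_of_one_le_re (Or.inr (by norm_num)) h2) this

theorem norm_F_pow_four_eq {q : ℕ} [NeZero q] (χ : DirichletCharacter ℂ q)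
    (h4 : GRH (mulChiNeg4 (χ ^ 2))) {F : ℂ → ℂ}
    (hFser : ∀ s : ℂ, 1 < s.re → F s = LSeries (STwist χ) s)
    (hFan : DifferentiableOn ℂ F {s : ℂ | 1 / 4 < s.re ∧ (s.re ≤ 1 / 2 →
      LVal χ (1 / 2 + s.im * I) * LVal (mulChiNeg4 χ) (1 / 2 + s.im * I) ≠ 0 ∧
      ¬(s.im = 0 ∧ (χ ^ 2 = 1 ∨ mulChiNeg4 (χ ^ 2) = 1)))}) {s : ℂ}
    (hs : 1 / 4 < s.re) (hs0 : s.im ≠ 0)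
    (hs1 : s.re ≤ 1 / 2 →
      LVal χ (1 / 2 + s.im * I) * LVal (mulChiNeg4 χ) (1 / 2 + s.im * I) ≠ 0) :
    ‖F s‖ ^ 4 = ‖LVal χ s * LVal (mulChiNeg4 χ) s‖ ^ 2 * ‖LVal (χ ^ 2) (2 * s)‖ *
      ‖quarticFactor χ s‖ * ‖(LVal (mulChiNeg4 (χ ^ 2)) (2 * s))⁻¹‖ := by
  have : NeZero (4 * q) := ⟨mul_ne_zero (by norm_num) (NeZero.ne q)⟩
  have hne : LVal (mulChiNeg4 (χ ^ 2)) (2 * s) ≠ 0 := by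
    rw [LVal_eq]
    exact LFunction_ne_zero_of_GRH h4 (by simp; linarith) (by simpa using hs0)
  have key := congrArg norm (F_pow_four_eq χ hFser hFan hs hs0 hs1)
  rw [norm_mul, norm_mul, norm_mul, norm_pow, norm_pow] at key
  rw [norm_inv, eq_mul_inv_iff_mul_eq₀ (norm_ne_zero_iff.2 hne), key]

theorem norm_F_pow_four_le_of_large {q : ℕ} [NeZero q] (χ : DirichletCharacter ℂ q)
    (h1 : GRH χ) (h2 : GRH (mulChiNeg4 χ)) (h3 : GRH (χ ^ 2)) (h4 : GRH (mulChiNeg4 (χ ^ 2)))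
    {F : ℂ → ℂ} (hFser : ∀ s : ℂ, 1 < s.re → F s = LSeries (STwist χ) s)
    (hFan : DifferentiableOn ℂ F {s : ℂ | 1 / 4 < s.re ∧ (s.re ≤ 1 / 2 →
      LVal χ (1 / 2 + s.im * I) * LVal (mulChiNeg4 χ) (1 / 2 + s.im * I) ≠ 0 ∧
      ¬(s.im = 0 ∧ (χ ^ 2 = 1 ∨ mulChiNeg4 (χ ^ 2) = 1)))})
    {R δ : ℝ} (hR : 0 < R) (hR1 : R ≤ 3 / 16) (hδ : 0 < δ) (hδ1 : δ ≤ 1 / 4) :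
    ∃ C, 0 ≤ C ∧ ∀ γ : ℝ, 4 ≤ |γ| →
      LVal χ (1 / 2 + γ * I) * LVal (mulChiNeg4 χ) (1 / 2 + γ * I) = 0 →
      ∀ s ∈ Metric.ball (1 / 2 + γ * I : ℂ) R, (s.re ≤ 1 / 2 →
        LVal χ (1 / 2 + s.im * I) * LVal (mulChiNeg4 χ) (1 / 2 + s.im * I) ≠ 0) →
      ‖F s‖ ^ 4 ≤ C * (|γ| + 1) ^ (4 * R + 10 * δ) * ‖s - (1 / 2 + γ * I)‖ ^ 2 := by
  have : NeZero (4 * q) := ⟨mul_ne_zero (by norm_num) (NeZero.ne q)⟩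
  obtain ⟨C₁, hC₁, b1⟩ := norm_LVal_le_rpow h1 hR.le (by linarith) hδ hδ1
  obtain ⟨C₂, hC₂, b2⟩ := norm_LVal_le_rpow h2 hR.le (by linarith) hδ hδ1
  obtain ⟨C₃, hC₃, b3⟩ := LFunction_littlewood h3 (show (0 : ℝ) < 1 / 8 by norm_num) hδ
  obtain ⟨C₄, hC₄, b4⟩ := LFunction_littlewood h4 (show (0 : ℝ) < 1 / 8 by norm_num) hδ
  obtain ⟨B, hB, b5⟩ := norm_quarticFactor_le χ
  refine ⟨((C₁ * C₂) / R) ^ 2 * (C₃ * 2 ^ δ) * B * (C₄ * 2 ^ δ), by positivity,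
    fun γ hγ hz s hs hs1 => ?_⟩
  have hball : ∀ z ∈ Metric.ball (1 / 2 + γ * I : ℂ) R,
      1 / 2 - R ≤ z.re ∧ |γ| - R ≤ |z.im| ∧ |z.im| ≤ |γ| + 1 := by
    intro z hz
    rw [mem_ball_iff_norm] at hz
    have hre := (abs_re_le_norm _).trans hz.le
    have him := (abs_im_le_norm _).trans hz.le
    simp only [sub_re, add_re, mul_re, sub_im, add_im, mul_im] at hre him
    norm_num at hre him
    have e1 := abs_sub_abs_le_abs_sub z.im γ
    have e2 := abs_sub_abs_le_abs_sub γ z.im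
    rw [abs_sub_comm] at e2
    refine ⟨by linarith [(abs_le.1 hre).1], by linarith, by linarith⟩
  set t : ℝ := |γ| + 1 with ht
  have ht0 : 0 < t := by positivity
  let M : ℂ → ℂ := fun z => LVal χ z * LVal (mulChiNeg4 χ) z
  have hMb : ∀ z ∈ Metric.ball (1 / 2 + γ * I : ℂ) R,
      ‖M z‖ ≤ C₁ * C₂ * t ^ (2 * R + 4 * δ) := by
    intro z hz
    obtain ⟨a1, a2, a3⟩ := hball z hz
    have a4 : 3 ≤ |z.im| := by linarith
    have e1 : ‖LVal χ z‖ ≤ C₁ * t ^ (R + 2 * δ) := (b1 z a1 a4).trans (by gcongr)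
    have e2 : ‖LVal (mulChiNeg4 χ) z‖ ≤ C₂ * t ^ (R + 2 * δ) := (b2 z a1 a4).trans (by gcongr)
    have e3 : t ^ (R + 2 * δ) * t ^ (R + 2 * δ) = t ^ (2 * R + 4 * δ) := by
      rw [← Real.rpow_add ht0]; ring_nf
    calc ‖M z‖ ≤ (C₁ * t ^ (R + 2 * δ)) * (C₂ * t ^ (R + 2 * δ)) := by
          rw [norm_mul]; gcongr
      _ = C₁ * C₂ * t ^ (2 * R + 4 * δ) := by rw [← e3]; ring
  have hMd : DifferentiableOn ℂ M (Metric.ball (1 / 2 + γ * I : ℂ) R) := fun z hz => by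
    have hz1 : z ≠ 1 := fun h => by
      have := (hball z hz).2.1
      rw [h, one_im, abs_zero] at this
      linarith
    exact ((differentiableAt_LVal χ hz1).mul
      (differentiableAt_LVal (mulChiNeg4 χ) hz1)).differentiableWithinAt
  have hMz : M (1 / 2 + γ * I) = 0 := hz
  have hM : ‖M s‖ ≤ (C₁ * C₂) * t ^ (2 * R + 4 * δ) / R * ‖s - (1 / 2 + γ * I)‖ := by
    have := Complex.dist_le_div_mul_dist_of_mapsTo_ball hMd
      (R₂ := (C₁ * C₂) * t ^ (2 * R + 4 * δ)) (fun z hz => by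
        rw [hMz, mem_closedBall_zero_iff]
        exact hMb z hz) hs
    rwa [hMz, dist_zero_right, dist_eq_norm] at this
  obtain ⟨a1, a2, a3⟩ := hball s hs
  have a4 : 3 ≤ |s.im| := by linarith
  have hs0 : s.im ≠ 0 := fun h => by rw [h, abs_zero] at a4; linarith
  have him2 : |(2 * s).im| = 2 * |s.im| := by simp [abs_mul]
  have hre2 : 1 / 2 + 1 / 8 ≤ (2 * s).re := by simp; linarith
  have h2δ : |(2 * s).im| ^ δ ≤ 2 ^ δ * t ^ δ := by
    rw [him2, Real.mul_rpow (by norm_num) (abs_nonneg _)]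
    gcongr
  have e3 : ‖LVal (χ ^ 2) (2 * s)‖ ≤ C₃ * 2 ^ δ * t ^ δ := by
    rw [LVal_eq, mul_assoc]
    exact (b3 _ hre2 (by linarith)).1.trans (by gcongr)
  have e4 : ‖(LVal (mulChiNeg4 (χ ^ 2)) (2 * s))⁻¹‖ ≤ C₄ * 2 ^ δ * t ^ δ := by
    rw [LVal_eq, mul_assoc]
    exact (b4 _ hre2 (by linarith)).2.trans (by gcongr)
  have e5 := b5 s (by linarith)
  rw [norm_F_pow_four_eq χ h4 hFser hFan (by linarith) hs0 hs1]
  have e6 : t ^ (4 * R + 10 * δ) = (t ^ (2 * R + 4 * δ)) ^ 2 * t ^ δ * t ^ δ := by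
    rw [sq, ← Real.rpow_add ht0, ← Real.rpow_add ht0, ← Real.rpow_add ht0]; ring_nf
  calc _ ≤ ((C₁ * C₂) * t ^ (2 * R + 4 * δ) / R * ‖s - (1 / 2 + γ * I)‖) ^ 2 *
        (C₃ * 2 ^ δ * t ^ δ) * B * (C₄ * 2 ^ δ * t ^ δ) := by gcongr
    _ = _ := by rw [e6]; ring

theorem norm_F_pow_four_le_near {q : ℕ} [NeZero q] (χ : DirichletCharacter ℂ q)
    (h4 : GRH (mulChiNeg4 (χ ^ 2)))
    {F : ℂ → ℂ} (hFser : ∀ s : ℂ, 1 < s.re → F s = LSeries (STwist χ) s)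
    (hFan : DifferentiableOn ℂ F {s : ℂ | 1 / 4 < s.re ∧ (s.re ≤ 1 / 2 →
      LVal χ (1 / 2 + s.im * I) * LVal (mulChiNeg4 χ) (1 / 2 + s.im * I) ≠ 0 ∧
      ¬(s.im = 0 ∧ (χ ^ 2 = 1 ∨ mulChiNeg4 (χ ^ 2) = 1)))})
    {R : ℝ} (hR1 : R ≤ 3 / 16) {γ : ℝ} (hγ : γ ≠ 0)
    (hz : LVal χ (1 / 2 + γ * I) * LVal (mulChiNeg4 χ) (1 / 2 + γ * I) = 0) :
    ∃ C, 0 ≤ C ∧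
      ∀ s ∈ Metric.closedBall (1 / 2 + γ * I : ℂ) R, |s.im - γ| ≤ |γ| / 2 → (s.re ≤ 1 / 2 →
        LVal χ (1 / 2 + s.im * I) * LVal (mulChiNeg4 χ) (1 / 2 + s.im * I) ≠ 0) →
      ‖F s‖ ^ 4 ≤ C * ‖s - (1 / 2 + γ * I)‖ ^ 2 := by
  have : NeZero (4 * q) := ⟨mul_ne_zero (by norm_num) (NeZero.ne q)⟩
  set ρ : ℂ := 1 / 2 + γ * I with hρ
  let M : ℂ → ℂ := fun z => LVal χ z * LVal (mulChiNeg4 χ) z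
  let K : Set ℂ := Metric.closedBall ρ R ∩ {s | |s.im - γ| ≤ |γ| / 2}
  have hK : IsCompact K := (isCompact_closedBall ρ R).inter_right
    (isClosed_le (by fun_prop) continuous_const)
  have hKim : ∀ s ∈ K, s.im ≠ 0 := by
    rintro s ⟨-, hs⟩ h
    rw [Set.mem_ofPred_eq, h, zero_sub, abs_neg] at hs
    have := abs_pos.2 hγ
    linarith
  have hKre : ∀ s ∈ K, 5 / 16 ≤ s.re := by
    rintro s ⟨hs, -⟩
    rw [mem_closedBall_iff_norm] at hs
    have hre := (abs_re_le_norm _).trans hs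
    simp only [hρ, sub_re, add_re, mul_re] at hre
    norm_num at hre
    linarith [(abs_le.1 hre).1]
  have hne1 : ∀ z : ℂ, z.im ≠ 0 → z ≠ 1 := fun z hz h => hz (by rw [h]; simp)
  have hMd : ∀ z : ℂ, z.im ≠ 0 → DifferentiableAt ℂ M z := fun z hz =>
    (differentiableAt_LVal χ (hne1 z hz)).mul (differentiableAt_LVal (mulChiNeg4 χ) (hne1 z hz))
  have hρim : ρ.im ≠ 0 := by simpa [hρ] using hγ
  have hdsl : ContinuousOn (dslope M ρ) K := fun z hz => by
    refine ContinuousAt.continuousWithinAt ?_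
    rcases eq_or_ne z ρ with rfl | h
    · exact continuousAt_dslope_same.2 (hMd _ hρim)
    · exact (continuousAt_dslope_of_ne h).2 (hMd z (hKim z hz)).continuousAt
  have h2ne : ∀ z ∈ K, (2 * z) ≠ 1 := fun z hz => hne1 _ (by simpa using hKim z hz)
  have hc3 : ContinuousOn (fun z => LVal (χ ^ 2) (2 * z)) K := fun z hz =>
    (DifferentiableAt.comp (g := LVal (χ ^ 2)) z (differentiableAt_LVal _ (h2ne z hz))
      (differentiableAt_id.const_mul 2)).continuousAt.continuousWithinAt
  have hc4 : ContinuousOn (fun z => (LVal (mulChiNeg4 (χ ^ 2)) (2 * z))⁻¹) K := fun z hz => by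
    refine (DifferentiableAt.comp (g := LVal (mulChiNeg4 (χ ^ 2))) z
      (differentiableAt_LVal _ (h2ne z hz))
      (differentiableAt_id.const_mul 2)).continuousAt.continuousWithinAt.inv₀ ?_
    simp only [Function.comp, LVal_eq]
    refine LFunction_ne_zero_of_GRH h4 ?_ (by simpa using hKim z hz)
    have := hKre z hz
    simp; linarith
  have hc5 : ContinuousOn (quarticFactor χ) K := fun z hz =>
    (differentiableAt_quarticFactor χ
      (by linarith [hKre z hz])).continuousAt.continuousWithinAt
  obtain ⟨C, hC⟩ := hK.exists_bound_of_continuousOn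
    ((((hdsl.pow 2).mul hc3).mul hc5).mul hc4)
  refine ⟨|C|, abs_nonneg C, fun s hs him hs1 => ?_⟩
  have hsK : s ∈ K := ⟨hs, him⟩
  rw [norm_F_pow_four_eq χ h4 hFser hFan (by linarith [hKre s hsK]) (hKim s hsK) hs1]
  have hMz : M ρ = 0 := hz
  have hMs : LVal χ s * LVal (mulChiNeg4 χ) s = (s - ρ) * dslope M ρ s := by
    have := sub_smul_dslope M ρ s
    rw [hMz, sub_zero, smul_eq_mul] at this
    exact this.symm
  have := hC s hsK
  simp only [Pi.mul_apply, Pi.pow_apply, norm_mul, norm_pow] at this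
  rw [hMs, norm_mul]
  calc _ = (‖dslope M ρ s‖ ^ 2 * ‖LVal (χ ^ 2) (2 * s)‖ * ‖quarticFactor χ s‖ *
        ‖(LVal (mulChiNeg4 (χ ^ 2)) (2 * s))⁻¹‖) * ‖s - ρ‖ ^ 2 := by ring
    _ ≤ _ := by
      gcongr
      exact this.trans (le_abs_self C)

theorem norm_F_le {q : ℕ} [NeZero q] (χ : DirichletCharacter ℂ q)
    (h1 : GRH χ) (h2 : GRH (mulChiNeg4 χ)) (h3 : GRH (χ ^ 2)) (h4 : GRH (mulChiNeg4 (χ ^ 2)))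
    {F : ℂ → ℂ} (hFser : ∀ s : ℂ, 1 < s.re → F s = LSeries (STwist χ) s)
    (hFan : DifferentiableOn ℂ F {s : ℂ | 1 / 4 < s.re ∧ (s.re ≤ 1 / 2 →
      LVal χ (1 / 2 + s.im * I) * LVal (mulChiNeg4 χ) (1 / 2 + s.im * I) ≠ 0 ∧
      ¬(s.im = 0 ∧ (χ ^ 2 = 1 ∨ mulChiNeg4 (χ ^ 2) = 1)))})
    {c ε : ℝ} (hc0 : 0 < c) (hc1 : c < 1 / 8) (hε : 0 < ε) :
    ∃ C R, 0 ≤ C ∧ c < R ∧ ∀ γ : ℝ, γ ≠ 0 →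
      LVal χ (1 / 2 + γ * I) * LVal (mulChiNeg4 χ) (1 / 2 + γ * I) = 0 →
      ∀ s ∈ Metric.ball (1 / 2 + γ * I : ℂ) R, |s.im - γ| ≤ |γ| / 2 → (s.re ≤ 1 / 2 →
        LVal χ (1 / 2 + s.im * I) * LVal (mulChiNeg4 χ) (1 / 2 + s.im * I) ≠ 0) →
      ‖F s‖ ≤ C * (|γ| + 1) ^ (c + ε) * ‖s - (1 / 2 + γ * I)‖ ^ (1 / 2 : ℝ) := by
  have : NeZero (4 * q) := ⟨mul_ne_zero (by norm_num) (NeZero.ne q)⟩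
  set κ : ℝ := min (1 / 16) (ε / 2) with hκ
  set δ : ℝ := min (1 / 4) (ε / 5) with hδ
  have hκ0 : 0 < κ := lt_min (by norm_num) (by linarith)
  have hδ0 : 0 < δ := lt_min (by norm_num) (by linarith)
  have hκ1 : κ ≤ 1 / 16 := min_le_left _ _
  have hδ1 : δ ≤ 1 / 4 := min_le_left _ _
  have hκ2 : κ ≤ ε / 2 := min_le_right _ _
  have hδ2 : δ ≤ ε / 5 := min_le_right _ _
  obtain ⟨A, hA, bA⟩ := norm_F_pow_four_le_of_large χ h1 h2 h3 h4 hFser hFan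
    (show 0 < c + κ by linarith) (by linarith) hδ0 hδ1
  have hfin := finite_zeros χ (mulChiNeg4 χ) 4
  have hnear : ∀ γ : ℝ, ∃ C, 0 ≤ C ∧ (γ ≠ 0 →
      LVal χ (1 / 2 + γ * I) * LVal (mulChiNeg4 χ) (1 / 2 + γ * I) = 0 →
      ∀ s ∈ Metric.closedBall (1 / 2 + γ * I : ℂ) (c + κ), |s.im - γ| ≤ |γ| / 2 →
        (s.re ≤ 1 / 2 →
          LVal χ (1 / 2 + s.im * I) * LVal (mulChiNeg4 χ) (1 / 2 + s.im * I) ≠ 0) →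
      ‖F s‖ ^ 4 ≤ C * ‖s - (1 / 2 + γ * I)‖ ^ 2) := by
    intro γ
    by_cases h : γ ≠ 0 ∧ LVal χ (1 / 2 + γ * I) * LVal (mulChiNeg4 χ) (1 / 2 + γ * I) = 0
    · obtain ⟨C, hC, hb⟩ := norm_F_pow_four_le_near χ h4 hFser hFan
        (show c + κ ≤ 3 / 16 by linarith) h.1 h.2
      exact ⟨C, hC, fun _ _ => hb⟩
    · exact ⟨0, le_rfl, fun a b => absurd ⟨a, b⟩ h⟩
  choose D hD bD using hnear
  set K : ℝ := A + ∑ γ ∈ hfin.toFinset, D γ with hK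
  have hS : 0 ≤ ∑ γ ∈ hfin.toFinset, D γ := Finset.sum_nonneg fun γ _ => hD γ
  have hK0 : 0 ≤ K := by linarith
  refine ⟨1 + K, c + κ, by linarith, by linarith, fun γ hγ hz s hs him hs1 => ?_⟩
  set t : ℝ := |γ| + 1 with ht
  have ht1 : 1 ≤ t := by linarith [abs_nonneg γ]
  have ht0 : 0 < t := by linarith
  have hF4 : ‖F s‖ ^ 4 ≤ K * t ^ (4 * (c + ε)) * ‖s - (1 / 2 + γ * I)‖ ^ 2 := by
    rcases le_total 4 |γ| with h | h
    · refine (bA γ h hz s hs hs1).trans ?_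
      have : t ^ (4 * (c + κ) + 10 * δ) ≤ t ^ (4 * (c + ε)) :=
        Real.rpow_le_rpow_of_exponent_le ht1 (by linarith)
      gcongr
      linarith
    · refine (bD γ hγ hz s (Metric.ball_subset_closedBall hs) him hs1).trans ?_
      have h1 : D γ ≤ K := by
        have := Finset.single_le_sum (f := D) (fun γ _ => hD γ) (hfin.mem_toFinset.2 ⟨h, hz⟩)
        linarith
      have h2 : 1 ≤ t ^ (4 * (c + ε)) := Real.one_le_rpow ht1 (by positivity)
      gcongr
      nlinarith
  refine le_of_pow_le_pow_left₀ four_ne_zero (by positivity) (hF4.trans ?_)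
  have e1 : (t ^ (c + ε)) ^ 4 = t ^ (4 * (c + ε)) := by
    rw [← Real.rpow_natCast, ← Real.rpow_mul ht0.le]; congr 1; push_cast; ring
  have e2 : (‖s - (1 / 2 + γ * I)‖ ^ (1 / 2 : ℝ)) ^ 4 = ‖s - (1 / 2 + γ * I)‖ ^ 2 := by
    rw [← Real.rpow_natCast, ← Real.rpow_mul (norm_nonneg _), ← Real.rpow_natCast]; congr 1
    norm_num
  rw [mul_pow, mul_pow, e1, e2]
  have h3 : K ≤ (1 + K) ^ 4 := by
    have : 1 + K ≤ (1 + K) ^ 4 := le_self_pow₀ (by linarith) (by norm_num)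
    linarith
  gcongr

theorem exists_tendsto_of_tendsto_pow_four {f : ℝ → ℂ} {η : ℝ} {g : ℂ} (hη : 0 < η)
    (hf : ContinuousOn f (Set.Ioo 0 η))
    (hg : Tendsto (fun t => f t ^ 4) (nhdsWithin 0 (Set.Ioi 0)) (nhds g)) :
    ∃ l, Tendsto f (nhdsWithin 0 (Set.Ioi 0)) (nhds l) := by
  rcases eq_or_ne g 0 with rfl | hg0
  · refine ⟨0, tendsto_zero_iff_norm_tendsto_zero.2 ?_⟩
    have h1 : Tendsto (fun t => (‖f t ^ 4‖) ^ (1 / 4 : ℝ)) (nhdsWithin 0 (Set.Ioi 0))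
        (nhds ((‖(0 : ℂ)‖) ^ (1 / 4 : ℝ))) :=
      hg.norm.rpow_const (Or.inr (by norm_num))
    rw [norm_zero, Real.zero_rpow (by norm_num)] at h1
    refine h1.congr fun t => ?_
    rw [norm_pow, ← Real.rpow_natCast, ← Real.rpow_mul (norm_nonneg _)]
    norm_num
  · obtain ⟨w, hw⟩ := IsAlgClosed.exists_pow_nat_eq g (show 0 < 4 by norm_num)
    have hw0 : w ≠ 0 := by rintro rfl; exact hg0 (by rw [← hw]; norm_num)
    have h1 : Tendsto (fun t => f t ^ 4 / g) (nhdsWithin 0 (Set.Ioi 0)) (nhds 1) := by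
      simpa [hg0] using hg.div_const g
    have hslit : ∀ᶠ t in nhdsWithin (0 : ℝ) (Set.Ioi 0), f t ^ 4 / g ∈ slitPlane :=
      h1.eventually (isOpen_slitPlane.mem_nhds one_mem_slitPlane)
    obtain ⟨η', hη', hsub⟩ := mem_nhdsGT_iff_exists_Ioo_subset.1 hslit
    have hη'0 : 0 < η' := hη'
    set J : Set ℝ := Set.Ioo 0 (min η η') with hJ
    have hJ1 : ∀ t ∈ J, t ∈ Set.Ioo 0 η := fun t ht => ⟨ht.1, ht.2.trans_le (min_le_left _ _)⟩
    have hJ2 : ∀ t ∈ J, f t ^ 4 / g ∈ slitPlane := fun t ht =>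
      hsub ⟨ht.1, ht.2.trans_le (min_le_right _ _)⟩
    have hJn : J ∈ nhdsWithin (0 : ℝ) (Set.Ioi 0) := Ioo_mem_nhdsGT (lt_min hη hη'0)
    let h : ℝ → ℂ := fun t => w * (f t ^ 4 / g) ^ (1 / 4 : ℂ)
    have hh4 : ∀ t ∈ J, h t ^ 4 = f t ^ 4 := fun t ht => by
      have : ((f t ^ 4 / g) ^ (1 / 4 : ℂ)) ^ 4 = f t ^ 4 / g := by
        rw [← cpow_nat_mul]; norm_num
      simp only [h, mul_pow, this, hw]
      field_simp
    have hh0 : ∀ t ∈ J, h t ≠ 0 := fun t ht => by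
      refine mul_ne_zero hw0 ?_
      rw [cpow_ne_zero_iff_of_exponent_ne_zero (by norm_num)]
      exact slitPlane_ne_zero (hJ2 t ht)
    have hhc : ContinuousOn h J := by
      refine continuousOn_const.mul (ContinuousOn.cpow_const ?_ hJ2)
      exact ((hf.mono hJ1).pow 4).div_const g
    have hhl : Tendsto h (nhdsWithin 0 (Set.Ioi 0)) (nhds w) := by
      have := (h1.cpow (tendsto_const_nhds (x := (1 / 4 : ℂ))) one_mem_slitPlane).const_mul w
      simpa [h] using this
    have hfin : Set.Finite {z : ℂ | z ^ 4 = 1} := by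
      have : {z : ℂ | z ^ 4 = 1} ⊆ ((Polynomial.nthRootsFinset 4 (1 : ℂ) : Finset ℂ) : Set ℂ) := by
        intro z hz
        exact Finset.mem_coe.2 ((Polynomial.mem_nthRootsFinset (by norm_num) 1).2 hz)
      exact (Finset.finite_toSet _).subset this
    have hconst : ∀ x ∈ J, ∀ y ∈ J, f x / h x = f y / h y := fun x hx y hy =>
      isPreconnected_Ioo.constant_of_mapsTo (f := fun t => f t / h t) (T := {z : ℂ | z ^ 4 = 1})
        hfin.isDiscrete ((hf.mono hJ1).div hhc hh0) (fun t ht => by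
          rw [Set.mem_ofPred_eq, div_pow, hh4 t ht, div_self]
          rw [← hh4 t ht]
          exact pow_ne_zero 4 (hh0 t ht)) hx hy
    have hx0 : min η η' / 2 ∈ J := ⟨by have := lt_min hη hη'0; linarith,
      by have := lt_min hη hη'0; linarith⟩
    refine ⟨f (min η η' / 2) / h (min η η' / 2) * w, (hhl.const_mul _).congr' ?_⟩
    filter_upwards [hJn] with t ht
    rw [hconst _ hx0 t ht, div_mul_cancel₀ _ (hh0 t ht)]

/-- A punctured neighbourhood of `1/2 + iγ`, slit along the horizontal ray to the left. -/
def slitBall (γ R η : ℝ) : Set ℂ :=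
  {s | s ∈ Metric.ball (1 / 2 + γ * I : ℂ) R ∧ |s.im - γ| < η ∧ (s.re ≤ 1 / 2 → s.im ≠ γ)}

theorem mem_slitBall_of_lt {γ R η c e σ t : ℝ} (he : |e| = 1) (hσ : σ ∈ Set.Icc (1 / 2 - c) (1 / 2))
    (ht : 0 < t) (ht1 : t < η) (ht2 : t < R - c) :
    (σ + (γ + e * t) * I : ℂ) ∈ slitBall γ R η := by
  have h1 : (σ + (γ + e * t) * I : ℂ).im - γ = e * t := by simp
  have h2 : |e * t| = t := by rw [abs_mul, he, one_mul, abs_of_pos ht]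
  refine ⟨?_, by rw [h1, h2]; exact ht1, fun _ h => ?_⟩
  · rw [mem_ball_iff_norm]
    have : (σ + (γ + e * t) * I : ℂ) - (1 / 2 + γ * I) = ((σ - 1 / 2 : ℝ) : ℂ) + (e * t : ℝ) * I := by
      push_cast; ring
    rw [this]
    refine (norm_add_le _ _).trans_lt ?_
    rw [norm_mul, norm_real, norm_real, norm_I, mul_one, Real.norm_eq_abs, Real.norm_eq_abs, h2,
      abs_of_nonpos (by linarith [hσ.2])]
    linarith [hσ.1]
  · rw [h, sub_self] at h1
    rw [← h1, abs_zero] at h2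
    exact ht.ne h2

theorem exists_boundary_value {F G : ℂ → ℂ} {γ c R η B e : ℝ} (he : |e| = 1)
    (hcR : c < R) (hη : 0 < η) (hF : ContinuousOn F (slitBall γ R η))
    (hb : ∀ s ∈ slitBall γ R η, ‖F s‖ ≤ B * ‖s - (1 / 2 + γ * I)‖ ^ (1 / 2 : ℝ))
    (hG : ∀ σ ∈ Set.Icc (1 / 2 - c) (1 / 2), ContinuousAt G (σ + γ * I))
    (hFG : ∀ s ∈ slitBall γ R η, F s ^ 4 = G s) :
    ∃ φ : ℝ → ℂ,
      MeasureTheory.AEStronglyMeasurable φ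
        (MeasureTheory.volume.restrict (Set.Icc (1 / 2 - c) (1 / 2))) ∧
      (∀ σ ∈ Set.Icc (1 / 2 - c) (1 / 2), ‖φ σ‖ ≤ B * (1 / 2 - σ) ^ (1 / 2 : ℝ)) ∧
      ∀ σ ∈ Set.Icc (1 / 2 - c) (1 / 2), Tendsto (fun t : ℝ => F (σ + (γ + e * t) * I))
        (nhdsWithin 0 (Set.Ioi 0)) (nhds (φ σ)) := by
  have hη' : 0 < min η (R - c) := lt_min hη (by linarith)
  have hmem : ∀ σ ∈ Set.Icc (1 / 2 - c) (1 / 2), ∀ t ∈ Set.Ioo 0 (min η (R - c)),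
      (σ + (γ + e * t) * I : ℂ) ∈ slitBall γ R η := fun σ hσ t ht =>
    mem_slitBall_of_lt he hσ ht.1 (ht.2.trans_le (min_le_left _ _))
      (ht.2.trans_le (min_le_right _ _))
  have hJ : Set.Ioo 0 (min η (R - c)) ∈ nhdsWithin (0 : ℝ) (Set.Ioi 0) := Ioo_mem_nhdsGT hη'
  have hlim : ∀ σ : ℝ, Tendsto (fun t : ℝ => (σ + (γ + e * t) * I : ℂ))
      (nhdsWithin 0 (Set.Ioi 0)) (nhds (σ + γ * I)) := fun σ => by
    have : Continuous fun t : ℝ => (σ + (γ + e * t) * I : ℂ) := by fun_prop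
    simpa using (this.tendsto 0).mono_left nhdsWithin_le_nhds
  have hex : ∀ σ : ℝ, ∃ l, σ ∈ Set.Icc (1 / 2 - c) (1 / 2) →
      Tendsto (fun t : ℝ => F (σ + (γ + e * t) * I)) (nhdsWithin 0 (Set.Ioi 0)) (nhds l) := by
    intro σ
    by_cases hσ : σ ∈ Set.Icc (1 / 2 - c) (1 / 2)
    · obtain ⟨l, hl⟩ := exists_tendsto_of_tendsto_pow_four
        (f := fun t : ℝ => F (σ + (γ + e * t) * I)) (g := G (σ + γ * I)) hη'
        (hF.comp (by fun_prop) (hmem σ hσ)) (by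
          refine ((hG σ hσ).tendsto.comp (hlim σ)).congr' ?_
          filter_upwards [hJ] with t ht
          exact (hFG _ (hmem σ hσ t ht)).symm)
      exact ⟨l, fun _ => hl⟩
    · exact ⟨0, fun h => absurd h hσ⟩
  choose φ hφ using hex
  refine ⟨φ, ?_, fun σ hσ => ?_, hφ⟩
  · have hseq : Tendsto (fun n : ℕ => min η (R - c) / ((n : ℝ) + 2)) atTop
        (nhdsWithin 0 (Set.Ioi 0)) := by
      refine tendsto_nhdsWithin_iff.2 ⟨?_, Eventually.of_forall fun n =>
        div_pos hη' (by positivity)⟩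
      exact Tendsto.const_div_atTop
        (tendsto_atTop_add_const_right _ _ tendsto_natCast_atTop_atTop) _
    refine aestronglyMeasurable_of_tendsto_ae atTop
      (f := fun (n : ℕ) (σ : ℝ) => F (σ + (γ + e * (min η (R - c) / ((n : ℝ) + 2) : ℝ)) * I))
      (fun n => ?_) ?_
    · refine ContinuousOn.aestronglyMeasurable ?_ measurableSet_Icc
      refine hF.comp (by fun_prop) fun σ hσ => hmem σ hσ _ ⟨div_pos hη' (by positivity), ?_⟩
      exact div_lt_self hη' (by have : (0 : ℝ) ≤ n := n.cast_nonneg; linarith)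
    · filter_upwards [MeasureTheory.ae_restrict_mem measurableSet_Icc] with σ hσ
      exact (hφ σ hσ).comp hseq
  · refine le_of_tendsto_of_tendsto (hφ σ hσ).norm
      (((((hlim σ).sub_const (1 / 2 + γ * I)).norm.rpow_const
        (Or.inr (show (0 : ℝ) ≤ 1 / 2 by norm_num))).const_mul B).trans (le_of_eq ?_)) ?_
    · have : (σ + γ * I - (1 / 2 + γ * I) : ℂ) = ((σ - 1 / 2 : ℝ) : ℂ) := by push_cast; ring
      rw [this, norm_real, Real.norm_eq_abs, abs_of_nonpos (by linarith [hσ.2]), neg_sub]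
    · filter_upwards [hJ] with t ht
      exact hb _ (hmem σ hσ t ht)

theorem tendsto_segment_integral {F k : ℂ → ℂ} {γ c R η B e : ℝ} {φ : ℝ → ℂ} (he : |e| = 1)
    (hc : c < 1 / 2) (hcR : c < R) (hη : 0 < η) (hB : 0 ≤ B)
    (hF : ContinuousOn F (slitBall γ R η))
    (hb : ∀ s ∈ slitBall γ R η, ‖F s‖ ≤ B * ‖s - (1 / 2 + γ * I)‖ ^ (1 / 2 : ℝ))
    (hk : ContinuousOn k {s | 0 < s.re})
    (hφ : ∀ σ ∈ Set.Icc (1 / 2 - c) (1 / 2), Tendsto (fun t : ℝ => F (σ + (γ + e * t) * I))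
        (nhdsWithin 0 (Set.Ioi 0)) (nhds (φ σ))) {r : ℝ} (hr : 0 < r) (hrc : r < c) :
    Tendsto (fun t : ℝ => ∫ σ in (1 / 2 - c)..(1 / 2 - r),
        F (σ + (γ + e * t) * I) * k (σ + (γ + e * t) * I)) (nhdsWithin 0 (Set.Ioi 0))
      (nhds (∫ σ in (1 / 2 - c)..(1 / 2 - r), φ σ * k (σ + γ * I))) := by
  set η' := min η (R - c) with hη'def
  have hη' : 0 < η' := lt_min hη (by linarith)
  have hJ : Set.Ioo 0 η' ∈ nhdsWithin (0 : ℝ) (Set.Ioi 0) := Ioo_mem_nhdsGT hη'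
  have hIcc : ∀ σ ∈ Set.uIoc (1 / 2 - c) (1 / 2 - r), σ ∈ Set.Icc (1 / 2 - c) (1 / 2) := by
    intro σ hσ
    rw [Set.uIoc_of_le (by linarith)] at hσ
    exact ⟨hσ.1.le, by linarith [hσ.2]⟩
  have hmem : ∀ σ ∈ Set.Icc (1 / 2 - c) (1 / 2), ∀ t ∈ Set.Ioo 0 η',
      (σ + (γ + e * t) * I : ℂ) ∈ slitBall γ R η := fun σ hσ t ht =>
    mem_slitBall_of_lt he hσ ht.1 (ht.2.trans_le (min_le_left _ _))
      (ht.2.trans_le (min_le_right _ _))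
  have hbox : Set.Icc (1 / 2 - c) (1 / 2) ×ℂ Set.Icc (γ - η') (γ + η') ⊆ {s : ℂ | 0 < s.re} := by
    intro s hs
    have : 1 / 2 - c ≤ s.re := (mem_reProdIm.1 hs).1.1
    exact lt_of_lt_of_le (by linarith) this
  obtain ⟨K, hK⟩ := ((isCompact_Icc (a := 1 / 2 - c) (b := 1 / 2)).reProdIm
    (isCompact_Icc (a := γ - η') (b := γ + η'))).exists_bound_of_continuousOn (hk.mono hbox)
  have hbound : ∀ σ ∈ Set.Icc (1 / 2 - c) (1 / 2), ∀ t ∈ Set.Ioo 0 η',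
      ‖F (σ + (γ + e * t) * I) * k (σ + (γ + e * t) * I)‖ ≤ B * R ^ (1 / 2 : ℝ) * |K| := by
    intro σ hσ t ht
    have h1 := hmem σ hσ t ht
    have h2 : ‖k (σ + (γ + e * t) * I)‖ ≤ |K| := by
      refine (hK _ (mem_reProdIm.2 ⟨by simpa using hσ, ?_⟩)).trans (le_abs_self K)
      have h3 : |e * t| ≤ η' := by rw [abs_mul, he, one_mul, abs_of_pos ht.1]; exact ht.2.le
      have := abs_le.1 h3
      simp only [add_im, ofReal_im, mul_im, add_re, ofReal_re, I_im, I_re, mul_re]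
      constructor <;> norm_num <;> linarith
    have h3 : ‖(σ + (γ + e * t) * I : ℂ) - (1 / 2 + γ * I)‖ ≤ R := (mem_ball_iff_norm.1 h1.1).le
    rw [norm_mul]
    refine mul_le_mul ((hb _ h1).trans ?_) h2 (norm_nonneg _)
      (mul_nonneg hB (Real.rpow_nonneg ((norm_nonneg _).trans h3) _))
    gcongr
  refine intervalIntegral.tendsto_integral_filter_of_dominated_convergence
    (fun _ => B * R ^ (1 / 2 : ℝ) * |K|) ?_ ?_ intervalIntegrable_const ?_
  · filter_upwards [hJ] with t ht
    refine ContinuousOn.aestronglyMeasurable ?_ measurableSet_uIoc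
    refine ContinuousOn.mul (hF.comp (by fun_prop) fun σ hσ => hmem σ (hIcc σ hσ) t ht)
      (hk.comp (by fun_prop) fun σ hσ => ?_)
    have := (hIcc σ hσ).1
    simp only [Set.mem_ofPred_eq, add_re, ofReal_re, mul_re, I_re, I_im, add_im, ofReal_im, mul_im]
    norm_num
    linarith
  · filter_upwards [hJ] with t ht
    exact Eventually.of_forall fun σ hσ => hbound σ (hIcc σ hσ) t ht
  · refine Eventually.of_forall fun σ hσ => (hφ σ (hIcc σ hσ)).mul ?_
    have h0 : (0 : ℝ) < (σ + γ * I : ℂ).re := by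
      have := (hIcc σ hσ).1
      simp; linarith
    have hka : ContinuousAt k (σ + γ * I) :=
      hk.continuousAt ((isOpen_lt continuous_const continuous_re).mem_nhds h0)
    refine hka.tendsto.comp ?_
    have : Continuous fun t : ℝ => (σ + (γ + e * t) * I : ℂ) := by fun_prop
    simpa using (this.tendsto 0).mono_left nhdsWithin_le_nhds

theorem hankelIntegral_eq {F G : ℂ → ℂ} {γ c R η B : ℝ}
    (hc : c < 1 / 2) (hcR : c < R) (hη : 0 < η) (hB : 0 ≤ B)
    (hF : ContinuousOn F (slitBall γ R η))
    (hb : ∀ s ∈ slitBall γ R η, ‖F s‖ ≤ B * ‖s - (1 / 2 + γ * I)‖ ^ (1 / 2 : ℝ))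
    (hG : ∀ σ ∈ Set.Icc (1 / 2 - c) (1 / 2), ContinuousAt G (σ + γ * I))
    (hFG : ∀ s ∈ slitBall γ R η, F s ^ 4 = G s) :
    ∃ φ₁ φ₂ : ℝ → ℂ,
      (MeasureTheory.AEStronglyMeasurable φ₁
        (MeasureTheory.volume.restrict (Set.Icc (1 / 2 - c) (1 / 2))) ∧
      ∀ σ ∈ Set.Icc (1 / 2 - c) (1 / 2), ‖φ₁ σ‖ ≤ B * (1 / 2 - σ) ^ (1 / 2 : ℝ)) ∧
      (MeasureTheory.AEStronglyMeasurable φ₂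
        (MeasureTheory.volume.restrict (Set.Icc (1 / 2 - c) (1 / 2))) ∧
      ∀ σ ∈ Set.Icc (1 / 2 - c) (1 / 2), ‖φ₂ σ‖ ≤ B * (1 / 2 - σ) ^ (1 / 2 : ℝ)) ∧
      ∀ k : ℂ → ℂ, ContinuousOn k {s | 0 < s.re} → ∀ r, 0 < r → r < c →
        hankelIntegral (fun s => F s * k s) (1 / 2 + γ * I) c r =
          (∫ σ in (1 / 2 - c)..(1 / 2 - r), φ₁ σ * k (σ + γ * I)) +
          (∫ θ in (-Real.pi)..Real.pi, F (1 / 2 + γ * I + r * exp (θ * I)) *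
            k (1 / 2 + γ * I + r * exp (θ * I)) * (I * r * exp (θ * I))) -
          ∫ σ in (1 / 2 - c)..(1 / 2 - r), φ₂ σ * k (σ + γ * I) := by
  obtain ⟨φ₁, m1, b1, l1⟩ := exists_boundary_value (e := -1) (by simp) hcR hη hF hb hG hFG
  obtain ⟨φ₂, m2, b2, l2⟩ := exists_boundary_value (e := 1) (by simp) hcR hη hF hb hG hFG
  refine ⟨φ₁, φ₂, ⟨m1, b1⟩, ⟨m2, b2⟩, fun k hk r hr hrc => ?_⟩
  have t1 := tendsto_segment_integral (e := -1) (by simp) hc hcR hη hB hF hb hk l1 hr hrc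
  have t2 := tendsto_segment_integral (e := 1) (by simp) hc hcR hη hB hF hb hk l2 hr hrc
  have hre : (1 / 2 + γ * I : ℂ).re = 1 / 2 := by simp
  have him : (1 / 2 + γ * I : ℂ).im = γ := by simp
  rw [hankelIntegral, hre, him]
  refine Tendsto.limUnder_eq (((t1.add_const _).sub t2).congr fun t => ?_)
  simp only [ofReal_neg, ofReal_one, neg_mul, one_mul, ← sub_eq_add_neg]

theorem norm_integral_cpow_le {z : ℂ} {X : ℝ} (hX : 0 < X) (hz0 : 0 ≤ z.re) (hz : z.re ≤ 2) :
    ‖∫ x in X..(2 * X), (x : ℂ) ^ z‖ ≤ 9 * X ^ (z.re + 1) / ‖z + 1‖ := by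
  rw [integral_cpow (Or.inl (by linarith)), norm_div]
  gcongr
  refine (norm_sub_le _ _).trans ?_
  rw [norm_cpow_eq_rpow_re_of_pos hX, norm_cpow_eq_rpow_re_of_pos (by positivity), add_re, one_re,
    Real.mul_rpow (by norm_num) hX.le]
  have : (2 : ℝ) ^ (z.re + 1) ≤ 2 ^ (3 : ℝ) :=
    Real.rpow_le_rpow_of_exponent_le (by norm_num) (by linarith)
  norm_num at this
  have h2 : 0 < X ^ (z.re + 1) := by positivity
  nlinarith

open MeasureTheory in
theorem norm_integral_mul_conj_le {μ ν : Measure ℝ} [SFinite μ] [SFinite ν] {w₁ w₂ s₁ s₂ : ℝ → ℂ}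
    {γ₁ γ₂ X : ℝ} (hX : 1 ≤ X) (hw₁ : Integrable w₁ μ) (hw₂ : Integrable w₂ ν)
    (hs₁ : Measurable s₁) (hs₂ : Measurable s₂)
    (h₁ : ∀ᵐ u ∂μ, 0 ≤ (s₁ u).re ∧ (s₁ u).re ≤ 1 ∧ |(s₁ u).im - γ₁| ≤ 1 / 4)
    (h₂ : ∀ᵐ u ∂ν, 0 ≤ (s₂ u).re ∧ (s₂ u).re ≤ 1 ∧ |(s₂ u).im - γ₂| ≤ 1 / 4) :
    IntervalIntegrable (fun x : ℝ => (∫ u, w₁ u * (x : ℂ) ^ s₁ u ∂μ) *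
      (starRingEnd ℂ) (∫ u, w₂ u * (x : ℂ) ^ s₂ u ∂ν)) volume X (2 * X) ∧
    ‖∫ x in X..(2 * X), (∫ u, w₁ u * (x : ℂ) ^ s₁ u ∂μ) *
      (starRingEnd ℂ) (∫ u, w₂ u * (x : ℂ) ^ s₂ u ∂ν)‖ ≤
      23 * X / (1 + |γ₁ - γ₂|) *
        ((∫ u, ‖w₁ u‖ * X ^ (s₁ u).re ∂μ) * ∫ u, ‖w₂ u‖ * X ^ (s₂ u).re ∂ν) := by
  have hX0 : 0 < X := by linarith
  have hX2 : X ≤ 2 * X := by linarith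
  let W : ℝ × ℝ → ℂ := fun p => w₁ p.1 * (starRingEnd ℂ) (w₂ p.2)
  let Z : ℝ × ℝ → ℂ := fun p => s₁ p.1 + (starRingEnd ℂ) (s₂ p.2)
  have hconj : Measurable (starRingEnd ℂ) := continuous_conj.measurable
  have hw₂' : Integrable (fun u => (starRingEnd ℂ) (w₂ u)) ν :=
    (integrable_norm_iff (continuous_conj.comp_aestronglyMeasurable hw₂.1)).1
      (by simpa using hw₂.norm)
  have hW : Integrable W (μ.prod ν) := hw₁.mul_prod hw₂'
  have hZm : Measurable Z := (hs₁.comp measurable_fst).add (hconj.comp (hs₂.comp measurable_snd))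
  have hZ : ∀ᵐ p ∂(μ.prod ν), 0 ≤ (Z p).re ∧ (Z p).re ≤ 2 ∧ |(Z p).im - (γ₁ - γ₂)| ≤ 1 / 2 := by
    filter_upwards [Measure.quasiMeasurePreserving_fst.ae h₁,
      Measure.quasiMeasurePreserving_snd.ae h₂] with p hp hp'
    have e1 : (Z p).re = (s₁ p.1).re + (s₂ p.2).re := by simp [Z]
    have e2 : (Z p).im - (γ₁ - γ₂) = ((s₁ p.1).im - γ₁) - ((s₂ p.2).im - γ₂) := by
      simp [Z]; ring
    rw [e1, e2]
    exact ⟨by linarith, by linarith, (abs_sub _ _).trans (by linarith)⟩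
  have hprod : ∀ x : ℝ, 0 < x → (∫ u, w₁ u * (x : ℂ) ^ s₁ u ∂μ) *
      (starRingEnd ℂ) (∫ u, w₂ u * (x : ℂ) ^ s₂ u ∂ν) =
      ∫ p, W p * (x : ℂ) ^ Z p ∂(μ.prod ν) := by
    intro x hx
    have hx' : (x : ℂ) ≠ 0 := by exact_mod_cast hx.ne'
    rw [← integral_conj, ← integral_prod_mul]
    refine integral_congr_ae (Eventually.of_forall fun p => ?_)
    have : (starRingEnd ℂ) ((x : ℂ) ^ s₂ p.2) = (x : ℂ) ^ (starRingEnd ℂ) (s₂ p.2) := by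
      rw [cpow_conj _ _ (by rw [arg_ofReal_of_nonneg hx.le]; exact Real.pi_pos.ne), conj_ofReal]
    simp only [W, Z, map_mul, this, cpow_add _ _ hx']
    ring
  have hInt : Integrable (fun a : ℝ × (ℝ × ℝ) => W a.2 * (a.1 : ℂ) ^ Z a.2)
      ((volume.restrict (Set.Ioc X (2 * X))).prod (μ.prod ν)) := by
    refine Integrable.mul_bdd (c := (2 * X) ^ (2 : ℝ)) (hW.comp_snd _) ?_ ?_
    · exact ((measurable_ofReal.comp measurable_fst).pow
        (hZm.comp measurable_snd)).aestronglyMeasurable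
    · filter_upwards [Measure.quasiMeasurePreserving_fst.ae (ae_restrict_mem measurableSet_Ioc),
        Measure.quasiMeasurePreserving_snd.ae hZ] with a ha hb
      have h0 : 0 < a.1 := hX0.trans ha.1
      rw [norm_cpow_eq_rpow_re_of_pos h0]
      exact (Real.rpow_le_rpow h0.le ha.2 hb.1).trans
        (Real.rpow_le_rpow_of_exponent_le (by linarith) hb.2.1)
  have hcongr : ∀ x ∈ Set.Ioc X (2 * X), (∫ p, W p * (x : ℂ) ^ Z p ∂(μ.prod ν)) =
      (∫ u, w₁ u * (x : ℂ) ^ s₁ u ∂μ) *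
        (starRingEnd ℂ) (∫ u, w₂ u * (x : ℂ) ^ s₂ u ∂ν) :=
    fun x hx => (hprod x (hX0.trans hx.1)).symm
  refine ⟨?_, ?_⟩
  · rw [intervalIntegrable_iff_integrableOn_Ioc_of_le hX2]
    refine hInt.integral_prod_left.congr ?_
    filter_upwards [ae_restrict_mem measurableSet_Ioc] with x hx using hcongr x hx
  · rw [intervalIntegral.integral_of_le hX2, ← setIntegral_congr_fun measurableSet_Ioc hcongr,
      integral_integral_swap hInt, ← integral_prod_mul, ← integral_const_mul]
    have hpow : ∀ {s : ℝ → ℂ} {κ : Measure ℝ} {w : ℝ → ℂ} {γ : ℝ}, Integrable w κ → Measurable s →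
        (∀ᵐ u ∂κ, 0 ≤ (s u).re ∧ (s u).re ≤ 1 ∧ |(s u).im - γ| ≤ 1 / 4) →
        Integrable (fun u => ‖w u‖ * X ^ (s u).re) κ := by
      intro s κ w γ hw hs h
      refine hw.norm.mul_bdd (c := X ^ (1 : ℝ))
        (measurable_const.pow (measurable_re.comp hs)).aestronglyMeasurable ?_
      filter_upwards [h] with u hu
      rw [Real.norm_of_nonneg (by positivity)]
      exact Real.rpow_le_rpow_of_exponent_le hX hu.2.1
    refine norm_integral_le_of_norm_le (((hpow hw₁ hs₁ h₁).mul_prod (hpow hw₂ hs₂ h₂)).const_mul _) ?_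
    filter_upwards [hZ] with p hp
    have e0 : (∫ x in Set.Ioc X (2 * X), W p * (x : ℂ) ^ Z p) =
        W p * ∫ x in X..(2 * X), (x : ℂ) ^ Z p := by
      rw [intervalIntegral.integral_of_le hX2, integral_const_mul]
    have e1 : (Z p).re + 1 = (s₁ p.1).re + (s₂ p.2).re + 1 := by simp [Z]
    have e2 : 1 + |γ₁ - γ₂| ≤ 5 / 2 * ‖Z p + 1‖ := by
      have a1 := (abs_re_le_norm (Z p + 1))
      have a2 := (abs_im_le_norm (Z p + 1))
      rw [add_re, one_re, abs_of_nonneg (by linarith [hp.1])] at a1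
      rw [add_im, one_im, add_zero] at a2
      have a3 := abs_sub_abs_le_abs_sub (γ₁ - γ₂) (Z p).im
      rw [abs_sub_comm (γ₁ - γ₂) (Z p).im] at a3
      linarith [hp.1, hp.2.2]
    have e3 : 9 * X ^ ((Z p).re + 1) / ‖Z p + 1‖ ≤
        23 * X / (1 + |γ₁ - γ₂|) * (X ^ (s₁ p.1).re * X ^ (s₂ p.2).re) := by
      have hpos : 0 < 1 + |γ₁ - γ₂| := by positivity
      have hn : 0 < ‖Z p + 1‖ := by linarith
      rw [e1, Real.rpow_add_one hX0.ne', Real.rpow_add hX0, div_le_iff₀ hn]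
      have hP : 0 < X ^ (s₁ p.1).re * X ^ (s₂ p.2).re := by positivity
      generalize X ^ (s₁ p.1).re * X ^ (s₂ p.2).re = P at hP
      rw [div_mul_eq_mul_div, div_mul_eq_mul_div, le_div_iff₀ hpos]
      have hPX : 0 < P * X := by positivity
      nlinarith
    rw [e0, norm_mul]
    calc ‖W p‖ * ‖∫ x in X..(2 * X), (x : ℂ) ^ Z p‖
        ≤ ‖W p‖ * (23 * X / (1 + |γ₁ - γ₂|) * (X ^ (s₁ p.1).re * X ^ (s₂ p.2).re)) := by
          gcongr
          exact (norm_integral_cpow_le hX0 hp.1 hp.2.1).trans e3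
      _ = _ := by
          simp only [W, norm_mul, RCLike.norm_conj]
          ring

theorem exists_slitBall_data {q : ℕ} [NeZero q] (χ : DirichletCharacter ℂ q)
    (h1 : GRH χ) (h2 : GRH (mulChiNeg4 χ)) (h3 : GRH (χ ^ 2)) (h4 : GRH (mulChiNeg4 (χ ^ 2)))
    {F : ℂ → ℂ} (hFser : ∀ s : ℂ, 1 < s.re → F s = LSeries (STwist χ) s)
    (hFan : DifferentiableOn ℂ F {s : ℂ | 1 / 4 < s.re ∧ (s.re ≤ 1 / 2 →
      LVal χ (1 / 2 + s.im * I) * LVal (mulChiNeg4 χ) (1 / 2 + s.im * I) ≠ 0 ∧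
      ¬(s.im = 0 ∧ (χ ^ 2 = 1 ∨ mulChiNeg4 (χ ^ 2) = 1)))})
    {c ε : ℝ} (hc0 : 0 < c) (hc1 : c < 1 / 8) (hε : 0 < ε) :
    ∃ C R G, 0 ≤ C ∧ c < R ∧ ∀ γ : ℝ, γ ≠ 0 →
      LVal χ (1 / 2 + γ * I) * LVal (mulChiNeg4 χ) (1 / 2 + γ * I) = 0 →
      ∃ η > 0, ContinuousOn F (slitBall γ R η) ∧
        (∀ s ∈ slitBall γ R η,
          ‖F s‖ ≤ C * (|γ| + 1) ^ (c + ε) * ‖s - (1 / 2 + γ * I)‖ ^ (1 / 2 : ℝ)) ∧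
        (∀ σ ∈ Set.Icc (1 / 2 - c) (1 / 2), ContinuousAt G (σ + γ * I)) ∧
        ∀ s ∈ slitBall γ R η, F s ^ 4 = G s := by
  obtain ⟨C, R, hC, hcR, hbound⟩ := norm_F_le χ h1 h2 h3 h4 hFser hFan hc0 hc1 hε
  have hne : ∀ s : ℂ, 1 / 4 < s.re → s.im ≠ 0 → LVal (mulChiNeg4 (χ ^ 2)) (2 * s) ≠ 0 := by
    intro s hs hs0
    rw [LVal_eq]
    exact LFunction_ne_zero_of_GRH h4 (by simp; linarith) (by simpa using hs0)
  refine ⟨C, min R (3 / 16), fun s => (LVal χ s * LVal (mulChiNeg4 χ) s) ^ 2 * LVal (χ ^ 2) (2 * s) *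
    quarticFactor χ s / LVal (mulChiNeg4 (χ ^ 2)) (2 * s), hC, lt_min hcR (by linarith),
    fun γ hγ h0 => ?_⟩
  have hfin := (finite_zeros χ (mulChiNeg4 χ) (|γ| + 1)).subset (Set.sdiff_subset (t := {γ}))
  obtain ⟨η, hη, hball⟩ := Metric.mem_nhds_iff.1
    (hfin.isClosed.isOpen_compl.mem_nhds (by simp : γ ∈ _))
  have hγ' : 0 < |γ| := abs_pos.2 hγ
  have hη' : 0 < min η (min (|γ| / 2) 1) := by positivity
  have key : ∀ s ∈ slitBall γ (min R (3 / 16)) (min η (min (|γ| / 2) 1)),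
      1 / 4 < s.re ∧ s.im ≠ 0 ∧ s ∈ Metric.ball (1 / 2 + γ * I : ℂ) R ∧ |s.im - γ| ≤ |γ| / 2 ∧
      (s.re ≤ 1 / 2 →
        LVal χ (1 / 2 + s.im * I) * LVal (mulChiNeg4 χ) (1 / 2 + s.im * I) ≠ 0) := by
    rintro s ⟨hs1, hs2, hs3⟩
    simp only [lt_min_iff] at hs2
    have hre := (abs_re_le_norm (s - (1 / 2 + γ * I))).trans_lt
      ((mem_ball_iff_norm.1 hs1).trans_le (min_le_right _ _))
    simp only [sub_re, add_re, div_ofNat_re, one_re, mul_re, ofReal_re, I_re, mul_zero, ofReal_im,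
      I_im, mul_one, sub_self, add_zero] at hre
    refine ⟨by linarith [(abs_lt.1 hre).1], fun h => ?_, ?_, hs2.2.1.le, fun h hz => ?_⟩
    · rw [h, zero_sub, abs_neg] at hs2
      linarith
    · exact Metric.ball_subset_ball (min_le_left _ _) hs1
    · have hm : s.im ∈ Metric.ball γ η := by simpa [Real.dist_eq] using hs2.1
      refine hball hm ⟨⟨?_, hz⟩, hs3 h⟩
      have := abs_sub_abs_le_abs_sub s.im γ
      linarith
  refine ⟨_, hη', ?_, ?_, ?_, ?_⟩
  · refine hFan.continuousOn.mono fun s hs => ?_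
    obtain ⟨a1, a2, -, -, a5⟩ := key s hs
    exact ⟨a1, fun h => ⟨a5 h, fun h' => a2 h'.1⟩⟩
  · intro s hs
    obtain ⟨a1, a2, a3, a4, a5⟩ := key s hs
    exact hbound γ hγ h0 s a3 a4 a5
  · intro σ hσ
    have hre : (σ + γ * I : ℂ).re = σ := by simp
    have him : (σ + γ * I : ℂ).im = γ := by simp
    have hr4 : 1 / 4 < (σ + γ * I : ℂ).re := by rw [hre]; linarith [hσ.1]
    have hz1 : (σ + γ * I : ℂ) ≠ 1 := fun h => hγ (by rw [← him, h, one_im])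
    have hz2 : 2 * (σ + γ * I : ℂ) ≠ 1 := fun h => by
      have := congrArg Complex.im h
      simp [hγ] at this
    have hc2 : ContinuousAt (fun s : ℂ => 2 * s) (σ + γ * I) := by fun_prop
    refine ContinuousAt.div (((((differentiableAt_LVal χ hz1).continuousAt.mul
      (differentiableAt_LVal (mulChiNeg4 χ) hz1).continuousAt).pow 2).mul ?_).mul
      (differentiableAt_quarticFactor χ hr4).continuousAt) ?_ (hne _ hr4 (by rwa [him]))
    · exact ContinuousAt.comp' (differentiableAt_LVal (χ ^ 2) hz2).continuousAt hc2
    · exact ContinuousAt.comp' (differentiableAt_LVal (mulChiNeg4 (χ ^ 2)) hz2).continuousAt hc2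
  · intro s hs
    obtain ⟨a1, a2, a3, a4, a5⟩ := key s hs
    rw [eq_div_iff (hne s a1 a2)]
    exact F_pow_four_eq χ hFser hFan a1 a2 a5

open MeasureTheory in
/-- `h` is a superposition of the powers `x ^ s` with `s` in the critical strip at height about `γ`,
with coefficients of total mass at most `b` when weighted by `X ^ Re s`. -/
def IsPowerIntegral (γ X b : ℝ) (h : ℝ → ℂ) : Prop :=
  ∃ (μ : Measure ℝ) (_ : SFinite μ) (w s : ℝ → ℂ), Integrable w μ ∧ Measurable s ∧
    (∀ᵐ u ∂μ, 0 ≤ (s u).re ∧ (s u).re ≤ 1 ∧ |(s u).im - γ| ≤ 1 / 4) ∧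
    (∀ x : ℝ, h x = ∫ u, w u * (x : ℂ) ^ s u ∂μ) ∧
    ∫ u, ‖w u‖ * X ^ (s u).re ∂μ ≤ b

theorem IsPowerIntegral.neg {γ X b : ℝ} {h : ℝ → ℂ} (hh : IsPowerIntegral γ X b h) :
    IsPowerIntegral γ X b (fun x => -h x) := by
  obtain ⟨μ, hμ, w, s, hw, hs, hre, hx, hb⟩ := hh
  exact ⟨μ, hμ, fun u => -w u, s, hw.neg, hs, hre,
    fun x => by simp [hx, MeasureTheory.integral_neg], by simpa using hb⟩

theorem IsPowerIntegral.nonneg {γ X b : ℝ} {h : ℝ → ℂ} (hX : 0 ≤ X) (hh : IsPowerIntegral γ X b h) :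
    0 ≤ b := by
  obtain ⟨μ, -, w, s, -, -, -, -, hb⟩ := hh
  exact (MeasureTheory.integral_nonneg fun u => by positivity).trans hb

theorem IsPowerIntegral.mul_conj {γ₁ γ₂ X b₁ b₂ : ℝ} {f g : ℝ → ℂ} (hX : 1 ≤ X)
    (hf : IsPowerIntegral γ₁ X b₁ f) (hg : IsPowerIntegral γ₂ X b₂ g) :
    IntervalIntegrable (fun x => f x * (starRingEnd ℂ) (g x)) MeasureTheory.volume X (2 * X) ∧
    ‖∫ x in X..(2 * X), f x * (starRingEnd ℂ) (g x)‖ ≤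
      23 * X / (1 + |γ₁ - γ₂|) * (b₁ * b₂) := by
  have hb₁ := hf.nonneg (by linarith)
  obtain ⟨μ, hμ, w, s, hw, hs, hre, hx, hb⟩ := hf
  obtain ⟨ν, hν, w', s', hw', hs', hre', hx', hb'⟩ := hg
  obtain ⟨h1, h2⟩ := norm_integral_mul_conj_le hX hw hw' hs hs' hre hre'
  simp only [hx, hx']
  have i2 : 0 ≤ ∫ u, ‖w' u‖ * X ^ (s' u).re ∂ν :=
    MeasureTheory.integral_nonneg fun u => by positivity
  refine ⟨h1, h2.trans ?_⟩
  gcongr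

theorem norm_integral_sum_mul_conj_le {ι : Type*} [Fintype ι] {γ₁ γ₂ X : ℝ} {b₁ b₂ : ι → ℝ}
    {f g : ι → ℝ → ℂ} (hX : 1 ≤ X) (hf : ∀ i, IsPowerIntegral γ₁ X (b₁ i) (f i))
    (hg : ∀ i, IsPowerIntegral γ₂ X (b₂ i) (g i)) :
    ‖∫ x in X..(2 * X), (∑ i, f i x) * (starRingEnd ℂ) (∑ i, g i x)‖ ≤
      23 * X / (1 + |γ₁ - γ₂|) * ((∑ i, b₁ i) * ∑ i, b₂ i) := by
  simp_rw [map_sum, Finset.sum_mul_sum]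
  have hInt : ∀ i, IntervalIntegrable (fun x => ∑ j, f i x * (starRingEnd ℂ) (g j x))
      MeasureTheory.volume X (2 * X) := fun i => by
    simpa only [Finset.sum_fn] using
      IntervalIntegrable.sum Finset.univ fun j _ => ((hf i).mul_conj hX (hg j)).1
  rw [intervalIntegral.integral_finsetSum fun i _ => hInt i, Finset.mul_sum]
  refine norm_sum_le_of_le _ fun i _ => ?_
  rw [intervalIntegral.integral_finsetSum fun j _ => ((hf i).mul_conj hX (hg j)).1, Finset.mul_sum]
  exact norm_sum_le_of_le _ fun j _ => ((hf i).mul_conj hX (hg j)).2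

theorem inv_norm_le {γ : ℝ} {s : ℂ} (hre : 3 / 8 ≤ s.re) (him : |s.im - γ| ≤ 1 / 8) :
    ‖s‖⁻¹ ≤ 4 / (|γ| + 1) := by
  have a1 := (le_abs_self _).trans (abs_re_le_norm s)
  have a2 := abs_im_le_norm s
  have a3 := abs_sub_abs_le_abs_sub γ s.im
  rw [abs_sub_comm] at a3
  have : 0 < ‖s‖ := by linarith
  rw [inv_le_comm₀ this (by positivity), inv_div, div_le_iff₀ (by norm_num)]
  linarith

theorem integral_sqrt_mul_rpow_le {c r X : ℝ} (hr : 0 < r) (hrc : r ≤ c) (hX : 1 < X) :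
    ∫ σ in (1 / 2 - c)..(1 / 2 - r), (1 / 2 - σ) ^ (1 / 2 : ℝ) * X ^ σ ≤
      X ^ (1 / 2 : ℝ) * (Real.log X ^ (-3 / 2 : ℝ) * Real.Gamma (3 / 2)) := by
  have hX0 : 0 < X := by linarith
  have hl : 0 < Real.log X := Real.log_pos hX
  have e1 : (∫ σ in (1 / 2 - c)..(1 / 2 - r), (1 / 2 - σ) ^ (1 / 2 : ℝ) * X ^ σ) =
      ∫ u in r..c, u ^ (1 / 2 : ℝ) * X ^ (1 / 2 - u) := by
    have := intervalIntegral.integral_comp_sub_left (a := 1 / 2 - c) (b := 1 / 2 - r)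
      (fun u : ℝ => u ^ (1 / 2 : ℝ) * X ^ (1 / 2 - u)) (1 / 2)
    simpa using this
  have e2 : ∀ u : ℝ, u ^ (1 / 2 : ℝ) * X ^ (1 / 2 - u) =
      X ^ (1 / 2 : ℝ) * (u ^ ((3 / 2 : ℝ) - 1) * Real.exp (-(Real.log X * u))) := by
    intro u
    rw [Real.rpow_sub hX0, Real.rpow_def_of_pos hX0 u, Real.exp_neg]
    norm_num
    ring
  have hG := Real.integral_rpow_mul_exp_neg_mul_Ioi (a := 3 / 2) (by norm_num) hl
  have hInt : MeasureTheory.IntegrableOn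
      (fun u : ℝ => u ^ ((3 / 2 : ℝ) - 1) * Real.exp (-(Real.log X * u))) (Set.Ioi 0) := by
    by_contra h
    rw [MeasureTheory.integral_undef h] at hG
    have : 0 < (1 / Real.log X) ^ (3 / 2 : ℝ) * Real.Gamma (3 / 2) :=
      mul_pos (by positivity) (Real.Gamma_pos_of_pos (by norm_num))
    linarith
  rw [e1, intervalIntegral.integral_congr fun u _ => e2 u, intervalIntegral.integral_const_mul]
  gcongr
  rw [intervalIntegral.integral_of_le hrc]
  refine (MeasureTheory.setIntegral_mono_set hInt ?_ ?_).trans (hG.trans ?_).le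
  · filter_upwards [MeasureTheory.ae_restrict_mem measurableSet_Ioi] with u hu
    have : (0 : ℝ) < u := hu
    positivity
  · exact LE.le.eventuallyLE fun u hu => hr.trans hu.1
  · rw [one_div, Real.inv_rpow hl.le, ← Real.rpow_neg hl.le]
    norm_num

open MeasureTheory in
theorem isPowerIntegral_segment {φ : ℝ → ℂ} {γ c B r X : ℝ} (hc : c ≤ 1 / 8) (hB : 0 ≤ B)
    (hφ : AEStronglyMeasurable φ (volume.restrict (Set.Icc (1 / 2 - c) (1 / 2))))
    (hb : ∀ σ ∈ Set.Icc (1 / 2 - c) (1 / 2), ‖φ σ‖ ≤ B * (1 / 2 - σ) ^ (1 / 2 : ℝ))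
    (hr : 0 < r) (hrc : r < c) (hX : 1 < X) :
    IsPowerIntegral γ X (B * (4 / (|γ| + 1)) *
      (X ^ (1 / 2 : ℝ) * (Real.log X ^ (-3 / 2 : ℝ) * Real.Gamma (3 / 2))))
      (fun x => ∫ σ in (1 / 2 - c)..(1 / 2 - r), φ σ * ((x : ℂ) ^ (σ + γ * I) / (σ + γ * I))) := by
  have hX0 : 0 < X := by linarith
  have hle : 1 / 2 - c ≤ 1 / 2 - r := by linarith
  have hs : Continuous fun σ : ℝ => (σ + γ * I : ℂ) := by fun_prop
  have hsub : Set.Ioc (1 / 2 - c) (1 / 2 - r) ⊆ Set.Icc (1 / 2 - c) (1 / 2) :=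
    fun σ hσ => ⟨hσ.1.le, by linarith [hσ.2]⟩
  have hw : ∀ σ ∈ Set.Ioc (1 / 2 - c) (1 / 2 - r),
      ‖φ σ / (σ + γ * I)‖ ≤ B * (4 / (|γ| + 1)) * (1 / 2 - σ) ^ (1 / 2 : ℝ) := by
    intro σ hσ
    have h1 := hb σ (hsub hσ)
    have h3 := (norm_nonneg _).trans h1
    have h2 : ‖(σ + γ * I : ℂ)‖⁻¹ ≤ 4 / (|γ| + 1) :=
      inv_norm_le (by simp; linarith [hσ.1]) (by simp)
    rw [norm_div, div_eq_mul_inv, mul_right_comm]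
    gcongr
  have hcont : ContinuousOn (fun σ : ℝ => B * (4 / (|γ| + 1)) * (1 / 2 - σ) ^ (1 / 2 : ℝ))
      (Set.Icc (1 / 2 - c) (1 / 2 - r)) :=
    (continuous_const.mul ((continuous_const.sub continuous_id).rpow_const
      fun _ => Or.inr (by norm_num))).continuousOn
  have hmeas : AEStronglyMeasurable (fun σ : ℝ => φ σ / (σ + γ * I))
      (volume.restrict (Set.Ioc (1 / 2 - c) (1 / 2 - r))) := by
    simp_rw [div_eq_mul_inv]
    exact (hφ.mono_measure (Measure.restrict_mono hsub le_rfl)).mul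
      hs.measurable.inv.aestronglyMeasurable
  have hInt : IntegrableOn (fun σ : ℝ => φ σ / (σ + γ * I)) (Set.Ioc (1 / 2 - c) (1 / 2 - r)) := by
    refine Integrable.mono' (hcont.integrableOn_Icc.mono_set Set.Ioc_subset_Icc_self) hmeas ?_
    filter_upwards [ae_restrict_mem measurableSet_Ioc] with σ hσ using hw σ hσ
  refine ⟨volume.restrict (Set.Ioc (1 / 2 - c) (1 / 2 - r)), inferInstance,
    fun σ => φ σ / (σ + γ * I), fun σ => σ + γ * I, hInt, hs.measurable, ?_, fun x => ?_, ?_⟩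
  · filter_upwards [ae_restrict_mem measurableSet_Ioc] with σ hσ
    simp only [add_re, ofReal_re, mul_re, I_re, mul_zero, ofReal_im, I_im, mul_one, sub_self,
      add_zero, add_im, mul_im, zero_add]
    exact ⟨by linarith [hσ.1], by linarith [hσ.2], by norm_num⟩
  · beta_reduce
    rw [intervalIntegral.integral_of_le hle]
    congr 1
    ext σ
    ring
  · have hpow : Continuous fun σ : ℝ => X ^ σ := continuous_const.rpow continuous_id
      fun _ => Or.inl hX0.ne'
    have h := integral_sqrt_mul_rpow_le hr hrc.le hX
    rw [intervalIntegral.integral_of_le hle] at h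
    have hcK : 0 ≤ B * (4 / (|γ| + 1)) := by positivity
    refine le_trans ?_ (mul_le_mul_of_nonneg_left h hcK)
    rw [← integral_const_mul]
    refine integral_mono_of_nonneg (Eventually.of_forall fun σ => by positivity) ?_ ?_
    · refine (ContinuousOn.integrableOn_Icc ?_).mono_set Set.Ioc_subset_Icc_self
      simp only [← mul_assoc]
      exact hcont.mul hpow.continuousOn
    · filter_upwards [ae_restrict_mem measurableSet_Ioc] with σ hσ
      have := hw σ hσ
      have hre : (σ + γ * I : ℂ).re = σ := by simp
      simp only [hre]
      rw [← mul_assoc]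
      gcongr

open MeasureTheory in
theorem isPowerIntegral_circle {F : ℂ → ℂ} {γ R η B r X : ℝ} (hB : 0 ≤ B)
    (hF : ContinuousOn F (slitBall γ R η))
    (hb : ∀ s ∈ slitBall γ R η, ‖F s‖ ≤ B * ‖s - (1 / 2 + γ * I)‖ ^ (1 / 2 : ℝ))
    (hr : 0 < r) (hr8 : r ≤ 1 / 8) (hrη : r < η) (hrR : r < R) (hX : 1 < X) :
    IsPowerIntegral γ X (B * (4 / (|γ| + 1)) *
      (X ^ (1 / 2 : ℝ) * (2 * Real.pi * (r ^ (3 / 2 : ℝ) * X ^ r))))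
      (fun x => ∫ θ in (-Real.pi)..Real.pi, F (1 / 2 + γ * I + r * exp (θ * I)) *
        ((x : ℂ) ^ (1 / 2 + γ * I + r * exp (θ * I)) / (1 / 2 + γ * I + r * exp (θ * I))) *
          (I * r * exp (θ * I))) := by
  have hX0 : 0 < X := by linarith
  have hpi : -Real.pi ≤ Real.pi := by linarith [Real.pi_pos]
  let s : ℝ → ℂ := fun θ => 1 / 2 + γ * I + r * exp (θ * I)
  let w : ℝ → ℂ := fun θ => F (s θ) / s θ * (I * r * exp (θ * I))
  have hs : Continuous s := by fun_prop
  have hre : ∀ θ, (s θ).re = 1 / 2 + r * Real.cos θ := fun θ => by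
    simp [s, exp_ofReal_mul_I_re, -one_div]
  have him : ∀ θ, (s θ).im = γ + r * Real.sin θ := fun θ => by
    simp [s, exp_ofReal_mul_I_im]
  have hdist : ∀ θ, ‖s θ - (1 / 2 + γ * I)‖ = r := fun θ => by
    simp [s, norm_exp_ofReal_mul_I, abs_of_pos hr]
  have hcos : ∀ θ, |r * Real.cos θ| ≤ r := fun θ => by
    rw [abs_mul, abs_of_pos hr]
    exact mul_le_of_le_one_right hr.le (Real.abs_cos_le_one θ)
  have hsin : ∀ θ, |r * Real.sin θ| ≤ r := fun θ => by
    rw [abs_mul, abs_of_pos hr]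
    exact mul_le_of_le_one_right hr.le (Real.abs_sin_le_one θ)
  have hsne : ∀ θ, s θ ≠ 0 := fun θ h => by
    have := hre θ
    rw [h, zero_re] at this
    linarith [(abs_le.1 (hcos θ)).1]
  have hmem : ∀ θ ∈ Set.Ioo (-Real.pi) Real.pi, s θ ∈ slitBall γ R η := by
    intro θ hθ
    refine ⟨by rwa [mem_ball_iff_norm, hdist], ?_, fun h1 h2 => ?_⟩
    · rw [him, add_sub_cancel_left]
      exact (hsin θ).trans_lt hrη
    · rw [him, add_eq_left, mul_eq_zero, or_iff_right hr.ne',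
        Real.sin_eq_zero_iff_of_lt_of_lt hθ.1 hθ.2] at h2
      rw [hre, h2, Real.cos_zero] at h1
      linarith
  have hIoo : ∀ᵐ θ ∂(volume.restrict (Set.Ioc (-Real.pi) Real.pi)),
      θ ∈ Set.Ioo (-Real.pi) Real.pi := by
    rw [← Measure.restrict_congr_set Ioo_ae_eq_Ioc]
    exact ae_restrict_mem measurableSet_Ioo
  have hw : ∀ θ ∈ Set.Ioo (-Real.pi) Real.pi,
      ‖w θ‖ ≤ B * (4 / (|γ| + 1)) * r ^ (3 / 2 : ℝ) := by
    intro θ hθ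
    have h1 := hb _ (hmem θ hθ)
    have h2 : ‖s θ‖⁻¹ ≤ 4 / (|γ| + 1) :=
      inv_norm_le (by rw [hre]; linarith [(abs_le.1 (hcos θ)).1])
        (by rw [him, add_sub_cancel_left]; exact (hsin θ).trans hr8)
    rw [hdist] at h1
    have h3 : r ^ (3 / 2 : ℝ) = r ^ (1 / 2 : ℝ) * r := by
      rw [← Real.rpow_add_one hr.ne']; norm_num
    simp only [w, norm_mul, norm_div, norm_I, one_mul, norm_exp_ofReal_mul_I, mul_one, norm_real,
      Real.norm_of_nonneg hr.le]
    rw [div_eq_mul_inv, h3]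
    calc ‖F (s θ)‖ * ‖s θ‖⁻¹ * r ≤ (B * r ^ (1 / 2 : ℝ)) * (4 / (|γ| + 1)) * r := by gcongr
      _ = _ := by ring
  have hwm : AEStronglyMeasurable w (volume.restrict (Set.Ioc (-Real.pi) Real.pi)) := by
    rw [← Measure.restrict_congr_set Ioo_ae_eq_Ioc]
    refine ContinuousOn.aestronglyMeasurable ?_ measurableSet_Ioo
    refine ((hF.comp hs.continuousOn hmem).div hs.continuousOn fun θ _ => hsne θ).mul ?_
    fun_prop
  refine ⟨volume.restrict (Set.Ioc (-Real.pi) Real.pi), inferInstance, w, s, ?_, hs.measurable,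
    Eventually.of_forall fun θ => ?_, fun x => ?_, ?_⟩
  · refine Integrable.mono' (integrable_const (B * (4 / (|γ| + 1)) * r ^ (3 / 2 : ℝ))) hwm ?_
    filter_upwards [hIoo] with θ hθ using hw θ hθ
  · have := abs_le.1 (hcos θ)
    rw [hre, him, add_sub_cancel_left]
    exact ⟨by linarith, by linarith, (hsin θ).trans (by linarith)⟩
  · beta_reduce
    rw [intervalIntegral.integral_of_le hpi]
    congr 1
    ext θ
    simp only [w, s]
    ring
  · have hbd : ∀ᵐ θ ∂(volume.restrict (Set.Ioc (-Real.pi) Real.pi)), ‖w θ‖ * X ^ (s θ).re ≤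
        B * (4 / (|γ| + 1)) * r ^ (3 / 2 : ℝ) * X ^ (1 / 2 + r) := by
      filter_upwards [hIoo] with θ hθ
      have h1 := hw θ hθ
      have h2 : (s θ).re ≤ 1 / 2 + r := by rw [hre]; linarith [(abs_le.1 (hcos θ)).2]
      have := hX.le
      gcongr
    refine (integral_mono_of_nonneg (Eventually.of_forall fun θ => by positivity)
      (integrable_const _) hbd).trans ?_
    rw [integral_const, Measure.real, Measure.restrict_apply_univ, Real.volume_Ioc,
      ENNReal.toReal_ofReal (by linarith), smul_eq_mul, Real.rpow_add hX0]
    exact le_of_eq (by ring)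

theorem exists_isPowerIntegral_fin_three {γ X b₀ b₁ b₂ : ℝ} {f₀ f₁ f₂ : ℝ → ℂ}
    (h₀ : IsPowerIntegral γ X b₀ f₀) (h₁ : IsPowerIntegral γ X b₁ f₁)
    (h₂ : IsPowerIntegral γ X b₂ f₂) :
    ∃ (f : Fin 3 → ℝ → ℂ) (b : Fin 3 → ℝ), (∀ i, IsPowerIntegral γ X (b i) (f i)) ∧
      (∀ x, ∑ i, f i x = f₀ x + f₁ x + f₂ x) ∧ ∑ i, b i = b₀ + b₁ + b₂ := by
  refine ⟨![f₀, f₁, f₂], ![b₀, b₁, b₂], fun i => ?_, fun x => ?_, ?_⟩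
  · fin_cases i
    exacts [h₀, h₁, h₂]
  · simp [Fin.sum_univ_three]
  · simp [Fin.sum_univ_three]

theorem exists_hankelIntegral_eq_sum {q : ℕ} [NeZero q] (χ : DirichletCharacter ℂ q)
    (h1 : GRH χ) (h2 : GRH (mulChiNeg4 χ)) (h3 : GRH (χ ^ 2)) (h4 : GRH (mulChiNeg4 (χ ^ 2)))
    {F : ℂ → ℂ} (hFser : ∀ s : ℂ, 1 < s.re → F s = LSeries (STwist χ) s)
    (hFan : DifferentiableOn ℂ F {s : ℂ | 1 / 4 < s.re ∧ (s.re ≤ 1 / 2 →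
      LVal χ (1 / 2 + s.im * I) * LVal (mulChiNeg4 χ) (1 / 2 + s.im * I) ≠ 0 ∧
      ¬(s.im = 0 ∧ (χ ^ 2 = 1 ∨ mulChiNeg4 (χ ^ 2) = 1)))})
    {c ε : ℝ} (hc0 : 0 < c) (hc1 : c < 1 / 8) (hε : 0 < ε) :
    ∃ K, ∀ γ : ℝ, γ ≠ 0 →
      LVal χ (1 / 2 + γ * I) * LVal (mulChiNeg4 χ) (1 / 2 + γ * I) = 0 →
      ∃ r₀ > 0, ∀ r, 0 < r → r < r₀ → ∀ X : ℝ, 1 < X →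
        ∃ (f : Fin 3 → ℝ → ℂ) (b : Fin 3 → ℝ), (∀ i, IsPowerIntegral γ X (b i) (f i)) ∧
          (∀ x : ℝ, 0 < x →
            hankelIntegral (fun s => F s * (x : ℂ) ^ s / s) (1 / 2 + γ * I) c r = ∑ i, f i x) ∧
          ∑ i, b i ≤ K * (|γ| + 1) ^ (c + ε - 1) *
            (X ^ (1 / 2 : ℝ) * (Real.log X ^ (-3 / 2 : ℝ) + r ^ (3 / 2 : ℝ) * X ^ r)) := by
  obtain ⟨C, R, G, hC, hcR, hdata⟩ := exists_slitBall_data χ h1 h2 h3 h4 hFser hFan hc0 hc1 hε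
  have hΓ : 0 < Real.Gamma (3 / 2) := Real.Gamma_pos_of_pos (by norm_num)
  refine ⟨4 * C * (2 * Real.Gamma (3 / 2) + 2 * Real.pi), fun γ hγ h0 => ?_⟩
  obtain ⟨η, hη, hF, hb, hG, hFG⟩ := hdata γ hγ h0
  have hB : 0 ≤ C * (|γ| + 1) ^ (c + ε) := by positivity
  obtain ⟨φ₁, φ₂, ⟨m1, b1⟩, ⟨m2, b2⟩, hH⟩ :=
    hankelIntegral_eq (by linarith) hcR hη hB hF hb hG hFG
  refine ⟨min c η, lt_min hc0 hη, fun r hr hrr X hX => ?_⟩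
  obtain ⟨hrc, hrη⟩ := lt_min_iff.1 hrr
  have p1 := isPowerIntegral_segment (γ := γ) hc1.le hB m1 b1 hr hrc hX
  have p2 := isPowerIntegral_circle hB hF hb hr (by linarith) hrη (by linarith) hX
  have p3 := (isPowerIntegral_segment (γ := γ) hc1.le hB m2 b2 hr hrc hX).neg
  obtain ⟨f, b, hfb, hf, hbsum⟩ := exists_isPowerIntegral_fin_three p1 p2 p3
  refine ⟨f, b, hfb, fun x hx => ?_, ?_⟩
  · have hk : ContinuousOn (fun s : ℂ => (x : ℂ) ^ s / s) {s | 0 < s.re} := by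
      have hx' : (x : ℂ) ≠ 0 := by exact_mod_cast hx.ne'
      refine ContinuousOn.div (fun s _ => ?_) continuousOn_id fun s hs h => ?_
      · exact (continuousAt_const_cpow hx').continuousWithinAt
      · simp [h] at hs
    have := hH _ hk r hr hrc
    simp only [← mul_div_assoc] at this
    rw [this, hf]
    simp only [← mul_div_assoc, sub_eq_add_neg]
  · have hX0 : 0 < X := by linarith
    have hl := Real.log_pos hX
    have hL : 0 < Real.log X ^ (-3 / 2 : ℝ) := by positivity
    have hP : 0 < r ^ (3 / 2 : ℝ) * X ^ r := by positivity
    have hpi := Real.pi_pos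
    rw [hbsum, Real.rpow_sub_one (by positivity)]
    generalize Real.log X ^ (-3 / 2 : ℝ) = L at *
    generalize r ^ (3 / 2 : ℝ) * X ^ r = P at *
    generalize Real.Gamma (3 / 2) = g at *
    calc _ = 4 * C * ((|γ| + 1) ^ (c + ε) / (|γ| + 1)) * X ^ (1 / 2 : ℝ) *
          (2 * g * L + 2 * Real.pi * P) := by ring
      _ ≤ 4 * C * ((|γ| + 1) ^ (c + ε) / (|γ| + 1)) * X ^ (1 / 2 : ℝ) *
          ((2 * g + 2 * Real.pi) * (L + P)) := by
        gcongr
        nlinarith [mul_pos hpi hL, mul_pos hΓ hP]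
      _ = _ := by ring

/-- **Lemma 4.3:** mean-square bound for products of two Hankel loop integrals. -/
theorem hankel_mean_square_bound
    (q : ℕ) (hq : 0 < q) (χ : DirichletCharacter ℂ q) (hχ : χ ≠ 1)
    (h1 : GRH χ) (h2 : GRH (mulChiNeg4 χ)) (h3 : GRH (χ ^ 2)) (h4 : GRH (mulChiNeg4 (χ ^ 2)))
    (c : ℝ) (hc0 : 0 < c) (hc1 : c < 1 / 8) (ε : ℝ) (hε : 0 < ε)
    (F : ℂ → ℂ)
    (hFser : ∀ s : ℂ, 1 < s.re → F s = LSeries (STwist χ) s)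
    (hFan : DifferentiableOn ℂ F {s : ℂ | 1 / 4 < s.re ∧ (s.re ≤ 1 / 2 →
      LVal χ (1 / 2 + s.im * I) * LVal (mulChiNeg4 χ) (1 / 2 + s.im * I) ≠ 0 ∧
      ¬(s.im = 0 ∧ (χ ^ 2 = 1 ∨ mulChiNeg4 (χ ^ 2) = 1)))}) :
    ∃ C : ℝ, ∀ γ₁ γ₂ : ℝ, γ₁ ≠ 0 → γ₂ ≠ 0 →
      LVal χ (1 / 2 + γ₁ * I) * LVal (mulChiNeg4 χ) (1 / 2 + γ₁ * I) = 0 →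
      LVal χ (1 / 2 + γ₂ * I) * LVal (mulChiNeg4 χ) (1 / 2 + γ₂ * I) = 0 →
      ∀ X : ℝ, 2 ≤ X → ∃ r₀ : ℝ, 0 < r₀ ∧ ∀ r : ℝ, 0 < r → r < r₀ →
        ‖(1 / (X : ℂ)) * ∫ x in X..(2 * X),
            hankelIntegral (fun s => F s * (x : ℂ) ^ s / s) (1 / 2 + γ₁ * I) c r *
              (starRingEnd ℂ)
                (hankelIntegral (fun s => F s * (x : ℂ) ^ s / s) (1 / 2 + γ₂ * I) c r)‖
          ≤ C * X * (Real.log X ^ (-(3 : ℝ) / 2) + r ^ ((3 : ℝ) / 2) * X ^ r) ^ 2 /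
              (((|γ₁| + 1) * (|γ₂| + 1)) ^ (1 - c - ε) * (1 + |γ₁ - γ₂|)) := by
  have : NeZero q := ⟨hq.ne'⟩
  obtain ⟨K, hK⟩ := exists_hankelIntegral_eq_sum χ h1 h2 h3 h4 hFser hFan hc0 hc1 hε
  refine ⟨23 * K ^ 2, fun γ₁ γ₂ hγ₁ hγ₂ hz₁ hz₂ X hX => ?_⟩
  obtain ⟨ρ₁, hρ₁, H₁⟩ := hK γ₁ hγ₁ hz₁
  obtain ⟨ρ₂, hρ₂, H₂⟩ := hK γ₂ hγ₂ hz₂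
  refine ⟨min ρ₁ ρ₂, lt_min hρ₁ hρ₂, fun r hr hrr => ?_⟩
  obtain ⟨hr₁, hr₂⟩ := lt_min_iff.1 hrr
  obtain ⟨f, b, hf, hfx, hb⟩ := H₁ r hr hr₁ X (by linarith)
  obtain ⟨g, d, hg, hgx, hd⟩ := H₂ r hr hr₂ X (by linarith)
  have hX0 : 0 < X := by linarith
  have hmain := norm_integral_sum_mul_conj_le (by linarith) hf hg
  have hcongr : (∫ x in X..(2 * X),
      hankelIntegral (fun s => F s * (x : ℂ) ^ s / s) (1 / 2 + γ₁ * I) c r * (starRingEnd ℂ)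
        (hankelIntegral (fun s => F s * (x : ℂ) ^ s / s) (1 / 2 + γ₂ * I) c r)) =
      ∫ x in X..(2 * X), (∑ i, f i x) * (starRingEnd ℂ) (∑ i, g i x) := by
    refine intervalIntegral.integral_congr fun x hx => ?_
    rw [Set.uIcc_of_le (by linarith)] at hx
    have hx0 : 0 < x := hX0.trans_le hx.1
    simp only [hfx x hx0, hgx x hx0]
  have hb0 : 0 ≤ ∑ i, b i := Finset.sum_nonneg fun i _ => (hf i).nonneg hX0.le
  have hd0 : 0 ≤ ∑ i, d i := Finset.sum_nonneg fun i _ => (hg i).nonneg hX0.le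
  have hbd := mul_le_mul hb hd hd0 (hb0.trans hb)
  have hsq : X ^ (1 / 2 : ℝ) * X ^ (1 / 2 : ℝ) = X := by
    rw [← Real.rpow_add hX0]
    norm_num
  rw [hcongr, norm_mul, norm_div, norm_one, norm_real, Real.norm_of_nonneg hX0.le]
  refine (mul_le_mul_of_nonneg_left (hmain.trans (mul_le_mul_of_nonneg_left hbd (by positivity)))
    (by positivity)).trans_eq ?_
  have e : 1 - c - ε = -(c + ε - 1) := by ring
  rw [e, Real.rpow_neg (by positivity), Real.mul_rpow (by positivity) (by positivity)]
  generalize Real.log X ^ (-3 / 2 : ℝ) + r ^ (3 / 2 : ℝ) * X ^ r = P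
  have n1 : (|γ₁| + 1) ^ (c + ε - 1) ≠ 0 := by positivity
  have n2 : (|γ₂| + 1) ^ (c + ε - 1) ≠ 0 := by positivity
  calc _ = 1 / X * (23 * X / (1 + |γ₁ - γ₂|) * (K ^ 2 * ((|γ₁| + 1) ^ (c + ε - 1) *
        (|γ₂| + 1) ^ (c + ε - 1)) * (X ^ (1 / 2 : ℝ) * X ^ (1 / 2 : ℝ)) * P ^ 2)) := by ring
    _ = _ := by
      rw [hsq]
      field_simp

end
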